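/- arXiv:2309.14275 — 2 statements merged into one kernel-verified Lean document; each statement's English description precedes it below -/
import Mathlib

section
/- There exists a constant c > 0 such that for every finite nonempty set S ⊂ ℤ² and every function a : ℤ² → ℂ supported on S, the function u(t,x) = Σ_{ξ∈S} a(ξ) e^{i(ξ·x − t|ξ|²)} satisfies (∫_0^{1/Log(#S)} ∫_{𝕋²} |u(t,x)|⁴ dx dt)^{1/4} ≤ c (Σ_{ξ∈S} |a(ξ)|²)^{1/2}. -/
open MeasureTheory
open scoped BigOperators Real

namespace LocalStrichartz

open Finset

/-- Height at abscissa `x` of the non-vertical line `l = (slope, intercept)`. -/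
def lineAt (l : ℝ × ℝ) (x : ℝ) : ℝ := l.1 * x + l.2

/-- Two segments, given by their endpoints and supporting lines, cross transversally. -/
def SegCross {ι : Type*} (u v l : ι → ℝ × ℝ) (e e' : ι) : Prop :=
  ∃ x₁ x₂ : ℝ, ((u e).1 ≤ x₁ ∧ (u e').1 ≤ x₁ ∧ x₁ ≤ (v e).1 ∧ x₁ ≤ (v e').1) ∧
    ((u e).1 ≤ x₂ ∧ (u e').1 ≤ x₂ ∧ x₂ ≤ (v e).1 ∧ x₂ ≤ (v e').1) ∧
    lineAt (l e) x₁ < lineAt (l e') x₁ ∧ lineAt (l e') x₂ < lineAt (l e) x₂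

lemma SegCross.symm {ι : Type*} {u v l : ι → ℝ × ℝ} {e e' : ι} (h : SegCross u v l e e') :
    SegCross u v l e' e := by
  obtain ⟨x₁, x₂, ⟨a, b, c, d⟩, ⟨a', b', c', d'⟩, h1, h2⟩ := h
  exact ⟨x₂, x₁, ⟨b', a', d', c'⟩, ⟨b, a, d, c⟩, h2, h1⟩

lemma SegCross.exists_inner {ι : Type*} {u v l : ι → ℝ × ℝ} {e e' : ι}
    (h : SegCross u v l e e') :
    (l e).1 ≠ (l e').1 ∧ ∃ x, lineAt (l e) x = lineAt (l e') x ∧ (u e).1 < x ∧ (u e').1 < x ∧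
      x < (v e).1 ∧ x < (v e').1 := by
  obtain ⟨x₁, x₂, ⟨a, b, c, d⟩, ⟨a', b', c', d'⟩, h1, h2⟩ := h
  simp only [lineAt] at *
  have hne : (l e).1 ≠ (l e').1 := by
    intro h; rw [h] at h1 h2; linarith
  refine ⟨hne, ((l e').2 - (l e).2) / ((l e).1 - (l e').1), ?_⟩
  have hs : (l e).1 - (l e').1 ≠ 0 := sub_ne_zero.2 hne
  have heq : ((l e).1 - (l e').1) * (((l e').2 - (l e).2) / ((l e).1 - (l e').1)) =
    (l e').2 - (l e).2 := by field_simp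
  set x := ((l e').2 - (l e).2) / ((l e).1 - (l e').1)
  have h3 : ((l e).1 - (l e').1) * (x₁ - x) < 0 := by linarith
  have h4 : 0 < ((l e).1 - (l e').1) * (x₂ - x) := by linarith
  refine ⟨by linarith, ?_⟩
  rcases lt_or_gt_of_ne hs with h | h
  · have := (neg_iff_pos_of_mul_neg h3).1 h
    have := (neg_iff_neg_of_mul_pos h4).1 h
    refine ⟨?_, ?_, ?_, ?_⟩ <;> linarith
  · have := (pos_iff_neg_of_mul_neg h3).1 h
    have := (pos_iff_pos_of_mul_pos h4).1 h
    refine ⟨?_, ?_, ?_, ?_⟩ <;> linarith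

/-- A planar family of segments with at most one segment per (left endpoint, slope) has at most
`3 n` members. -/
lemma card_le_of_no_cross {ι : Type*} (E : Finset ι) (u v l : ι → ℝ × ℝ)
    (W : Finset (ℝ × ℝ)) (hW : Set.InjOn Prod.fst (W : Set (ℝ × ℝ)))
    (huW : ∀ e ∈ E, u e ∈ W) (hvW : ∀ e ∈ E, v e ∈ W)
    (huv : ∀ e ∈ E, (u e).1 < (v e).1)
    (hul : ∀ e ∈ E, (u e).2 = lineAt (l e) (u e).1)
    (hvl : ∀ e ∈ E, (v e).2 = lineAt (l e) (v e).1)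
    (hinj : ∀ e ∈ E, ∀ e' ∈ E, u e = u e' → (l e).1 = (l e').1 → e = e')
    (hcr : ∀ e ∈ E, ∀ e' ∈ E, ¬ SegCross u v l e e') :
    #E ≤ 3 * #W := by
  classical
  set Top : Finset ι := {e ∈ E | ∀ e' ∈ E, u e = u e' → (l e').1 ≤ (l e).1} with hTop
  have hT : #Top ≤ #W := by
    apply Finset.card_le_card_of_injOn u
    · intro e he; exact huW e (mem_filter.1 he).1
    · intro e he e' he' h
      have h1 := mem_filter.1 he; have h2 := mem_filter.1 he'
      exact hinj e h1.1 e' h2.1 h (le_antisymm (h2.2 e h1.1 h.symm) (h1.2 e' h2.1 h))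
  have key : ∀ e ∈ E \ Top, ∃ e' ∈ E, u e' = u e ∧ (l e).1 < (l e').1 ∧
      (∀ e'' ∈ E, u e'' = u e → (l e).1 < (l e'').1 → (l e').1 ≤ (l e'').1) ∧
      ∃ w ∈ W, (u e).1 < w.1 ∧ lineAt (l e) w.1 ≤ w.2 ∧ w.2 ≤ lineAt (l e') w.1 ∧
        w.1 ≤ (v e).1 ∧ w.1 ≤ (v e').1 ∧
        ∀ w' ∈ W, (u e).1 < w'.1 → w'.1 < w.1 → lineAt (l e) w'.1 ≤ w'.2 →
          ¬ w'.2 ≤ lineAt (l e') w'.1 := by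
    intro e he
    rw [mem_sdiff] at he
    have hne : ({e' ∈ E | u e' = u e ∧ (l e).1 < (l e').1} : Finset ι).Nonempty := by
      by_contra hcon
      rw [not_nonempty_iff_eq_empty, filter_eq_empty_iff] at hcon
      refine he.2 (mem_filter.2 ⟨he.1, fun e' he' h => ?_⟩)
      by_contra hlt
      exact hcon he' ⟨h.symm, not_le.1 hlt⟩
    obtain ⟨e', he', hmin⟩ := exists_min_image _ (fun e => (l e).1) hne
    rw [mem_filter] at he'
    obtain ⟨he'E, hu, hsl⟩ := he'
    refine ⟨e', he'E, hu, hsl, fun e'' h1 h2 h3 => hmin e'' (mem_filter.2 ⟨h1, h2, h3⟩), ?_⟩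
    have hb : ∀ x, (u e).1 < x → lineAt (l e) x < lineAt (l e') x := by
      intro x hx
      have h1 := hul e he.1; have h2 := hul e' he'E
      rw [hu] at h2
      simp only [lineAt] at *
      nlinarith
    set Q : Finset (ℝ × ℝ) := {w ∈ W | (u e).1 < w.1 ∧ lineAt (l e) w.1 ≤ w.2 ∧
      w.2 ≤ lineAt (l e') w.1} with hQ
    have hq : ∃ w ∈ Q, w.1 ≤ (v e).1 ∧ w.1 ≤ (v e').1 := by
      have h1 := huv e he.1
      have h2 := huv e' he'E
      rw [hu] at h2
      rcases le_total (v e).1 (v e').1 with h | h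
      · refine ⟨v e, mem_filter.2 ⟨hvW e he.1, h1, (hvl e he.1).ge, ?_⟩, le_rfl, h⟩
        rw [hvl e he.1]; exact (hb _ h1).le
      · refine ⟨v e', mem_filter.2 ⟨hvW e' he'E, h2, ?_, (hvl e' he'E).le⟩, h, le_rfl⟩
        rw [hvl e' he'E]; exact (hb _ h2).le
    obtain ⟨w0, hw0, h01, h02⟩ := hq
    obtain ⟨w, hw, hwmin⟩ := exists_min_image Q Prod.fst ⟨w0, hw0⟩
    have hw' := mem_filter.1 hw
    refine ⟨w, hw'.1, hw'.2.1, hw'.2.2.1, hw'.2.2.2, (hwmin _ hw0).trans h01,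
      (hwmin _ hw0).trans h02, ?_⟩
    intro w' hw'W h1 h2 h3 h4
    exact absurd (hwmin w' (mem_filter.2 ⟨hw'W, h1, h3, h4⟩)) (not_le.2 h2)
  choose! n hnE hnu hns hnmin w hwW hwu hwl hwn hwv hwv' hwmin using key
  have hNT : #(E \ Top) ≤ #(W ×ˢ (univ : Finset Prop)) := by
    apply Finset.card_le_card_of_injOn (fun e => (w e, lineAt (l e) (w e).1 < (w e).2))
    · intro e he; exact mem_product.2 ⟨hwW e he, mem_univ _⟩
    · have aux : ∀ e₁ ∈ E \ Top, ∀ e₂ ∈ E \ Top, w e₁ = w e₂ →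
          ((lineAt (l e₁) (w e₁).1 < (w e₁).2) ↔ (lineAt (l e₂) (w e₂).1 < (w e₂).2)) →
          lineAt (l e₁) (w e₁).1 < lineAt (l (n e₂)) (w e₁).1 := by
        intro e₁ h₁ e₂ h₂ hw ht
        by_cases h : lineAt (l e₁) (w e₁).1 < (w e₁).2
        · have := hwn e₂ h₂
          rw [← hw] at this
          exact h.trans_le this
        · have h' := fun hh => h (ht.2 hh)
          have e1 := le_antisymm (hwl e₁ h₁) (not_lt.1 h)
          have e2 := le_antisymm (hwl e₂ h₂) (not_lt.1 h')
          rw [e1, hw, ← e2]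
          have hE2 := (mem_sdiff.1 h₂).1
          have g1 := hul e₂ hE2; have g2 := hul _ (hnE e₂ h₂)
          rw [hnu e₂ h₂] at g2
          have g3 := hns e₂ h₂
          have g4 := hwu e₂ h₂
          simp only [lineAt] at *
          nlinarith
      have aux2 : ∀ e₁ ∈ E \ Top, ∀ e₂ ∈ E \ Top, w e₁ = w e₂ →
          ((lineAt (l e₁) (w e₁).1 < (w e₁).2) ↔ (lineAt (l e₂) (w e₂).1 < (w e₂).2)) →
          ¬ (u e₁).1 < (u e₂).1 := by
        intro e₁ h₁ e₂ h₂ hw ht hlt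
        have a1 := aux e₁ h₁ e₂ h₂ hw ht
        have a2 := aux e₂ h₂ e₁ h₁ hw.symm ht.symm
        have hE1 := (mem_sdiff.1 h₁).1
        have hE2 := (mem_sdiff.1 h₂).1
        have b := hwmin e₁ h₁ (u e₂) (huW _ hE2) hlt (hw ▸ hwu e₂ h₂)
        have c1 := hwv e₁ h₁; have c2 := hwv' e₁ h₁; have c3 := hwv e₂ h₂; have c4 := hwv' e₂ h₂
        have d := hwu e₂ h₂
        have k1 := hul e₂ hE2; have k2 := hul _ (hnE e₂ h₂)
        rw [hnu e₂ h₂] at k2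
        rw [← hw] at a2 c3 c4 d
        by_cases hb : lineAt (l e₁) (u e₂).1 ≤ (u e₂).2
        · have b' := not_le.1 (b hb)
          rw [k1] at b'
          refine hcr e₂ hE2 _ (hnE e₁ h₁) ⟨(w e₁).1, (u e₂).1, ⟨?_, ?_, ?_, ?_⟩,
            ⟨?_, ?_, ?_, ?_⟩, a2, b'⟩ <;> (try rw [hnu e₁ h₁]) <;> linarith
        · have b' := not_le.1 hb
          rw [k2] at b'
          refine hcr e₁ hE1 _ (hnE e₂ h₂) ⟨(w e₁).1, (u e₂).1, ⟨?_, ?_, ?_, ?_⟩,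
            ⟨?_, ?_, ?_, ?_⟩, a1, b'⟩ <;> (try rw [hnu e₂ h₂]) <;> linarith
      have aux3 : ∀ e₁ ∈ E \ Top, ∀ e₂ ∈ E \ Top, w e₁ = w e₂ →
          ((lineAt (l e₁) (w e₁).1 < (w e₁).2) ↔ (lineAt (l e₂) (w e₂).1 < (w e₂).2)) →
          u e₁ = u e₂ → ¬ (l e₁).1 < (l e₂).1 := by
        intro e₁ h₁ e₂ h₂ hw ht hu hlt
        have a2 := aux e₂ h₂ e₁ h₁ hw.symm ht.symm
        have hE2 := (mem_sdiff.1 h₂).1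
        have b := hnmin e₁ h₁ e₂ hE2 hu.symm hlt
        have k1 := hul e₂ hE2; have k2 := hul _ (hnE e₁ h₁)
        rw [hnu e₁ h₁, hu] at k2
        have d := hwu e₂ h₂
        simp only [lineAt] at *
        nlinarith
      intro e₁ h₁ e₂ h₂ h
      simp only [Prod.mk.injEq, eq_iff_iff] at h
      have h₁' : e₁ ∈ E \ Top := h₁
      have h₂' : e₂ ∈ E \ Top := h₂
      have hE1 := (mem_sdiff.1 h₁').1
      have hE2 := (mem_sdiff.1 h₂').1
      have hu : u e₁ = u e₂ := hW (huW _ hE1) (huW _ hE2) (le_antisymm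
        (not_lt.1 (aux2 _ h₂' _ h₁' h.1.symm h.2.symm)) (not_lt.1 (aux2 _ h₁' _ h₂' h.1 h.2)))
      exact hinj _ hE1 _ hE2 hu (le_antisymm
        (not_lt.1 (aux3 _ h₂' _ h₁' h.1.symm h.2.symm hu.symm))
        (not_lt.1 (aux3 _ h₁' _ h₂' h.1 h.2 hu)))
  rw [card_product, Finset.card_univ, Fintype.card_prop] at hNT
  have hsub : Top ⊆ E := filter_subset _ _
  have := card_sdiff_add_card_eq_card hsub
  omega

lemma card_coloring_filter {α : Type*} [DecidableEq α] [Fintype α] (k : ℕ) (T : Finset α)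
    (c : Fin k) :
    #{χ : α → Fin k | ∀ i ∈ T, χ i = c} * k ^ #T = k ^ Fintype.card α := by
  have : ({χ : α → Fin k | ∀ i ∈ T, χ i = c} : Finset (α → Fin k)) =
      Fintype.piFinset (fun i => if i ∈ T then {c} else univ) := by
    ext χ
    simp only [mem_filter, mem_univ, true_and, Fintype.mem_piFinset]
    refine forall_congr' fun i => ?_
    split_ifs with h <;> simp [h]
  rw [this, Fintype.card_piFinset]
  have h2 : ∀ i, #(if i ∈ T then ({c} : Finset (Fin k)) else univ) = if i ∈ T then 1 else k := by
    intro i; split_ifs <;> simp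
  simp_rw [h2]
  rw [prod_ite, prod_const, prod_const, one_pow, one_mul, ← pow_add]
  congr 1
  have : #({x | x ∈ T} : Finset α) = #T := by congr 1; ext; simp
  rw [add_comm, ← this, card_filter_add_card_filter_not, Finset.card_univ]

/-- Colouring the vertices with `k` colours at random amplifies a crossing inequality. -/
lemma card_le_add_crossings {α ι : Type} [DecidableEq α] [Fintype α] (E : Finset ι)
    (u v : ι → α) (C : ι → ι → Prop) [DecidableRel C] (k : ℕ) (hk : 1 ≤ k)
    (huv : ∀ e ∈ E, u e ≠ v e)
    (hC : ∀ e ∈ E, ∀ e' ∈ E, C e e' → u e ≠ u e' ∧ u e ≠ v e' ∧ v e ≠ u e' ∧ v e ≠ v e')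
    (hplane : ∀ W : Finset α, ∀ E' ⊆ E, (∀ e ∈ E', u e ∈ W ∧ v e ∈ W) →
      (∀ e ∈ E', ∀ e' ∈ E', ¬ C e e') → #E' ≤ 3 * #W) :
    (#E : ℝ) ≤ 3 * Fintype.card α * k + #{p ∈ E ×ˢ E | C p.1 p.2} / k ^ 2 := by
  classical
  have hk0 : (0 : ℝ) < k := by exact_mod_cast hk
  set n := Fintype.card α
  set Cr : Finset (ι × ι) := {p ∈ E ×ˢ E | C p.1 p.2}
  have one (χ : α → Fin k) (c : Fin k) :
      #{e ∈ E | ∀ i ∈ ({u e, v e} : Finset α), χ i = c} ≤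
        3 * #{i : α | ∀ j ∈ ({i} : Finset α), χ j = c}
        + #{p ∈ Cr | ∀ i ∈ ({u p.1, v p.1, u p.2, v p.2} : Finset α), χ i = c} := by
    set Ec : Finset ι := {e ∈ E | ∀ i ∈ ({u e, v e} : Finset α), χ i = c} with hEc
    set Crc : Finset (ι × ι) :=
      {p ∈ Cr | ∀ i ∈ ({u p.1, v p.1, u p.2, v p.2} : Finset α), χ i = c} with hCrc
    have h1 : #(Ec \ Crc.image Prod.fst) ≤ 3 * #{i : α | ∀ j ∈ ({i} : Finset α), χ j = c} := by
      apply hplane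
      · exact sdiff_subset.trans (filter_subset _ _)
      · intro e he
        have := (mem_filter.1 (mem_sdiff.1 he).1).2
        simp only [mem_insert, mem_singleton, forall_eq_or_imp, forall_eq] at this
        simpa using this
      · intro e he e' he' hCC
        obtain ⟨h1, h2⟩ := mem_sdiff.1 he
        obtain ⟨h1', -⟩ := mem_sdiff.1 he'
        apply h2
        refine mem_image.2 ⟨(e, e'), ?_, rfl⟩
        simp only [hEc, mem_filter, mem_insert, mem_singleton, forall_eq_or_imp,
          forall_eq] at h1 h1'
        simp only [hCrc, Cr, mem_filter, mem_product, mem_insert, mem_singleton, forall_eq_or_imp,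
          forall_eq]
        tauto
    have h2 : #Ec ≤ #(Ec \ Crc.image Prod.fst) + #(Crc.image Prod.fst) := by
      rw [← Nat.sub_le_iff_le_add]; exact le_card_sdiff _ _
    have h3 : #(Crc.image Prod.fst) ≤ #Crc := card_image_le
    omega
  have swap {β : Type} (B : Finset β) (T : β → Finset α) (t : ℕ) (hT : ∀ b ∈ B, #(T b) = t) :
      ((∑ χ : α → Fin k, ∑ c : Fin k, #{b ∈ B | ∀ i ∈ T b, χ i = c} : ℕ) : ℝ) =
        #B * (k * (k ^ n / k ^ t)) := by
    have : ∑ χ : α → Fin k, ∑ c : Fin k, #{b ∈ B | ∀ i ∈ T b, χ i = c} =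
        ∑ b ∈ B, ∑ c : Fin k, #{χ : α → Fin k | ∀ i ∈ T b, χ i = c} := by
      simp_rw [card_filter]
      rw [sum_comm]
      simp_rw [sum_comm (s := (univ : Finset (α → Fin k)))]
      rw [sum_comm]
    rw [this]
    push_cast
    rw [← nsmul_eq_mul, ← sum_const]
    refine sum_congr rfl fun b hb => ?_
    rw [← hT b hb]
    have h : ∀ c : Fin k, (#{χ : α → Fin k | ∀ i ∈ T b, χ i = c} : ℝ) = k ^ n / k ^ #(T b) := by
      intro c
      rw [eq_div_iff (by positivity)]
      exact_mod_cast card_coloring_filter k (T b) c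
    simp [h]
  have tot : ((∑ χ : α → Fin k, ∑ c : Fin k,
      #{e ∈ E | ∀ i ∈ ({u e, v e} : Finset α), χ i = c} : ℕ) : ℝ)
     ≤ 3 * ((∑ χ : α → Fin k, ∑ c : Fin k, #{i : α | ∀ j ∈ ({i} : Finset α), χ j = c} : ℕ) : ℝ) +
      ((∑ χ : α → Fin k, ∑ c : Fin k,
        #{p ∈ Cr | ∀ i ∈ ({u p.1, v p.1, u p.2, v p.2} : Finset α), χ i = c} : ℕ) : ℝ) := by
    norm_cast
    simp_rw [mul_sum, ← sum_add_distrib]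
    exact sum_le_sum fun χ _ => sum_le_sum fun c _ => one χ c
  rw [swap E (fun e => {u e, v e}) 2 (fun e he => card_pair (huv e he)),
    swap Cr (fun p => {u p.1, v p.1, u p.2, v p.2}) 4 ?_,
    swap (univ : Finset α) (fun i => ({i} : Finset α)) 1 (fun i _ => card_singleton i)] at tot
  · rw [Finset.card_univ] at tot
    have hkn : (0 : ℝ) < (k : ℝ) ^ n := by positivity
    generalize (k : ℝ) ^ n = K at tot hkn
    generalize (#Cr : ℝ) = R at tot ⊢
    have e1 : (#E : ℝ) = #E * (k * (K / k ^ 2)) * (k / K) := by field_simp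
    have e2 : 3 * (n : ℝ) * k + R / k ^ 2 =
      (3 * (n * (k * (K / k ^ 1))) + R * (k * (K / k ^ 4))) * (k / K) := by
      field_simp
    rw [e1, e2]
    gcongr
  · intro p hp
    obtain ⟨h1, h2⟩ := mem_filter.1 hp
    obtain ⟨h3, h4⟩ := mem_product.1 h1
    have := hC _ h3 _ h4 h2
    have a1 := huv _ h3
    have a2 := huv _ h4
    rw [card_insert_of_notMem, card_insert_of_notMem, card_pair a2] <;>
      simp only [mem_insert, mem_singleton] <;> tauto

/-- A form of the **Szemerédi–Trotter theorem** with a free parameter `k`. -/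
theorem szemeredi_trotter (P Ls : Finset (ℝ × ℝ)) (hP : Set.InjOn Prod.fst (P : Set (ℝ × ℝ)))
    (k : ℕ) (hk : 1 ≤ k) :
    (#{z ∈ P ×ˢ Ls | z.1.2 = lineAt z.2 z.1.1} : ℝ) ≤ #Ls + 3 * #P * k + (#Ls : ℝ) ^ 2 / k ^ 2 := by
  classical
  set I : Finset ((ℝ × ℝ) × (ℝ × ℝ)) := {z ∈ P ×ˢ Ls | z.1.2 = lineAt z.2 z.1.1} with hI
  set E := {z ∈ I | ∃ q ∈ P, z.1.1 < q.1 ∧ q.2 = lineAt z.2 q.1} with hE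
  have hlast : #(I \ E) ≤ #Ls := by
    apply card_le_card_of_injOn Prod.snd
    · intro z hz
      exact (mem_product.1 (mem_filter.1 (mem_sdiff.1 hz).1).1).2
    · have aux : ∀ z ∈ I \ E, ∀ z' ∈ I \ E, z.2 = z'.2 → ¬ z.1.1 < z'.1.1 := by
        intro z hz z' hz' h hlt
        apply (mem_sdiff.1 hz).2
        have h1 := mem_filter.1 (mem_sdiff.1 hz').1
        exact mem_filter.2 ⟨(mem_sdiff.1 hz).1, z'.1, (mem_product.1 h1.1).1, hlt, h ▸ h1.2⟩
      intro z hz z' hz' h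
      have hx := le_antisymm (not_lt.1 (aux z' hz' z hz h.symm)) (not_lt.1 (aux z hz z' hz' h))
      have m1 := mem_filter.1 (mem_sdiff.1 hz).1
      have m2 := mem_filter.1 (mem_sdiff.1 hz').1
      exact Prod.ext (hP (mem_product.1 m1.1).1 (mem_product.1 m2.1).1 hx) h
  have hnext : ∀ z ∈ E, ∃ q ∈ P, z.1.1 < q.1 ∧ q.2 = lineAt z.2 q.1 ∧
      ∀ q' ∈ P, z.1.1 < q'.1 → q'.2 = lineAt z.2 q'.1 → q.1 ≤ q'.1 := by
    intro z hz
    obtain ⟨q, hq, h1, h2⟩ := (mem_filter.1 hz).2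
    obtain ⟨w, hw, hmin⟩ := exists_min_image {q ∈ P | z.1.1 < q.1 ∧ q.2 = lineAt z.2 q.1} Prod.fst
      ⟨q, mem_filter.2 ⟨hq, h1, h2⟩⟩
    rw [mem_filter] at hw
    exact ⟨w, hw.1, hw.2.1, hw.2.2, fun q' a b c => hmin q' (mem_filter.2 ⟨a, b, c⟩)⟩
  choose! v hvP hv1 hv2 hv3 using hnext
  have hEP : ∀ z ∈ E, z.1 ∈ P := fun z hz => (mem_product.1 (mem_filter.1 (mem_filter.1 hz).1).1).1
  have hEL : ∀ z ∈ E, z.2 ∈ Ls := fun z hz => (mem_product.1 (mem_filter.1 (mem_filter.1 hz).1).1).2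
  have hEi : ∀ z ∈ E, z.1.2 = lineAt z.2 z.1.1 := fun z hz => (mem_filter.1 (mem_filter.1 hz).1).2
  by_cases hE0 : E = ∅
  · have h1 : I \ E = I := by rw [hE0, sdiff_empty]
    rw [h1] at hlast
    have h2 : (#I : ℝ) ≤ #Ls := by exact_mod_cast hlast
    have : 0 ≤ 3 * (#P : ℝ) * k + (#Ls : ℝ) ^ 2 / k ^ 2 := by positivity
    linarith
  obtain ⟨z0, hz0⟩ := nonempty_iff_ne_empty.2 hE0
  set p0 : P := ⟨z0.1, hEP _ hz0⟩
  set uu : (ℝ × ℝ) × (ℝ × ℝ) → P := fun z => if h : z.1 ∈ P then ⟨z.1, h⟩ else p0 with huu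
  set vv : (ℝ × ℝ) × (ℝ × ℝ) → P := fun z => if h : v z ∈ P then ⟨v z, h⟩ else p0 with hvv
  have uuE : ∀ z ∈ E, (uu z : ℝ × ℝ) = z.1 := fun z hz => by simp [huu, hEP z hz]
  have vvE : ∀ z ∈ E, (vv z : ℝ × ℝ) = v z := fun z hz => by simp [hvv, hvP z hz]
  have main := card_le_add_crossings E uu vv (SegCross Prod.fst v Prod.snd) k hk ?_ ?_ ?_
  · have hc : #{p ∈ E ×ˢ E | SegCross Prod.fst v Prod.snd p.1 p.2} ≤ #(Ls ×ˢ Ls) := by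
      have sub : ∀ p ∈ E, ∀ p' ∈ E, p.2 = p'.2 → ∀ x, p.1.1 < x → p'.1.1 < x → x < (v p).1 →
          x < (v p').1 → ¬ p.1.1 < p'.1.1 := by
        intro p hp p' hp' h x h1 h2 h3 h4 hlt
        have := hv3 p hp p'.1 (hEP _ hp') hlt (h ▸ hEi p' hp')
        linarith
      have sub' : ∀ p ∈ E, ∀ p' ∈ E, p.2 = p'.2 → ∀ x, p.1.1 < x → p'.1.1 < x → x < (v p).1 →
          x < (v p').1 → p = p' := by
        intro p hp p' hp' h x h1 h2 h3 h4
        have hx := le_antisymm (not_lt.1 (sub p' hp' p hp h.symm x h2 h1 h4 h3))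
          (not_lt.1 (sub p hp p' hp' h x h1 h2 h3 h4))
        exact Prod.ext (hP (hEP _ hp) (hEP _ hp') hx) h
      apply card_le_card_of_injOn (fun p => (p.1.2, p.2.2))
      · intro p hp
        have := mem_product.1 (mem_filter.1 hp).1
        exact mem_product.2 ⟨hEL p.1 this.1, hEL p.2 this.2⟩
      · intro p hp p' hp' h
        obtain ⟨m1, c1⟩ := mem_filter.1 hp
        obtain ⟨m2, c2⟩ := mem_filter.1 hp'
        rw [mem_product] at m1 m2
        obtain ⟨s1, x, hx, a1, a2, a3, a4⟩ := c1.exists_inner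
        obtain ⟨s2, y, hy, b1, b2, b3, b4⟩ := c2.exists_inner
        simp only [Prod.mk.injEq] at h
        have hxy : x = y := by
          rw [← h.1, ← h.2] at hy
          simp only [lineAt] at hx hy
          have : (p.1.2.1 - p.2.2.1) * (x - y) = 0 := by linarith
          rcases mul_eq_zero.1 this with h | h
          · exact absurd (sub_eq_zero.1 h) s1
          · linarith
        subst hxy
        exact Prod.ext (sub' _ m1.1 _ m2.1 h.1 x a1 b1 a3 b3) (sub' _ m1.2 _ m2.2 h.2 x a2 b2 a4 b4)
    rw [card_product] at hc
    have hc' : (#{p ∈ E ×ˢ E | SegCross Prod.fst v Prod.snd p.1 p.2} : ℝ) ≤ (#Ls : ℝ) ^ 2 := by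
      rw [sq]; exact_mod_cast hc
    have hIE : (#I : ℝ) = #(I \ E) + #E := by
      exact_mod_cast (card_sdiff_add_card_eq_card (filter_subset _ _)).symm
    have hlast' : (#(I \ E) : ℝ) ≤ #Ls := by exact_mod_cast hlast
    rw [Fintype.card_coe] at main
    have : (#{p ∈ E ×ˢ E | SegCross Prod.fst v Prod.snd p.1 p.2} : ℝ) / k ^ 2 ≤
      (#Ls : ℝ) ^ 2 / k ^ 2 := by gcongr
    linarith
  · intro e he h
    have := congrArg Subtype.val h
    rw [uuE e he, vvE e he] at this
    have h2 := hv1 e he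
    rw [← this] at h2
    exact lt_irrefl _ h2
  · intro e he e' he' hC
    obtain ⟨s1, x, hx, a1, a2, a3, a4⟩ := hC.exists_inner
    have hcommon : ∀ r : ℝ × ℝ, r.2 = lineAt e.2 r.1 → r.2 = lineAt e'.2 r.1 → r.1 = x := by
      intro r h1 h2
      simp only [lineAt] at *
      have : (e.2.1 - e'.2.1) * (r.1 - x) = 0 := by linarith
      rcases mul_eq_zero.1 this with h | h
      · exact absurd (sub_eq_zero.1 h) s1
      · linarith
    have i1 := hEi e he; have i2 := hEi e' he'; have i3 := hv2 e he; have i4 := hv2 e' he'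
    refine ⟨fun h => ?_, fun h => ?_, fun h => ?_, fun h => ?_⟩ <;>
      have := congrArg Subtype.val h
    · rw [uuE e he, uuE e' he'] at this
      rw [← this] at i2
      linarith [hcommon _ i1 i2]
    · rw [uuE e he, vvE e' he'] at this
      rw [← this] at i4
      linarith [hcommon _ i1 i4]
    · rw [vvE e he, uuE e' he'] at this
      rw [← this] at i2
      linarith [hcommon _ i3 i2]
    · rw [vvE e he, vvE e' he'] at this
      rw [← this] at i4
      linarith [hcommon _ i3 i4]
  · intro W E' hE' hW hno
    have := card_le_of_no_cross E' Prod.fst v Prod.snd (W.map (Function.Embedding.subtype _))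
      ?_ ?_ ?_ ?_ ?_ ?_ ?_ hno
    · rwa [card_map] at this
    · intro a ha b hb h
      simp only [coe_map, Set.mem_image, mem_coe] at ha hb
      obtain ⟨a', -, rfl⟩ := ha
      obtain ⟨b', -, rfl⟩ := hb
      exact hP a'.2 b'.2 h
    · intro e he
      have := (hW e he).1
      rw [mem_map]
      exact ⟨_, this, uuE e (hE' he)⟩
    · intro e he
      have := (hW e he).2
      rw [mem_map]
      exact ⟨_, this, vvE e (hE' he)⟩
    · exact fun e he => hv1 e (hE' he)
    · exact fun e he => hEi e (hE' he)
    · exact fun e he => hv2 e (hE' he)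
    · intro e he e' he' h1 h2
      have i1 := hEi e (hE' he); have i2 := hEi e' (hE' he')
      rw [← h1] at i2
      simp only [lineAt] at i1 i2
      rw [← h2] at i2
      exact Prod.ext h1 (Prod.ext h2 (by linarith))

/-- An abscissa that is injective on the lattice, used to avoid vertical lines. -/
noncomputable def absc (p : ℤ × ℤ) : ℝ := p.1 + √2 * p.2

/-- The lattice point `p` lies on the line `l` (in sheared coordinates). -/
def OnLine (p : ℤ × ℤ) (l : ℝ × ℝ) : Prop := (p.2 : ℝ) = lineAt l (absc p)

/-- The line through `p` with direction `w`, in sheared coordinates. -/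
noncomputable def lineDir (p w : ℤ × ℤ) : ℝ × ℝ :=
  (w.2 / absc w, p.2 - w.2 / absc w * absc p)

lemma absc_sub (p q : ℤ × ℤ) : absc (p - q) = absc p - absc q := by
  simp only [absc, Prod.fst_sub, Prod.snd_sub]; push_cast; ring

lemma absc_eq_zero {p : ℤ × ℤ} (h : absc p = 0) : p = 0 := by
  by_cases h2 : p.2 = 0
  · have : p.1 = 0 := by simpa [absc, h2] using h
    exact Prod.ext this h2
  · exfalso
    have hq : (p.2 : ℝ) ≠ 0 := by exact_mod_cast h2
    have : √2 = ((-p.1 / p.2 : ℚ) : ℝ) := by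
      push_cast; field_simp; simp only [absc] at h; linarith
    exact irrational_sqrt_two.ne_rat _ this

lemma absc_injective : Function.Injective absc := by
  intro p q h
  exact sub_eq_zero.1 (absc_eq_zero (by rw [absc_sub, h, sub_self]))

lemma onLine_lineDir (p w : ℤ × ℤ) : OnLine p (lineDir p w) := by
  simp [OnLine, lineDir, lineAt]

lemma onLine_lineDir_iff {p q w : ℤ × ℤ} (hw : w ≠ 0) :
    OnLine q (lineDir p w) ↔ (q - p).1 * w.2 = (q - p).2 * w.1 := by
  have h0 : absc w ≠ 0 := fun h => hw (absc_eq_zero h)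
  have : OnLine q (lineDir p w) ↔ ((q.2 : ℝ) - p.2) * absc w = w.2 * (absc q - absc p) := by
    simp only [OnLine, lineDir, lineAt]
    field_simp
    constructor <;> intro h <;> linarith
  rw [this]
  simp only [absc, Prod.fst_sub, Prod.snd_sub]
  rw [← @Int.cast_inj ℝ]
  push_cast
  constructor <;> intro h <;> linarith

lemma line_unique {p q : ℤ × ℤ} {l l' : ℝ × ℝ} (hpq : p ≠ q) (h1 : OnLine p l) (h2 : OnLine q l)
    (h3 : OnLine p l') (h4 : OnLine q l') : l = l' := by
  have hx : absc p - absc q ≠ 0 := sub_ne_zero.2 fun h => hpq (absc_injective h)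
  simp only [OnLine, lineAt] at *
  have : (l.1 - l'.1) * (absc p - absc q) = 0 := by linarith
  have h5 : l.1 = l'.1 := by
    rcases mul_eq_zero.1 this with h | h
    · linarith
    · exact absurd h hx
  refine Prod.ext h5 ?_
  rw [h5] at h1
  linarith

open Classical in
/-- Number of points of `B` on `l`. -/
noncomputable def num (B : Finset (ℤ × ℤ)) (l : ℝ × ℝ) : ℕ := #{q ∈ B | OnLine q l}

open Classical in
/-- Number of points of `B` on `l` different from `p`. -/
noncomputable def cnt (B : Finset (ℤ × ℤ)) (p : ℤ × ℤ) (l : ℝ × ℝ) : ℕ :=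
  #{q ∈ B | q ≠ p ∧ OnLine q l}

lemma cnt_le_num (B : Finset (ℤ × ℤ)) (p : ℤ × ℤ) (l : ℝ × ℝ) : cnt B p l ≤ num B l := by
  classical
  apply card_le_card
  intro q hq
  rw [mem_filter] at hq ⊢
  exact ⟨hq.1, hq.2.2⟩

lemma sum_num_le (P : Finset (ℤ × ℤ)) (Ls : Finset (ℝ × ℝ)) (k : ℕ) (hk : 1 ≤ k) :
    (∑ l ∈ Ls, num P l : ℝ) ≤ #Ls + 3 * #P * k + (#Ls : ℝ) ^ 2 / k ^ 2 := by
  classical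
  set φ : ℤ × ℤ → ℝ × ℝ := fun p => (absc p, p.2) with hφ
  have hφi : Function.Injective φ := fun p q h => absc_injective (Prod.ext_iff.1 h).1
  have := szemeredi_trotter (P.image φ) Ls ?_ k hk
  · rw [card_image_of_injective _ hφi] at this
    refine le_trans (le_of_eq ?_) this
    norm_cast
    rw [card_filter, sum_product_right]
    refine sum_congr rfl fun l _ => ?_
    rw [sum_image (fun a _ b _ h => hφi h), num, card_filter]
    simp only [hφ, OnLine]
    congr!
  · intro a ha b hb h
    rw [mem_coe, mem_image] at ha hb
    obtain ⟨a', -, rfl⟩ := ha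
    obtain ⟨b', -, rfl⟩ := hb
    rw [absc_injective h]

/-- Lines rich in points of `B` have few incidences with `B`. -/
lemma sum_num_rich_le (B : Finset (ℤ × ℤ)) (G : Finset (ℝ × ℝ)) (N κ : ℕ) (hB : #B ≤ N)
    (hκ : 4 * N ≤ κ ^ 2) (hG : ∀ l ∈ G, κ ≤ num B l) : ∑ l ∈ G, num B l ≤ 2 * N := by
  classical
  set I := ∑ l ∈ G, num B l with hI
  have h1 : I = ∑ p ∈ B, #{l ∈ G | OnLine p l} := by
    simp only [hI, num, card_filter]; exact sum_comm
  have h2 : ∑ p ∈ B, #{l ∈ G | OnLine p l} ^ 2 ≤ I + #G ^ 2 := by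
    have e1 : ∑ p ∈ B, #{l ∈ G | OnLine p l} ^ 2 =
        ∑ z ∈ G ×ˢ G, #{p ∈ B | OnLine p z.1 ∧ OnLine p z.2} := by
      simp only [card_filter]
      rw [sum_comm]
      refine sum_congr rfl fun p _ => ?_
      rw [sq, sum_mul_sum, sum_product]
      refine sum_congr rfl fun l _ => sum_congr rfl fun l' _ => ?_
      by_cases h : OnLine p l <;> by_cases h' : OnLine p l' <;> simp [h, h']
    rw [e1]
    calc _ ≤ ∑ z ∈ G ×ˢ G, ((if z.1 = z.2 then num B z.1 else 0) + 1) := by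
          refine sum_le_sum fun z _ => ?_
          split_ifs with h
          · rw [h]; simp [num]
          · rw [zero_add, card_le_one]
            intro a ha b hb
            rw [mem_filter] at ha hb
            by_contra hab
            exact h (line_unique hab ha.2.1 hb.2.1 ha.2.2 hb.2.2)
      _ = _ := by
          rw [sum_add_distrib, sum_product]
          simp [hI, sq]
  have h3 : I ^ 2 ≤ #B * ∑ p ∈ B, #{l ∈ G | OnLine p l} ^ 2 := by
    rw [h1]; exact sq_sum_le_card_mul_sum_sq
  have h4 : #G * κ ≤ I := by
    rw [← smul_eq_mul]; exact card_nsmul_le_sum _ _ _ hG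
  have h5 : 4 * N * #G ^ 2 ≤ I ^ 2 := by
    calc _ ≤ κ ^ 2 * #G ^ 2 := by gcongr
      _ = (#G * κ) ^ 2 := by ring
      _ ≤ _ := by gcongr
  have h6 : I ^ 2 ≤ N * (I + #G ^ 2) := h3.trans (Nat.mul_le_mul hB h2)
  have h7 : 3 * I * I ≤ 4 * N * I := by nlinarith
  rcases Nat.eq_zero_or_pos I with h | h
  · omega
  · have := Nat.le_of_mul_le_mul_right h7 h
    omega

/-- Number of lines with at least `k` points of `B`. -/
lemma card_lines_mul_le (B : Finset (ℤ × ℤ)) (G : Finset (ℝ × ℝ)) (β k : ℕ) (hB : #B ≤ β ^ 2)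
    (hk : 2 ≤ k) (hkβ : k ≤ 2 * β) (hG : ∀ l ∈ G, k ≤ num B l) :
    (#G : ℝ) * k ^ 3 ≤ 2304 * β ^ 4 := by
  have hk' : (2 : ℝ) ≤ k := by exact_mod_cast hk
  have hkβ' : (k : ℝ) ≤ 2 * β := by exact_mod_cast hkβ
  have hB' : (#B : ℝ) ≤ β ^ 2 := by exact_mod_cast hB
  set L : ℝ := (#G : ℝ) with hL
  have hL0 : 0 ≤ L := by positivity
  set s := √(L / k) with hs
  have hs0 : 0 ≤ s := Real.sqrt_nonneg _
  have hs2 : k * s ^ 2 = L := by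
    rw [hs, Real.sq_sqrt (by positivity)]; field_simp
  have hIk : k * L ≤ ∑ l ∈ G, (num B l : ℝ) := by
    rw [mul_comm, hL, ← nsmul_eq_mul]
    exact card_nsmul_le_sum _ _ _ fun l hl => by exact_mod_cast hG l hl
  rcases le_or_gt 1 (2 * s) with h1 | h1
  · set x := ⌈2 * s⌉₊ with hx
    have hx1 : 2 * s ≤ x := Nat.le_ceil _
    have hx2 : (x : ℝ) < 2 * s + 1 := Nat.ceil_lt_add_one (by positivity)
    have hx0 : 1 ≤ x := by
      have : (1 : ℝ) ≤ x := h1.trans hx1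
      exact_mod_cast this
    have st := sum_num_le B G x hx0
    have e1 : L ^ 2 / x ^ 2 ≤ L * k / 4 := by
      rw [div_le_div_iff₀ (by positivity) (by norm_num)]
      have : 4 * s ^ 2 ≤ (x : ℝ) ^ 2 := by nlinarith
      calc L ^ 2 * 4 = L * k * (4 * s ^ 2) := by rw [← hs2]; ring
        _ ≤ _ := by gcongr
    have e2 : 3 * (#B : ℝ) * x ≤ 12 * β ^ 2 * s := by
      have : (x : ℝ) ≤ 4 * s := by linarith
      calc 3 * (#B : ℝ) * x ≤ 3 * β ^ 2 * (4 * s) := by gcongr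
        _ = _ := by ring
    have e3 : k ^ 2 * s * s ≤ 48 * β ^ 2 * s := by
      have : k * L ≤ L + 12 * β ^ 2 * s + L * k / 4 := by linarith
      have h' : L * 2 ≤ L * k := by gcongr
      have : L * k ≤ 48 * β ^ 2 * s := by linarith
      rw [← hs2] at this
      linarith
    have e4 : k ^ 2 * s ≤ 48 * β ^ 2 := le_of_mul_le_mul_right e3 (by linarith)
    calc L * (k : ℝ) ^ 3 = (k ^ 2 * s) ^ 2 := by rw [← hs2]; ring
      _ ≤ (48 * (β : ℝ) ^ 2) ^ 2 := by gcongr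
      _ = _ := by ring
  · have : 4 * s ^ 2 ≤ 1 := by nlinarith
    calc L * (k : ℝ) ^ 3 = (4 * s ^ 2) * k ^ 4 / 4 := by rw [← hs2]; ring
      _ ≤ 1 * (2 * (β : ℝ)) ^ 4 / 4 := by gcongr
      _ ≤ _ := by nlinarith [pow_nonneg (Nat.cast_nonneg (α := ℝ) β) 4]

/-- Pairs (point of `A`, line) such that the line has at least `k` further points of `B`. -/
lemma card_flags_mul_le (A B : Finset (ℤ × ℤ)) (F : Finset ((ℤ × ℤ) × (ℝ × ℝ)))
    (α β k : ℕ) (hA : #A ≤ α ^ 2) (hB : #B ≤ β ^ 2) (hα : 1 ≤ α) (hαβ : α ≤ β)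
    (hk : 1 ≤ k) (hkβ : k ≤ 2 * β)
    (hF : ∀ z ∈ F, z.1 ∈ A ∧ OnLine z.1 z.2 ∧ k ≤ cnt B z.1 z.2) :
    (#F : ℝ) * k ^ 2 ≤ 10 ^ 7 * (α * β ^ 3) := by
  classical
  have hA' : (#A : ℝ) ≤ α ^ 2 := by exact_mod_cast hA
  have hα' : (1 : ℝ) ≤ α := by exact_mod_cast hα
  have hαβ' : (α : ℝ) ≤ β := by exact_mod_cast hαβ
  have hk' : (1 : ℝ) ≤ k := by exact_mod_cast hk
  have hkβ' : (k : ℝ) ≤ 2 * β := by exact_mod_cast hkβ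
  have hβ' : (1 : ℝ) ≤ β := hα'.trans hαβ'
  -- trivial bound by counting pairs
  have triv : (#F : ℝ) * k ≤ α ^ 2 * β ^ 2 := by
    have h1 : #F * k ≤ #(A ×ˢ B) := by
      have h2 : #F * k ≤ ∑ z ∈ F, #{q ∈ B | q ≠ z.1 ∧ OnLine q z.2} := by
        rw [← smul_eq_mul]; exact card_nsmul_le_sum _ _ _ fun z hz => (hF z hz).2.2
      rw [← card_sigma] at h2
      refine h2.trans (card_le_card_of_injOn (fun s => (s.1.1, s.2)) ?_ ?_)
      · intro s hs
        have hs' := mem_sigma.1 hs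
        exact mem_product.2 ⟨(hF _ hs'.1).1, (mem_filter.1 hs'.2).1⟩
      · rintro ⟨z, q⟩ hs ⟨z', q'⟩ hs' h
        have h1 := mem_sigma.1 hs
        have h2 := mem_sigma.1 hs'
        simp only [Prod.mk.injEq] at h
        obtain ⟨h3, rfl⟩ := h
        have a1 := (mem_filter.1 h1.2).2
        have a2 := (mem_filter.1 h2.2).2
        have b1 := (hF _ h1.1).2.1
        have b2 := (hF _ h2.1).2.1
        simp only at a1 a2 b1 b2
        rw [← h3] at b2
        have : z.2 = z'.2 := line_unique a1.1 a1.2 b1 a2.2 b2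
        have : z = z' := Prod.ext h3 this
        subst this; rfl
    have h2 : #F * k ≤ α ^ 2 * β ^ 2 := by
      rw [card_product] at h1; exact h1.trans (Nat.mul_le_mul hA hB)
    exact_mod_cast h2
  rcases Nat.lt_or_ge k 2 with hk2 | hk2
  · have : k = 1 := by omega
    subst this
    have h3 : (α : ℝ) ^ 2 * β ^ 2 ≤ α * β ^ 3 := by
      have : (α : ℝ) * (α * β ^ 2) ≤ α * (β * β ^ 2) := by gcongr
      nlinarith
    have : (0:ℝ) ≤ α * β ^ 3 := by positivity
    simp only [Nat.cast_one, mul_one, one_pow] at triv ⊢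
    linarith
  set G := F.image Prod.snd with hG
  have hGk : ∀ l ∈ G, k ≤ num B l := by
    intro l hl
    obtain ⟨z, hz, rfl⟩ := mem_image.1 hl
    exact (hF z hz).2.2.trans (cnt_le_num _ _ _)
  have hLk := card_lines_mul_le B G β k hB hk2 hkβ hGk
  have hFG : (#F : ℝ) ≤ ∑ l ∈ G, (num A l : ℝ) := by
    norm_cast
    rw [card_eq_sum_card_image Prod.snd F]
    refine sum_le_sum fun l hl => ?_
    apply card_le_card_of_injOn Prod.fst
    · intro z hz
      obtain ⟨h1, h2⟩ := mem_filter.1 hz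
      exact mem_filter.2 ⟨(hF z h1).1, h2 ▸ (hF z h1).2.1⟩
    · intro z hz z' hz' h
      exact Prod.ext h ((mem_filter.1 hz).2.trans (mem_filter.1 hz').2.symm)
  set y : ℝ := β ^ 3 / (α * k ^ 2) with hy
  have hy0 : 0 < y := by positivity
  set x := ⌈y⌉₊ with hx
  have hx1 : y ≤ x := Nat.le_ceil _
  have hx2 : (x : ℝ) < y + 1 := Nat.ceil_lt_add_one hy0.le
  have hx0 : 1 ≤ x := Nat.one_le_ceil_iff.2 hy0
  have st := sum_num_le A G x hx0
  set L : ℝ := (#G : ℝ) with hL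
  have e1 : L ^ 2 / x ^ 2 * k ^ 2 ≤ 2304 ^ 2 * (α * β ^ 3) := by
    have : L ^ 2 / x ^ 2 ≤ (2304 * β ^ 4 / k ^ 3) ^ 2 / y ^ 2 := by
      have : L ≤ 2304 * β ^ 4 / k ^ 3 := by rw [le_div_iff₀ (by positivity)]; exact hLk
      gcongr
    calc L ^ 2 / x ^ 2 * (k : ℝ) ^ 2 ≤ (2304 * (β : ℝ) ^ 4 / k ^ 3) ^ 2 / y ^ 2 * k ^ 2 := by gcongr
      _ = 2304 ^ 2 * ((α : ℝ) * (α * β ^ 2)) := by rw [hy]; field_simp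
      _ ≤ 2304 ^ 2 * ((α : ℝ) * (β * β ^ 2)) := by gcongr
      _ = _ := by ring
  have e2 : 3 * (#A : ℝ) * x * k ^ 2 ≤ 15 * (α * β ^ 3) := by
    have h1 : 3 * (#A : ℝ) * x ≤ 3 * α ^ 2 * (y + 1) := by gcongr
    have h2 : (α : ℝ) ^ 2 * y * k ^ 2 = α * β ^ 3 := by rw [hy]; field_simp
    have h3 : (α : ℝ) ^ 2 * k ^ 2 ≤ 4 * (α * β ^ 3) := by
      calc (α : ℝ) ^ 2 * k ^ 2 ≤ α * β * (2 * β) ^ 2 := by rw [sq (α : ℝ)]; gcongr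
        _ = _ := by ring
    calc 3 * (#A : ℝ) * x * k ^ 2 ≤ 3 * α ^ 2 * (y + 1) * k ^ 2 := by gcongr
      _ = 3 * (α ^ 2 * y * k ^ 2) + 3 * (α ^ 2 * k ^ 2) := by ring
      _ ≤ _ := by rw [h2]; linarith
  have e0 : (0 : ℝ) ≤ α * β ^ 3 := by positivity
  have e3 : (#F : ℝ) * k ^ 2 ≤ L * k ^ 2 + (2304 ^ 2 + 15) * (α * β ^ 3) := by
    have := mul_le_mul_of_nonneg_right (hFG.trans st) (by positivity : (0 : ℝ) ≤ (k : ℝ) ^ 2)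
    nlinarith
  rcases le_or_gt (L * k ^ 2) (2304 * (α * β ^ 3)) with h | h
  · nlinarith
  · have h1 : 2304 * ((α : ℝ) * β ^ 3) * k ≤ 2304 * β ^ 4 := by
      calc 2304 * ((α : ℝ) * β ^ 3) * k ≤ L * k ^ 2 * k := by gcongr
        _ = L * k ^ 3 := by ring
        _ ≤ _ := hLk
    have h2 : (α : ℝ) * k ≤ β := by
      have : (α * k) * (β : ℝ) ^ 3 ≤ β * β ^ 3 := by linarith
      exact le_of_mul_le_mul_right this (by positivity)
    calc (#F : ℝ) * k ^ 2 = #F * k * k := by ring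
      _ ≤ α ^ 2 * β ^ 2 * k := by gcongr
      _ = α * β ^ 2 * (α * k) := by ring
      _ ≤ α * β ^ 2 * β := by gcongr
      _ ≤ _ := by nlinarith

lemma sum_min_two_pow_div_sq_le (M i : ℕ) :
    ∑ k ∈ Icc 1 M, (min k (2 ^ i) : ℝ) / k ^ 2 ≤ i + 2 := by
  have key : ∀ H : ℕ, 1 ≤ H → ∑ k ∈ Icc 1 M, (if H < k then (1 : ℝ) / k ^ 2 else 0) ≤ 1 / H := by
    intro H hH
    rw [← sum_filter]
    have : (Icc 1 M).filter (fun k => H < k) = Ioc H M := by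
      ext k; simp only [mem_filter, mem_Icc, mem_Ioc]; omega
    rw [this]
    rcases le_total H M with h | h
    · have h1 := sum_Ioc_inv_sq_le_sub (α := ℝ) (by omega : H ≠ 0) h
      simp only [one_div]
      refine h1.trans ?_
      have : (0 : ℝ) ≤ (M : ℝ)⁻¹ := by positivity
      linarith
    · rw [Ioc_eq_empty (by omega)]; simp
  induction i with
  | zero =>
    have h1 := key 1 le_rfl
    calc ∑ k ∈ Icc 1 M, (min k (2 ^ 0) : ℝ) / k ^ 2
        ≤ ∑ k ∈ Icc 1 M, ((if k = 1 then (1 : ℝ) else 0) +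
            (if 1 < k then (1 : ℝ) / k ^ 2 else 0)) := by
          refine sum_le_sum fun k hk => ?_
          rw [mem_Icc] at hk
          have hk1 : (1 : ℝ) ≤ k := by exact_mod_cast hk.1
          rw [pow_zero, min_eq_right hk1]
          rcases eq_or_lt_of_le hk.1 with h | h
          · simp [← h]
          · rw [if_pos h, if_neg (by omega)]; simp
      _ ≤ 1 + 1 := by
          rw [sum_add_distrib]
          refine add_le_add ?_ (by simpa using h1)
          rw [sum_ite_eq' (Icc 1 M) 1]; split_ifs <;> norm_num
      _ = _ := by norm_num
  | succ i ih =>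
    have h1 := key (2 ^ i) Nat.one_le_two_pow
    calc ∑ k ∈ Icc 1 M, (min k (2 ^ (i + 1)) : ℝ) / k ^ 2
        ≤ ∑ k ∈ Icc 1 M, ((min k (2 ^ i) : ℝ) / k ^ 2 +
            2 ^ i * (if 2 ^ i < k then (1 : ℝ) / k ^ 2 else 0)) := by
          refine sum_le_sum fun k hk => ?_
          split_ifs with h
          · have h' : (2 ^ i : ℝ) < k := by exact_mod_cast h
            rw [min_eq_right h'.le, mul_one_div, ← add_div]
            gcongr
            refine (min_le_right _ _).trans ?_
            rw [pow_succ]; linarith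
          · have h' : (k : ℝ) ≤ 2 ^ i := by exact_mod_cast not_lt.1 h
            rw [min_eq_left h', mul_zero, add_zero]
            gcongr
            exact min_le_left _ _
      _ ≤ (i + 2) + 1 := by
          rw [sum_add_distrib, ← mul_sum]
          refine add_le_add ih ?_
          calc _ ≤ (2 : ℝ) ^ i * (1 / ((2 ^ i : ℕ) : ℝ)) := by gcongr
            _ = 1 := by push_cast; field_simp
      _ = _ := by push_cast; ring

lemma mul_min_le_sum (n H M : ℕ) (hn : n ≤ M) :
    n * min n H ≤ 2 * ∑ k ∈ Icc 1 M, if k ≤ n then min k H else 0 := by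
  have h1 : ∑ k ∈ Icc 1 M, (if k ≤ n then min k H else 0) = ∑ k ∈ Icc 1 n, min k H := by
    rw [← sum_filter]
    congr 1
    ext k; simp only [mem_filter, mem_Icc]; omega
  rw [h1]
  clear h1 hn
  induction n with
  | zero => simp
  | succ n ih =>
    rw [sum_Icc_succ_top (by omega), mul_add]
    have : (n + 1) * min (n + 1) H ≤ n * min n H + 2 * min (n + 1) H := by
      rcases le_or_gt (n + 1) H with h | h
      · rw [min_eq_left h, min_eq_left (by omega)]; nlinarith
      · rw [min_eq_right h.le, min_eq_right (by omega)]; nlinarith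
    omega

open Classical in
/-- Truncated count of collinear triples on lines that are poor in `B`. -/
lemma sum_min_cnt_le (A B : Finset (ℤ × ℤ)) (α β i : ℕ) (hA : #A ≤ α ^ 2) (hB : #B ≤ β ^ 2)
    (hα : 1 ≤ α) (hαβ : α ≤ β) :
    ((∑ p ∈ A, ∑ q ∈ B with q ≠ p ∧ num B (lineDir p (q - p)) < 2 * β,
      min (cnt B p (lineDir p (q - p))) (2 ^ i) : ℕ) : ℝ) ≤ 4 * 10 ^ 7 * (i + 1) * (α * β ^ 3) := by
  set R : Finset ((ℤ × ℤ) × (ℤ × ℤ)) :=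
    {z ∈ A ×ˢ B | z.2 ≠ z.1 ∧ num B (lineDir z.1 (z.2 - z.1)) < 2 * β} with hR
  set g : (ℤ × ℤ) × (ℤ × ℤ) → (ℤ × ℤ) × (ℝ × ℝ) := fun z => (z.1, lineDir z.1 (z.2 - z.1)) with hg
  set F := R.image g with hF
  set H := 2 ^ i with hH
  have onl : ∀ z : (ℤ × ℤ) × (ℤ × ℤ), z.2 ≠ z.1 → OnLine z.2 (lineDir z.1 (z.2 - z.1)) := by
    intro z hz
    rw [onLine_lineDir_iff (sub_ne_zero.2 hz)]; ring
  have hFp : ∀ y ∈ F, y.1 ∈ A ∧ OnLine y.1 y.2 ∧ cnt B y.1 y.2 ≤ 2 * β := by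
    intro y hy
    obtain ⟨z, hz, rfl⟩ := mem_image.1 hy
    obtain ⟨h1, h2, h3⟩ := mem_filter.1 hz
    exact ⟨(mem_product.1 h1).1, onLine_lineDir _ _, (cnt_le_num _ _ _).trans h3.le⟩
  have e1 : (∑ p ∈ A, ∑ q ∈ B with q ≠ p ∧ num B (lineDir p (q - p)) < 2 * β,
      min (cnt B p (lineDir p (q - p))) H) ≤ ∑ y ∈ F, cnt B y.1 y.2 * min (cnt B y.1 y.2) H := by
    simp_rw [sum_filter]
    rw [← sum_product', ← sum_filter, ← hR]
    rw [← sum_fiberwise_of_maps_to (g := g) (t := F) (fun z hz => mem_image_of_mem _ hz)]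
    refine sum_le_sum fun y hy => ?_
    calc _ ≤ ∑ z ∈ R with g z = y, min (cnt B y.1 y.2) H := by
          refine sum_le_sum fun z hz => ?_
          rw [← (mem_filter.1 hz).2]
      _ = #{z ∈ R | g z = y} * min (cnt B y.1 y.2) H := by rw [sum_const, smul_eq_mul]
      _ ≤ _ := by
          gcongr
          apply card_le_card_of_injOn Prod.snd
          · intro z hz
            obtain ⟨h1, rfl⟩ := mem_filter.1 hz
            obtain ⟨h2, h3, -⟩ := mem_filter.1 h1
            exact mem_filter.2 ⟨(mem_product.1 h2).2, h3, onl z h3⟩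
          · intro z hz z' hz' h
            have h1 := (mem_filter.1 hz).2
            have h2 := (mem_filter.1 hz').2
            have : (g z).1 = (g z').1 := by rw [h1, h2]
            exact Prod.ext this h
  have e2 : ∑ y ∈ F, cnt B y.1 y.2 * min (cnt B y.1 y.2) H ≤
      2 * ∑ k ∈ Icc 1 (2 * β), min k H * #{y ∈ F | k ≤ cnt B y.1 y.2} := by
    calc _ ≤ ∑ y ∈ F, 2 * ∑ k ∈ Icc 1 (2 * β), if k ≤ cnt B y.1 y.2 then min k H else 0 :=
          sum_le_sum fun y hy => mul_min_le_sum _ _ _ (hFp y hy).2.2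
      _ = _ := by
          rw [← mul_sum, sum_comm]
          congr 1
          refine sum_congr rfl fun k _ => ?_
          rw [← sum_filter, sum_const, smul_eq_mul, mul_comm]
  have e3 : ∀ k ∈ Icc 1 (2 * β), (min k (2 ^ i) : ℝ) * #{y ∈ F | k ≤ cnt B y.1 y.2} ≤
      (min k (2 ^ i) : ℝ) / k ^ 2 * (10 ^ 7 * (α * β ^ 3)) := by
    intro k hk
    rw [mem_Icc] at hk
    have := card_flags_mul_le A B {y ∈ F | k ≤ cnt B y.1 y.2} α β k hA hB hα hαβ hk.1 hk.2 (by
      intro z hz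
      obtain ⟨h1, h2⟩ := mem_filter.1 hz
      exact ⟨(hFp z h1).1, (hFp z h1).2.1, h2⟩)
    have hk0 : (0 : ℝ) < k := by exact_mod_cast hk.1
    rw [div_mul_eq_mul_div, mul_div_assoc]
    gcongr
    rw [le_div_iff₀ (by positivity)]
    exact this
  have e4 := e1.trans e2
  calc _ ≤ ((2 * ∑ k ∈ Icc 1 (2 * β), min k H * #{y ∈ F | k ≤ cnt B y.1 y.2} : ℕ) : ℝ) := by
        exact_mod_cast e4
    _ = 2 * ∑ k ∈ Icc 1 (2 * β), (min k (2 ^ i) : ℝ) * #{y ∈ F | k ≤ cnt B y.1 y.2} := by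
        push_cast [hH]; rfl
    _ ≤ 2 * ∑ k ∈ Icc 1 (2 * β), (min k (2 ^ i) : ℝ) / k ^ 2 * (10 ^ 7 * (α * β ^ 3)) := by
        gcongr 2 * ?_
        exact sum_le_sum e3
    _ = 2 * (10 ^ 7 * (α * β ^ 3)) * ∑ k ∈ Icc 1 (2 * β), (min k (2 ^ i) : ℝ) / k ^ 2 := by
        rw [← sum_mul]; ring
    _ ≤ 2 * (10 ^ 7 * (α * β ^ 3)) * (i + 2) := by
        gcongr
        exact sum_min_two_pow_div_sq_le _ _
    _ ≤ _ := by
        have : (0 : ℝ) ≤ α * β ^ 3 * i := by positivity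
        nlinarith

section Energy

variable {ι κ : Type*} [DecidableEq κ]

/-- The energy of a weight `F` on `T` with respect to the classes of `cl`. -/
def energy (cl : ι → κ) (F : ι → ℝ) (T : Finset ι) : ℝ :=
  ∑ e ∈ T, ∑ e' ∈ T, if cl e = cl e' then F e * F e' else 0

lemma energy_eq_sum_sq (cl : ι → κ) (F : ι → ℝ) (T : Finset ι) (K : Finset κ)
    (hK : ∀ e ∈ T, cl e ∈ K) :
    energy cl F T = ∑ k ∈ K, (∑ e ∈ T with cl e = k, F e) ^ 2 := by
  simp_rw [sq, sum_mul_sum, sum_filter]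
  rw [energy, sum_comm]
  conv_rhs => rw [sum_comm]
  rw [sum_comm]
  refine sum_congr rfl fun e he => ?_
  rw [sum_eq_single (cl e)]
  · simp [eq_comm]
  · intro k _ hk
    rw [if_neg (Ne.symm hk)]
  · intro h; exact absurd (hK e he) h

lemma energy_le_filter (cl : ι → κ) (F : ι → ℝ) (T : Finset ι) (P : ι → Prop) [DecidablePred P] :
    energy cl F T ≤ 2 * energy cl F {e ∈ T | P e} + 2 * energy cl F {e ∈ T | ¬ P e} := by
  have h : ∀ e ∈ T, cl e ∈ T.image cl := fun e he => mem_image_of_mem _ he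
  rw [energy_eq_sum_sq cl F T _ h, energy_eq_sum_sq cl F {e ∈ T | P e} (T.image cl)
    fun e he => h e (mem_filter.1 he).1, energy_eq_sum_sq cl F {e ∈ T | ¬ P e} (T.image cl)
    fun e he => h e (mem_filter.1 he).1, mul_sum, mul_sum, ← sum_add_distrib]
  refine sum_le_sum fun k _ => ?_
  rw [← sum_filter_add_sum_filter_not {e ∈ T | cl e = k} P, filter_comm,
    filter_comm (p := fun e => cl e = k) (q := fun e => ¬ P e)]
  nlinarith [sq_nonneg (∑ x ∈ filter (fun x => cl x = k) (filter P T), F x -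
    ∑ x ∈ filter (fun x => cl x = k) (filter (fun x => ¬ P x) T), F x)]

lemma energy_le_sq_sum_sqrt {J : Type*} [DecidableEq J] (cl : ι → κ) (F : ι → ℝ) (T : Finset ι)
    (τ : ι → J) (Js : Finset J) (hτ : ∀ e ∈ T, τ e ∈ Js) :
    energy cl F T ≤ (∑ j ∈ Js, √(energy cl F {e ∈ T | τ e = j})) ^ 2 := by
  have h : ∀ e ∈ T, cl e ∈ T.image cl := fun e he => mem_image_of_mem _ he
  set x : J → κ → ℝ := fun j k => ∑ e ∈ {e ∈ T | τ e = j} with cl e = k, F e with hx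
  have h1 : energy cl F T = ∑ k ∈ T.image cl, (∑ j ∈ Js, x j k) ^ 2 := by
    rw [energy_eq_sum_sq cl F T _ h]
    refine sum_congr rfl fun k _ => ?_
    congr 1
    rw [← sum_fiberwise_of_maps_to (g := τ) (t := Js) (fun e he => hτ e (mem_filter.1 he).1)]
    refine sum_congr rfl fun j _ => ?_
    rw [filter_comm]
  have h2 : ∀ j, energy cl F {e ∈ T | τ e = j} = ∑ k ∈ T.image cl, x j k ^ 2 := by
    intro j
    rw [energy_eq_sum_sq cl F _ (T.image cl) fun e he => h e (mem_filter.1 he).1]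
  simp_rw [h1, h2, sq (∑ j ∈ Js, _), sum_mul_sum]
  rw [sum_comm]
  refine sum_le_sum fun j _ => ?_
  rw [sum_comm]
  refine sum_le_sum fun j' _ => ?_
  exact Real.sum_mul_le_sqrt_mul_sqrt _ _ _

lemma energy_map {ι' : Type*} (cl : ι → κ) (F : ι → ℝ) {κ' : Type*} [DecidableEq κ']
    (cl' : ι' → κ') (F' : ι' → ℝ) (g : ι' ↪ ι) (T : Finset ι') (hF : ∀ e ∈ T, F (g e) = F' e)
    (hcl : ∀ e ∈ T, ∀ e' ∈ T, cl (g e) = cl (g e') ↔ cl' e = cl' e') :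
    energy cl F (T.map g) = energy cl' F' T := by
  simp only [energy, sum_map]
  refine sum_congr rfl fun e he => sum_congr rfl fun e' he' => ?_
  rw [hF e he, hF e' he']
  simp only [hcl e he e' he']

end Energy

/-- A Schur test for the kernel `2 ^ (-|a - b|)`. -/
lemma sum_two_pow_dist_le (lam : ℕ → ℝ) (m : ℕ) :
    ∑ a ∈ range m, ∑ b ∈ range m, lam a * lam b * (1 / 2) ^ (Nat.dist a b) ≤
      4 * ∑ a ∈ range m, lam a ^ 2 := by
  have row : ∀ a, ∑ b ∈ range m, (1 / 2 : ℝ) ^ (Nat.dist a b) ≤ 4 := by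
    intro a
    calc ∑ b ∈ range m, (1 / 2 : ℝ) ^ (Nat.dist a b)
        ≤ ∑ b ∈ range m, ((if b ≤ a then (1 / 2 : ℝ) ^ (a - b) else 0) +
            (if a ≤ b then (1 / 2 : ℝ) ^ (b - a) else 0)) := by
          refine sum_le_sum fun b _ => ?_
          rcases le_total a b with h | h
          · rw [Nat.dist_eq_sub_of_le h, if_pos h]
            have : (0 : ℝ) ≤ if b ≤ a then (1 / 2 : ℝ) ^ (a - b) else 0 := by
              split_ifs <;> positivity
            linarith
          · rw [Nat.dist_eq_sub_of_le_right h, if_pos h]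
            have : (0 : ℝ) ≤ if a ≤ b then (1 / 2 : ℝ) ^ (b - a) else 0 := by
              split_ifs <;> positivity
            linarith
      _ ≤ 2 + 2 := by
          have geo : ∀ s : Finset ℕ, ∑ n ∈ s, (1 / 2 : ℝ) ^ n ≤ 2 := by
            intro s
            calc _ ≤ ∑ n ∈ range (s.sup id + 1), (1 / 2 : ℝ) ^ n :=
                  sum_le_sum_of_subset_of_nonneg (subset_range_sup_succ s) (by intros; positivity)
              _ ≤ 2 := by
                  rw [geom_sum_eq (by norm_num)]
                  have : (0 : ℝ) ≤ (1 / 2) ^ (s.sup id + 1) := by positivity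
                  rw [div_le_iff_of_neg (by norm_num)]
                  linarith
          rw [sum_add_distrib, ← sum_filter, ← sum_filter]
          refine add_le_add ?_ ?_
          · rw [← sum_image (f := fun n => (1 / 2 : ℝ) ^ n) (g := fun b => a - b)]
            · exact geo _
            · intro b hb b' hb' h
              have h1 := (mem_filter.1 hb).2
              have h2 := (mem_filter.1 hb').2
              simp only at h; omega
          · rw [← sum_image (f := fun n => (1 / 2 : ℝ) ^ n) (g := fun b => b - a)]
            · exact geo _
            · intro b hb b' hb' h
              have h1 := (mem_filter.1 hb).2
              have h2 := (mem_filter.1 hb').2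
              simp only at h; omega
      _ = 4 := by norm_num
  calc ∑ a ∈ range m, ∑ b ∈ range m, lam a * lam b * (1 / 2) ^ (Nat.dist a b)
      ≤ ∑ a ∈ range m, ∑ b ∈ range m,
        (lam a ^ 2 / 2 * (1 / 2) ^ (Nat.dist a b) + lam b ^ 2 / 2 * (1 / 2) ^ (Nat.dist b a)) := by
        refine sum_le_sum fun a _ => sum_le_sum fun b _ => ?_
        rw [Nat.dist_comm b a, ← add_mul]
        gcongr
        nlinarith [sq_nonneg (lam a - lam b)]
    _ = ∑ a ∈ range m, lam a ^ 2 * ∑ b ∈ range m, (1 / 2) ^ (Nat.dist a b) := by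
        simp_rw [sum_add_distrib]
        rw [sum_comm (f := fun a b => lam b ^ 2 / 2 * (1 / 2) ^ (Nat.dist b a)), ← sum_add_distrib]
        refine sum_congr rfl fun a _ => ?_
        rw [← mul_sum]; ring
    _ ≤ ∑ a ∈ range m, lam a ^ 2 * 4 := by
        refine sum_le_sum fun a _ => ?_
        gcongr
        exact row a
    _ = _ := by rw [← sum_mul, mul_comm]

/-- The integer inner product. -/
def dot (u v : ℤ × ℤ) : ℤ := u.1 * v.1 + u.2 * v.2

/-- Rotation by a right angle. -/
def perp (u : ℤ × ℤ) : ℤ × ℤ := (-u.2, u.1)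

/-- Two directed edges with the same class are opposite sides of a rectangle. -/
def rectClass (e : (ℤ × ℤ) × (ℤ × ℤ)) : (ℤ × ℤ) × ℤ := (e.2 - e.1, dot (e.2 - e.1) e.1)

/-- Product weight of an edge. -/
def edgeWt (f : ℤ × ℤ → ℝ) (e : (ℤ × ℤ) × (ℤ × ℤ)) : ℝ := f e.1 * f e.2

lemma dot_sub (u v w : ℤ × ℤ) : dot u (v - w) = dot u v - dot u w := by
  simp only [dot, Prod.fst_sub, Prod.snd_sub]; ring

lemma dot_comm (u v : ℤ × ℤ) : dot u v = dot v u := by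
  simp only [dot]; ring

lemma perp_ne_zero {u : ℤ × ℤ} (h : u ≠ 0) : perp u ≠ 0 := by
  intro h'
  simp only [perp, Prod.mk_eq_zero, neg_eq_zero] at h'
  exact h (Prod.ext h'.2 h'.1)

lemma rectClass_eq_iff {e e' : (ℤ × ℤ) × (ℤ × ℤ)} :
    rectClass e = rectClass e' ↔
      e.2 - e.1 = e'.2 - e'.1 ∧ dot (e.2 - e.1) (e'.1 - e.1) = 0 := by
  simp only [rectClass, Prod.mk.injEq, dot_sub, sub_eq_zero]
  constructor
  · rintro ⟨h1, h2⟩; exact ⟨h1, by rw [h2, h1]⟩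
  · rintro ⟨h1, h2⟩; exact ⟨h1, by rw [← h2, ← h1]⟩

lemma onLine_perp_iff {p q u : ℤ × ℤ} (hu : u ≠ 0) :
    OnLine q (lineDir p (perp u)) ↔ dot u (q - p) = 0 := by
  rw [onLine_lineDir_iff (perp_ne_zero hu)]
  simp only [perp, dot]
  constructor <;> intro h <;> linarith

lemma onLine_lineDir_iff_dot {p q u : ℤ × ℤ} (hu : u ≠ 0) :
    OnLine q (lineDir p u) ↔ dot (perp u) (q - p) = 0 := by
  rw [onLine_lineDir_iff hu]
  simp only [perp, dot]
  constructor <;> intro h <;> linarith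

lemma cross_eq_of_lineDir_eq {p u u' : ℤ × ℤ} (hu : u ≠ 0) (hu' : u' ≠ 0)
    (h : lineDir p u = lineDir p u') : u.1 * u'.2 = u.2 * u'.1 := by
  have h1 : OnLine (p + u) (lineDir p u') := by
    rw [← h, onLine_lineDir_iff hu]; simp [mul_comm]
  rw [onLine_lineDir_iff hu'] at h1
  simpa using h1

lemma eq_of_cross_of_dot {u u' v v' : ℤ × ℤ} (hu : u ≠ 0) (hu' : u' ≠ 0)
    (h : u.1 * u'.2 = u.2 * u'.1) (hv : dot u v = 0) (hv' : dot u' v' = 0)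
    (hs : u + v = u' + v') : u = u' := by
  obtain ⟨a, b⟩ := u
  obtain ⟨a', b'⟩ := u'
  obtain ⟨c, d⟩ := v
  obtain ⟨c', d'⟩ := v'
  simp only [dot, Prod.mk_add_mk, Prod.mk.injEq, ne_eq, Prod.mk_eq_zero] at *
  obtain ⟨h1, h2⟩ := hs
  -- the second vector is also orthogonal to `v`
  have k1 : a' * c + b' * d = 0 := by
    have e1 : a * (a' * c + b' * d) = 0 := by linear_combination a' * hv + d * h
    have e2 : b * (a' * c + b' * d) = 0 := by linear_combination b' * hv - c * h
    by_contra hne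
    exact hu ⟨(mul_eq_zero.1 e1).resolve_right hne, (mul_eq_zero.1 e2).resolve_right hne⟩
  have k2 : (a - a') * a' + (b - b') * b' = 0 := by
    linear_combination hv' - k1 + a' * h1 + b' * h2
  have k3 : (a - a') * b' - (b - b') * a' = 0 := by linear_combination h
  have k4 : (a - a') * (a' ^ 2 + b' ^ 2) = 0 := by linear_combination a' * k2 + b' * k3
  have k5 : (b - b') * (a' ^ 2 + b' ^ 2) = 0 := by linear_combination b' * k2 - a' * k3
  have k6 : a' ^ 2 + b' ^ 2 ≠ 0 := by
    intro h0
    have : a' = 0 := by nlinarith [sq_nonneg a', sq_nonneg b']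
    have : b' = 0 := by nlinarith [sq_nonneg a', sq_nonneg b']
    tauto
  have k7 := (mul_eq_zero.1 k4).resolve_right k6
  have k8 := (mul_eq_zero.1 k5).resolve_right k6
  exact ⟨by linarith, by linarith⟩

/-- The points of level `j`. -/
def levelSet (S : Finset (ℤ × ℤ)) (lev : ℤ × ℤ → ℕ) (j : ℕ) : Finset (ℤ × ℤ) :=
  {p ∈ S | lev p = j}

/-- The weight which is constant on levels. -/
noncomputable def levelWt (lev : ℤ × ℤ → ℕ) (lam : ℕ → ℝ) (p : ℤ × ℤ) : ℝ :=
  lam (lev p) / 16 ^ lev p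

lemma levelWt_nonneg (lev : ℤ × ℤ → ℕ) {lam : ℕ → ℝ} (hlam : ∀ j, 0 ≤ lam j) (p : ℤ × ℤ) :
    0 ≤ levelWt lev lam p := div_nonneg (hlam _) (by positivity)

lemma levelWt_sq (lev : ℤ × ℤ → ℕ) (lam : ℕ → ℝ) (p : ℤ × ℤ) :
    levelWt lev lam p ^ 2 = lam (lev p) ^ 2 / 256 ^ lev p := by
  rw [levelWt, div_pow, ← pow_mul, mul_comm, pow_mul]; norm_num

section

variable (S : Finset (ℤ × ℤ)) (lev : ℤ × ℤ → ℕ) (lam : ℕ → ℝ) (m : ℕ)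

lemma sum_levelWt_sq_le (hm : ∀ p ∈ S, lev p < m)
    (hcard : ∀ j, #(levelSet S lev j) ≤ 256 ^ j) :
    ∑ p ∈ S, levelWt lev lam p ^ 2 ≤ ∑ j ∈ range m, lam j ^ 2 := by
  rw [← sum_fiberwise_of_maps_to (g := lev) (t := range m) fun p hp => mem_range.2 (hm p hp)]
  refine sum_le_sum fun j _ => ?_
  calc ∑ p ∈ S with lev p = j, levelWt lev lam p ^ 2
      = ∑ p ∈ levelSet S lev j, lam j ^ 2 / 256 ^ j := by
        refine sum_congr rfl fun p hp => ?_
        rw [levelWt_sq, (mem_filter.1 hp).2]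
    _ = #(levelSet S lev j) * (lam j ^ 2 / 256 ^ j) := by rw [sum_const, nsmul_eq_mul]
    _ ≤ 256 ^ j * (lam j ^ 2 / 256 ^ j) := by
        gcongr
        exact_mod_cast hcard j
    _ = _ := by field_simp

lemma energy_rich_le (hm : ∀ p ∈ S, lev p < m)
    (hcard : ∀ j, #(levelSet S lev j) ≤ 256 ^ j)
    (T : Finset ((ℤ × ℤ) × (ℤ × ℤ))) (hT : T ⊆ S ×ˢ S) (hne : ∀ e ∈ T, e.2 - e.1 ≠ 0)
    (d : ℤ × ℤ → ℤ × ℤ → ℝ × ℝ) (hon : ∀ p u, OnLine p (d p u))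
    (hd : ∀ p u u', u ≠ 0 → u' ≠ 0 → d p u = d p u' → u.1 * u'.2 = u.2 * u'.1)
    (hrich : ∀ e ∈ T, 2 * 16 ^ lev e.1 ≤ num (levelSet S lev (lev e.1)) (d e.1 (e.2 - e.1))) :
    energy rectClass (edgeWt (levelWt lev lam)) T ≤ 2 * (∑ j ∈ range m, lam j ^ 2) ^ 2 := by
  classical
  set f := levelWt lev lam with hf
  set Lam := ∑ j ∈ range m, lam j ^ 2 with hLam
  have h1 : energy rectClass (edgeWt f) T ≤ ∑ e ∈ T, ∑ e' ∈ T,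
      if rectClass e = rectClass e' then f e.1 ^ 2 * f e'.2 ^ 2 else 0 := by
    have hsym : ∑ e ∈ T, ∑ e' ∈ T,
        (if rectClass e = rectClass e' then f e.1 ^ 2 * f e'.2 ^ 2 else 0) =
        ∑ e ∈ T, ∑ e' ∈ T,
        (if rectClass e = rectClass e' then f e'.1 ^ 2 * f e.2 ^ 2 else 0) := by
      rw [sum_comm]
      refine sum_congr rfl fun e _ => sum_congr rfl fun e' _ => ?_
      simp only [eq_comm]
    have h2 : 2 * energy rectClass (edgeWt f) T ≤ ∑ e ∈ T, ∑ e' ∈ T,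
        (if rectClass e = rectClass e' then f e.1 ^ 2 * f e'.2 ^ 2 else 0) +
        ∑ e ∈ T, ∑ e' ∈ T,
        (if rectClass e = rectClass e' then f e'.1 ^ 2 * f e.2 ^ 2 else 0) := by
      rw [energy, mul_sum, ← sum_add_distrib]
      refine sum_le_sum fun e _ => ?_
      rw [mul_sum, ← sum_add_distrib]
      refine sum_le_sum fun e' _ => ?_
      split_ifs
      · simp only [edgeWt]
        nlinarith [sq_nonneg (f e.1 * f e'.2 - f e'.1 * f e.2)]
      · simp
    rw [← hsym] at h2
    linarith
  set Fl : Finset ((ℤ × ℤ) × (ℝ × ℝ)) := T.image fun e => (e.1, d e.1 (e.2 - e.1)) with hFl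
  set g : ((ℤ × ℤ) × (ℤ × ℤ)) × ((ℤ × ℤ) × (ℤ × ℤ)) → ((ℤ × ℤ) × (ℝ × ℝ)) × (ℤ × ℤ) :=
    fun z => ((z.1.1, d z.1.1 (z.1.2 - z.1.1)), z.2.2) with hg
  have hginj : Set.InjOn g {z ∈ T ×ˢ T | rectClass z.1 = rectClass z.2} := by
    rintro ⟨⟨p, q⟩, ⟨s, r⟩⟩ hz ⟨⟨p', q'⟩, ⟨s', r'⟩⟩ hz' h
    obtain ⟨hz1, hz2⟩ := hz
    obtain ⟨hz1', hz2'⟩ := hz'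
    rw [mem_product] at hz1 hz1'
    have n1 := hne _ hz1.1
    have n2 := hne _ hz1'.1
    rw [rectClass_eq_iff] at hz2 hz2'
    simp only [hg, Prod.mk.injEq] at h hz2 hz2' n1 n2
    obtain ⟨⟨rfl, h2⟩, rfl⟩ := h
    have hcr := hd _ _ _ n1 n2 h2
    have hu : q - p = q' - p := by
      refine eq_of_cross_of_dot n1 n2 hcr hz2.2 hz2'.2 ?_
      rw [hz2.1, hz2'.1]; abel
    have e1 : q = q' := by simpa using hu
    have e2 : s = s' := by
      have := hz2.1.symm.trans (hu.trans hz2'.1)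
      simpa using this
    rw [e1, e2]
  have h2 : ∑ e ∈ T, ∑ e' ∈ T,
      (if rectClass e = rectClass e' then f e.1 ^ 2 * f e'.2 ^ 2 else 0) ≤
      (∑ y ∈ Fl, f y.1 ^ 2) * ∑ r ∈ S, f r ^ 2 := by
    rw [← sum_product', ← sum_filter, sum_mul_sum, ← sum_product']
    have : ∑ z ∈ T ×ˢ T with rectClass z.1 = rectClass z.2, f z.1.1 ^ 2 * f z.2.2 ^ 2 =
        ∑ y ∈ ({z ∈ T ×ˢ T | rectClass z.1 = rectClass z.2} : Finset _).image g,
          f y.1.1 ^ 2 * f y.2 ^ 2 := by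
      rw [sum_image]
      intro z hz z' hz' h
      exact hginj (by simpa using hz) (by simpa using hz') h
    rw [this]
    refine sum_le_sum_of_subset_of_nonneg ?_ (by intros; positivity)
    intro y hy
    obtain ⟨z, hz, rfl⟩ := mem_image.1 hy
    have := mem_product.1 (mem_filter.1 hz).1
    exact mem_product.2 ⟨mem_image.2 ⟨z.1, this.1, rfl⟩, (mem_product.1 (hT this.2)).2⟩
  have h3 : ∑ y ∈ Fl, f y.1 ^ 2 ≤ 2 * Lam := by
    have hFlm : ∀ y ∈ Fl, y.1 ∈ S ∧ OnLine y.1 y.2 ∧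
        2 * 16 ^ lev y.1 ≤ num (levelSet S lev (lev y.1)) y.2 := by
      intro y hy
      obtain ⟨e, he, rfl⟩ := mem_image.1 hy
      exact ⟨(mem_product.1 (hT he)).1, hon _ _, hrich e he⟩
    rw [← sum_fiberwise_of_maps_to (g := fun y => lev y.1) (t := range m)
      fun y hy => mem_range.2 (hm _ (hFlm y hy).1), mul_sum]
    refine sum_le_sum fun j _ => ?_
    have hc : #{y ∈ Fl | lev y.1 = j} ≤ 2 * 256 ^ j := by
      refine le_trans ?_ (sum_num_rich_le (levelSet S lev j)
        (({y ∈ Fl | lev y.1 = j} : Finset _).image Prod.snd) (256 ^ j) (2 * 16 ^ j) (hcard j) ?_ ?_)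
      · rw [card_eq_sum_card_image Prod.snd]
        refine sum_le_sum fun l _ => card_le_card_of_injOn Prod.fst ?_ ?_
        · intro y hy
          obtain ⟨hy1, rfl⟩ := mem_filter.1 hy
          obtain ⟨hy2, hy3⟩ := mem_filter.1 hy1
          have := hFlm y hy2
          exact mem_filter.2 ⟨mem_filter.2 ⟨this.1, hy3⟩, this.2.1⟩
        · intro y hy y' hy' h
          exact Prod.ext h ((mem_filter.1 hy).2.trans (mem_filter.1 hy').2.symm)
      · rw [mul_pow, ← pow_mul, mul_comm j, pow_mul]; norm_num
      · intro l hl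
        obtain ⟨y, hy, rfl⟩ := mem_image.1 hl
        obtain ⟨hy1, hy2⟩ := mem_filter.1 hy
        have := (hFlm y hy1).2.2
        rwa [hy2] at this
    calc ∑ y ∈ Fl with lev y.1 = j, f y.1 ^ 2
        = ∑ y ∈ Fl with lev y.1 = j, lam j ^ 2 / 256 ^ j := by
          refine sum_congr rfl fun y hy => ?_
          rw [hf, levelWt_sq, (mem_filter.1 hy).2]
      _ = #{y ∈ Fl | lev y.1 = j} * (lam j ^ 2 / 256 ^ j) := by rw [sum_const, nsmul_eq_mul]
      _ ≤ (2 * 256 ^ j) * (lam j ^ 2 / 256 ^ j) := by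
          gcongr
          exact_mod_cast hc
      _ = _ := by field_simp
  have h4 := sum_levelWt_sq_le S lev lam m hm hcard
  have hL0 : 0 ≤ Lam := by positivity
  calc _ ≤ _ := h1.trans h2
    _ ≤ (2 * Lam) * Lam := by gcongr
    _ = _ := by ring

end

section

variable (S : Finset (ℤ × ℤ)) (lev : ℤ × ℤ → ℕ) (lam : ℕ → ℝ) (m : ℕ)

/-- The level of `e.1` contains no other point of the perpendicular to `e` at `e.1`. -/
def Lonely (e : (ℤ × ℤ) × (ℤ × ℤ)) : Prop :=
  cnt (levelSet S lev (lev e.1)) e.1 (lineDir e.1 (perp (e.2 - e.1))) = 0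

lemma Lonely.eq_of_rectClass_eq {e e' : (ℤ × ℤ) × (ℤ × ℤ)} (h : Lonely S lev e)
    (hne : e.2 - e.1 ≠ 0) (he' : e'.1 ∈ S) (hcl : rectClass e = rectClass e')
    (hl : lev e'.1 = lev e.1) : e = e' := by
  classical
  rw [rectClass_eq_iff] at hcl
  have h1 : e'.1 = e.1 := by
    by_contra hcon
    rw [Lonely, cnt, card_eq_zero, filter_eq_empty_iff] at h
    exact h (mem_filter.2 ⟨he', hl⟩) ⟨hcon, (onLine_perp_iff hne).2 hcl.2⟩
  refine Prod.ext h1.symm ?_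
  have h2 := hcl.1
  rw [h1] at h2
  simpa using h2

lemma sum_edgeWt_sq_le (hm : ∀ p ∈ S, lev p < m) (hcard : ∀ j, #(levelSet S lev j) ≤ 256 ^ j)
    (T : Finset ((ℤ × ℤ) × (ℤ × ℤ))) (hT : T ⊆ S ×ˢ S) :
    ∑ e ∈ T, edgeWt (levelWt lev lam) e ^ 2 ≤ (∑ j ∈ range m, lam j ^ 2) ^ 2 := by
  calc _ ≤ ∑ e ∈ S ×ˢ S, edgeWt (levelWt lev lam) e ^ 2 :=
        sum_le_sum_of_subset_of_nonneg hT (by intros; positivity)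
    _ = (∑ p ∈ S, levelWt lev lam p ^ 2) ^ 2 := by
        simp only [edgeWt, mul_pow]
        rw [sq, sum_mul_sum, sum_product]
    _ ≤ _ := by
        gcongr
        exact sum_levelWt_sq_le S lev lam m hm hcard

lemma energy_lonely_le (hm : ∀ p ∈ S, lev p < m) (hcard : ∀ j, #(levelSet S lev j) ≤ 256 ^ j)
    (T : Finset ((ℤ × ℤ) × (ℤ × ℤ))) (hT : T ⊆ S ×ˢ S) (hne : ∀ e ∈ T, e.2 - e.1 ≠ 0)
    (hlon : ∀ e ∈ T, Lonely S lev e) :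
    energy rectClass (edgeWt (levelWt lev lam)) T ≤ m * (∑ j ∈ range m, lam j ^ 2) ^ 2 := by
  classical
  set F := edgeWt (levelWt lev lam)
  have hK : ∀ e ∈ T, rectClass e ∈ T.image rectClass := fun e he => mem_image_of_mem _ he
  rw [energy_eq_sum_sq _ _ _ _ hK]
  calc _ ≤ ∑ k ∈ T.image rectClass, m * ∑ e ∈ T with rectClass e = k, F e ^ 2 := by
        refine sum_le_sum fun k _ => ?_
        refine sq_sum_le_card_mul_sum_sq.trans ?_
        gcongr
        rw [← card_range m]
        refine card_le_card_of_injOn (fun e => lev e.1) ?_ ?_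
        · intro e he
          exact mem_range.2 (hm _ (mem_product.1 (hT (mem_filter.1 he).1)).1)
        · intro e he e' he' h
          obtain ⟨h1, h2⟩ := mem_filter.1 he
          obtain ⟨h1', h2'⟩ := mem_filter.1 he'
          exact (hlon e h1).eq_of_rectClass_eq S lev (hne e h1) (mem_product.1 (hT h1')).1
            (h2.trans h2'.symm) h.symm
    _ = m * ∑ e ∈ T, F e ^ 2 := by
        rw [← mul_sum, sum_fiberwise_of_maps_to hK]
    _ ≤ _ := by
        gcongr
        exact sum_edgeWt_sq_le S lev lam m hm hcard T hT

open Classical in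
lemma energy_lonely_cap_le (hlam : ∀ j, 0 ≤ lam j) (hm : ∀ p ∈ S, lev p < m)
    (hcard : ∀ j, #(levelSet S lev j) ≤ 256 ^ j)
    (T : Finset ((ℤ × ℤ) × (ℤ × ℤ))) (hT : T ⊆ S ×ˢ S) (hne : ∀ e ∈ T, e.2 - e.1 ≠ 0)
    (hlon : ∀ e ∈ T, Lonely S lev e) (U : ℤ × ℤ → Prop) (hU : ∀ w, U w → U (-w))
    (hTU : ∀ e ∈ T, U (e.2 - e.1)) (h : ℕ) (hh : 1 ≤ h)
    (hcap : ∀ p ∈ S, ∀ v, v ≠ 0 → #{q ∈ S | U (q - p) ∧ dot v (q - p) = 0} ≤ h ^ 2) :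
    energy rectClass (edgeWt (levelWt lev lam)) T ≤
      17 * h * (∑ j ∈ range m, lam j ^ 2) ^ 2 := by
  set F := edgeWt (levelWt lev lam) with hF
  set Lam := ∑ j ∈ range m, lam j ^ 2 with hLam
  have hT1 : ∀ e ∈ T, e.1 ∈ S := fun e he => (mem_product.1 (hT he)).1
  have hT2 : ∀ e ∈ T, e.2 ∈ S := fun e he => (mem_product.1 (hT he)).2
  set Z := {z ∈ T ×ˢ T | rectClass z.1 = rectClass z.2 ∧ z.1 ≠ z.2} with hZ
  have hsplit : energy rectClass F T = ∑ e ∈ T, F e ^ 2 + ∑ z ∈ Z, F z.1 * F z.2 := by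
    rw [energy, ← sum_product', ← sum_filter,
      ← sum_filter_add_sum_filter_not _
        (fun z : ((ℤ × ℤ) × (ℤ × ℤ)) × ((ℤ × ℤ) × (ℤ × ℤ)) => z.1 = z.2),
      filter_filter, filter_filter]
    congr 1
    have : ({z ∈ T ×ˢ T | rectClass z.1 = rectClass z.2 ∧ z.1 = z.2} : Finset _) =
        T.image fun e => (e, e) := by
      ext ⟨e, e'⟩
      simp only [mem_filter, mem_product, mem_image, Prod.mk.injEq]
      constructor
      · rintro ⟨⟨h1, h2⟩, h3, rfl⟩; exact ⟨e, h1, rfl, rfl⟩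
      · rintro ⟨a, h1, rfl, rfl⟩; exact ⟨⟨h1, h1⟩, rfl, rfl⟩
    rw [this, sum_image (by intro a _ b _ h; exact (Prod.mk.inj h).1)]
    simp [sq]
  set ty : ((ℤ × ℤ) × (ℤ × ℤ)) × ((ℤ × ℤ) × (ℤ × ℤ)) → (ℕ × ℕ) × (ℕ × ℕ) :=
    fun z => ((lev z.1.1, lev z.2.2), (lev z.1.2, lev z.2.1)) with hty
  set G : ℕ × ℕ → ℝ := fun x => lam x.1 * lam x.2 * (1 / 2) ^ Nat.dist x.1 x.2 with hG
  have hZm : ∀ z ∈ Z, z.1 ∈ T ∧ z.2 ∈ T ∧ rectClass z.1 = rectClass z.2 ∧ z.1.1 ≠ z.2.1 ∧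
      z.1.2 ≠ z.2.2 := by
    intro z hz
    obtain ⟨h1, h2, h3⟩ := mem_filter.1 hz
    rw [mem_product] at h1
    have hd := (rectClass_eq_iff.1 h2).1
    refine ⟨h1.1, h1.2, h2, fun h4 => h3 (Prod.ext h4 ?_), fun h4 => h3 (Prod.ext ?_ h4)⟩
    · rw [h4] at hd; simpa using hd
    · rw [h4] at hd; simpa using hd
  have count : ∀ a b c d : ℕ, #{z ∈ Z | ty z = ((a, d), (b, c))} * 4 ^ (Nat.dist a d + Nat.dist b c)
      ≤ h * 16 ^ (a + b + c + d) := by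
    intro a b c d
    set Zt := {z ∈ Z | ty z = ((a, d), (b, c))} with hZt
    have hl : ∀ z ∈ Zt, z ∈ Z ∧ lev z.1.1 = a ∧ lev z.1.2 = b ∧ lev z.2.1 = c ∧ lev z.2.2 = d := by
      intro z hz
      obtain ⟨h1, h2⟩ := mem_filter.1 hz
      simp only [hty, Prod.mk.injEq] at h2
      exact ⟨h1, h2.1.1, h2.2.1, h2.2.2, h2.1.2⟩
    have b1 : #Zt ≤ 256 ^ (a + b) := by
      calc #Zt ≤ #(levelSet S lev a ×ˢ levelSet S lev b) := by
            refine card_le_card_of_injOn Prod.fst ?_ ?_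
            · intro z hz
              obtain ⟨h1, h2, h3, h4, h5⟩ := hl z hz
              have := hZm z h1
              exact mem_product.2 ⟨mem_filter.2 ⟨hT1 _ this.1, h2⟩, mem_filter.2 ⟨hT2 _ this.1, h3⟩⟩
            · intro z hz z' hz' he
              obtain ⟨h1, h2, h3, h4, h5⟩ := hl z hz
              obtain ⟨h1', h2', h3', h4', h5'⟩ := hl z' hz'
              obtain ⟨k1, k2, k3, -⟩ := hZm z h1
              obtain ⟨k1', k2', k3', -⟩ := hZm z' h1'
              refine Prod.ext he ?_
              exact (hlon _ k2).eq_of_rectClass_eq S lev (hne _ k2) (hT1 _ k2')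
                (by rw [← k3, ← k3', he]) (h4'.trans h4.symm)
        _ ≤ 256 ^ a * 256 ^ b := by rw [card_product]; exact Nat.mul_le_mul (hcard a) (hcard b)
        _ = _ := by rw [pow_add]
    have b2 : #Zt ≤ 256 ^ (c + d) := by
      calc #Zt ≤ #(levelSet S lev c ×ˢ levelSet S lev d) := by
            refine card_le_card_of_injOn Prod.snd ?_ ?_
            · intro z hz
              obtain ⟨h1, h2, h3, h4, h5⟩ := hl z hz
              have := hZm z h1
              exact mem_product.2 ⟨mem_filter.2 ⟨hT1 _ this.2.1, h4⟩,
                mem_filter.2 ⟨hT2 _ this.2.1, h5⟩⟩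
            · intro z hz z' hz' he
              obtain ⟨h1, h2, h3, h4, h5⟩ := hl z hz
              obtain ⟨h1', h2', h3', h4', h5'⟩ := hl z' hz'
              obtain ⟨k1, k2, k3, -⟩ := hZm z h1
              obtain ⟨k1', k2', k3', -⟩ := hZm z' h1'
              refine Prod.ext ?_ he
              exact (hlon _ k1).eq_of_rectClass_eq S lev (hne _ k1) (hT1 _ k1')
                (by rw [k3, k3', he]) (h2'.trans h2.symm)
        _ ≤ 256 ^ c * 256 ^ d := by rw [card_product]; exact Nat.mul_le_mul (hcard c) (hcard d)
        _ = _ := by rw [pow_add]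
    have b3 : #Zt ≤ h ^ 2 * 256 ^ (a + c) := by
      calc #Zt ≤ h ^ 2 * #(levelSet S lev a ×ˢ levelSet S lev c) := by
            refine card_le_mul_card_image_of_maps_to (f := fun z => (z.1.1, z.2.1)) ?_ _ ?_
            · intro z hz
              obtain ⟨h1, h2, h3, h4, h5⟩ := hl z hz
              have := hZm z h1
              exact mem_product.2 ⟨mem_filter.2 ⟨hT1 z.1 this.1, h2⟩,
                mem_filter.2 ⟨hT1 z.2 this.2.1, h4⟩⟩
            · rintro ⟨p, s⟩ hps
              obtain ⟨hp, hs⟩ := mem_product.1 hps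
              by_cases hne' : s - p = 0
              · rw [card_eq_zero.2]
                · positivity
                · rw [filter_eq_empty_iff]
                  intro z hz he
                  simp only [Prod.mk.injEq] at he
                  have := (hZm z (hl z hz).1).2.2.2.1
                  rw [he.1, he.2] at this
                  exact this (sub_eq_zero.1 hne').symm
              · refine le_trans ?_ (hcap p (mem_filter.1 hp).1 (s - p) hne')
                refine card_le_card_of_injOn (fun z => z.1.2) ?_ ?_
                · intro z hz
                  obtain ⟨hz1, hz2⟩ := mem_filter.1 hz
                  simp only [Prod.mk.injEq] at hz2
                  obtain ⟨k1, k2, k3, -⟩ := hZm z (hl z hz1).1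
                  refine mem_filter.2 ⟨hT2 _ k1, ?_, ?_⟩
                  · rw [← hz2.1]; exact hTU _ k1
                  · rw [dot_comm, ← hz2.1, ← hz2.2]; exact (rectClass_eq_iff.1 k3).2
                · intro z hz z' hz' he
                  obtain ⟨hz1, hz2⟩ := mem_filter.1 hz
                  obtain ⟨hz1', hz2'⟩ := mem_filter.1 hz'
                  simp only [Prod.mk.injEq] at hz2 hz2' he
                  have k3 := (rectClass_eq_iff.1 (hZm z (hl z hz1).1).2.2.1).1
                  have k3' := (rectClass_eq_iff.1 (hZm z' (hl z' hz1').1).2.2.1).1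
                  rw [he, hz2.1, hz2.2] at k3
                  rw [hz2'.1, hz2'.2] at k3'
                  have := k3.symm.trans k3'
                  refine Prod.ext (Prod.ext (hz2.1.trans hz2'.1.symm) he)
                    (Prod.ext (hz2.2.trans hz2'.2.symm) (by simpa using this))
        _ ≤ h ^ 2 * (256 ^ a * 256 ^ c) := by
            rw [card_product]; exact Nat.mul_le_mul_left _ (Nat.mul_le_mul (hcard a) (hcard c))
        _ = _ := by rw [pow_add]
    have b4 : #Zt ≤ h ^ 2 * 256 ^ (b + d) := by
      calc #Zt ≤ h ^ 2 * #(levelSet S lev b ×ˢ levelSet S lev d) := by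
            refine card_le_mul_card_image_of_maps_to (f := fun z => (z.1.2, z.2.2)) ?_ _ ?_
            · intro z hz
              obtain ⟨h1, h2, h3, h4, h5⟩ := hl z hz
              have := hZm z h1
              exact mem_product.2 ⟨mem_filter.2 ⟨hT2 z.1 this.1, h3⟩,
                mem_filter.2 ⟨hT2 z.2 this.2.1, h5⟩⟩
            · rintro ⟨q, r⟩ hqr
              obtain ⟨hq, hr⟩ := mem_product.1 hqr
              by_cases hne' : r - q = 0
              · rw [card_eq_zero.2]
                · positivity
                · rw [filter_eq_empty_iff]
                  intro z hz he
                  simp only [Prod.mk.injEq] at he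
                  have := (hZm z (hl z hz).1).2.2.2.2
                  rw [he.1, he.2] at this
                  exact this (sub_eq_zero.1 hne').symm
              · refine le_trans ?_ (hcap q (mem_filter.1 hq).1 (r - q) hne')
                refine card_le_card_of_injOn (fun z => z.1.1) ?_ ?_
                · intro z hz
                  obtain ⟨hz1, hz2⟩ := mem_filter.1 hz
                  simp only [Prod.mk.injEq] at hz2
                  obtain ⟨k1, k2, k3, -⟩ := hZm z (hl z hz1).1
                  obtain ⟨k4, k5⟩ := rectClass_eq_iff.1 k3
                  refine mem_filter.2 ⟨hT1 _ k1, ?_, ?_⟩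
                  · have := hU _ (hTU _ k1)
                    rwa [neg_sub, hz2.1] at this
                  · have k6 : r - q = z.2.1 - z.1.1 := by
                      rw [← hz2.1, ← hz2.2, sub_eq_sub_iff_add_eq_add]
                      rw [sub_eq_sub_iff_add_eq_add] at k4
                      rw [add_comm z.2.1, k4, add_comm]
                    rw [k6, ← hz2.1]
                    simp only [dot, Prod.fst_sub, Prod.snd_sub] at k5 ⊢
                    linarith
                · intro z hz z' hz' he
                  obtain ⟨hz1, hz2⟩ := mem_filter.1 hz
                  obtain ⟨hz1', hz2'⟩ := mem_filter.1 hz'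
                  simp only [Prod.mk.injEq] at hz2 hz2' he
                  have k3 := (rectClass_eq_iff.1 (hZm z (hl z hz1).1).2.2.1).1
                  have k3' := (rectClass_eq_iff.1 (hZm z' (hl z' hz1').1).2.2.1).1
                  rw [he, hz2.1, hz2.2] at k3
                  rw [hz2'.1, hz2'.2] at k3'
                  have := k3.symm.trans k3'
                  refine Prod.ext (Prod.ext he (hz2.1.trans hz2'.1.symm))
                    (Prod.ext (by simpa using this) (hz2.2.trans hz2'.2.symm))
        _ ≤ h ^ 2 * (256 ^ b * 256 ^ d) := by
            rw [card_product]; exact Nat.mul_le_mul_left _ (Nat.mul_le_mul (hcard b) (hcard d))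
        _ = _ := by rw [pow_add]
    set N := #Zt
    set D := Nat.dist a d + Nat.dist b c with hD
    have p256 : ∀ n, 256 ^ n = 16 ^ (2 * n) := fun n => by rw [pow_mul]; norm_num
    have h416 : (4 : ℕ) ^ D ≤ 16 ^ D := Nat.pow_le_pow_left (by norm_num) _
    have caseX : ∀ n, n + D + n = a + b + c + d → N ≤ 256 ^ n →
        N * 4 ^ D ≤ h * 16 ^ (a + b + c + d) := by
      intro n hn hN
      calc N * 4 ^ D ≤ 256 ^ n * 16 ^ D := Nat.mul_le_mul hN h416
        _ = 1 * 16 ^ (a + b + c + d) := by rw [p256, ← pow_add, ← hn, one_mul]; congr 1; omega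
        _ ≤ _ := Nat.mul_le_mul_right _ hh
    have caseY : ∀ n, n + D + n = a + b + c + d → N ≤ h ^ 2 * 256 ^ n →
        N * 4 ^ D ≤ h * 16 ^ (a + b + c + d) := by
      intro n hn hN
      have e1 : N * N ≤ 16 ^ (a + b + c + d) * 16 ^ (a + b + c + d) := by
        calc N * N ≤ 256 ^ (a + b) * 256 ^ (c + d) := Nat.mul_le_mul b1 b2
          _ = _ := by rw [p256, p256, ← pow_add, ← pow_add]; congr 1; omega
      have e2 : N ≤ 16 ^ (a + b + c + d) := Nat.mul_self_le_mul_self_iff.1 e1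
      have e3 : N * 16 ^ D ≤ h ^ 2 * 16 ^ (a + b + c + d) := by
        calc N * 16 ^ D ≤ h ^ 2 * 256 ^ n * 16 ^ D := Nat.mul_le_mul_right _ hN
          _ = _ := by rw [p256, mul_assoc, ← pow_add, ← hn]; congr 2; omega
      apply Nat.mul_self_le_mul_self_iff.1
      calc N * 4 ^ D * (N * 4 ^ D) = N * (N * 16 ^ D) := by
            have : (16 : ℕ) ^ D = 4 ^ D * 4 ^ D := by rw [← mul_pow]; norm_num
            rw [this]; ring
        _ ≤ 16 ^ (a + b + c + d) * (h ^ 2 * 16 ^ (a + b + c + d)) := Nat.mul_le_mul e2 e3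
        _ = _ := by ring
    have cases : (c + d) + D + (c + d) = a + b + c + d ∨ (a + b) + D + (a + b) = a + b + c + d ∨
        (b + d) + D + (b + d) = a + b + c + d ∨ (a + c) + D + (a + c) = a + b + c + d := by
      simp only [hD, Nat.dist]; omega
    rcases cases with hc | hc | hc | hc
    · exact caseX _ hc b2
    · exact caseX _ hc b1
    · exact caseY _ hc b4
    · exact caseY _ hc b3
  have hoff : ∑ z ∈ Z, F z.1 * F z.2 ≤ h * (4 * Lam) ^ 2 := by
    have hGsum : ∑ x ∈ range m ×ˢ range m, G x ≤ 4 * Lam := by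
      rw [sum_product]; exact sum_two_pow_dist_le lam m
    have hG0 : ∀ x, 0 ≤ G x := fun x =>
      mul_nonneg (mul_nonneg (hlam _) (hlam _)) (by positivity)
    calc ∑ z ∈ Z, F z.1 * F z.2
        = ∑ t ∈ (range m ×ˢ range m) ×ˢ (range m ×ˢ range m), ∑ z ∈ Z with ty z = t,
            F z.1 * F z.2 := by
          rw [sum_fiberwise_of_maps_to]
          intro z hz
          obtain ⟨h1, h2, -⟩ := hZm z hz
          simp only [hty, mem_product, mem_range]
          exact ⟨⟨hm _ (hT1 _ h1), hm _ (hT2 _ h2)⟩, hm _ (hT2 _ h1), hm _ (hT1 _ h2)⟩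
      _ ≤ ∑ t ∈ (range m ×ˢ range m) ×ˢ (range m ×ˢ range m), h * (G t.1 * G t.2) := by
          refine sum_le_sum fun t _ => ?_
          obtain ⟨⟨a, d⟩, ⟨b, c⟩⟩ := t
          have e1 : ∀ z ∈ {z ∈ Z | ty z = ((a, d), (b, c))}, F z.1 * F z.2 =
              lam a * lam d * (lam b * lam c) / 16 ^ (a + b + c + d) := by
            intro z hz
            have h2 := (mem_filter.1 hz).2
            simp only [hty, Prod.mk.injEq] at h2
            obtain ⟨⟨rfl, rfl⟩, rfl, rfl⟩ := h2
            simp only [hF, edgeWt, levelWt, pow_add]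
            field_simp
          rw [sum_congr rfl e1, sum_const, nsmul_eq_mul]
          have hc := count a b c d
          have hc' : (#{z ∈ Z | ty z = ((a, d), (b, c))} : ℝ) *
              4 ^ (Nat.dist a d + Nat.dist b c) ≤ h * 16 ^ (a + b + c + d) := by
            exact_mod_cast hc
          set D := Nat.dist a d + Nat.dist b c
          have hl0 : 0 ≤ lam a * lam d * (lam b * lam c) :=
            mul_nonneg (mul_nonneg (hlam _) (hlam _)) (mul_nonneg (hlam _) (hlam _))
          have e2 : (#{z ∈ Z | ty z = ((a, d), (b, c))} : ℝ) / 16 ^ (a + b + c + d) ≤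
              h * (1 / 2) ^ D := by
            rw [div_le_iff₀ (by positivity), one_div, inv_pow]
            have : (2 : ℝ) ^ D ≤ 4 ^ D := pow_le_pow_left₀ (by norm_num) (by norm_num) _
            have h5 : (#{z ∈ Z | ty z = ((a, d), (b, c))} : ℝ) * 2 ^ D ≤
                h * 16 ^ (a + b + c + d) := le_trans (by gcongr) hc'
            calc _ ≤ (h * 16 ^ (a + b + c + d)) / (2 : ℝ) ^ D := by
                  rw [le_div_iff₀ (by positivity)]; exact h5
              _ = _ := by field_simp
          calc _ = (#{z ∈ Z | ty z = ((a, d), (b, c))} : ℝ) / 16 ^ (a + b + c + d) *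
                (lam a * lam d * (lam b * lam c)) := by ring
            _ ≤ (h * (1 / 2) ^ D) * (lam a * lam d * (lam b * lam c)) := by gcongr
            _ = _ := by simp only [hG, D, pow_add]; ring
      _ = h * ((∑ x ∈ range m ×ˢ range m, G x) * ∑ x ∈ range m ×ˢ range m, G x) := by
          rw [← mul_sum, sum_product, ← sum_mul_sum]
      _ ≤ h * ((4 * Lam) * (4 * Lam)) := by
          have := sum_nonneg (s := range m ×ˢ range m) fun x _ => hG0 x
          gcongr
      _ = _ := by ring
  have hdiag := sum_edgeWt_sq_le S lev lam m hm hcard T hT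
  have hh' : (1 : ℝ) ≤ h := by exact_mod_cast hh
  rw [hsplit]
  nlinarith [sq_nonneg Lam]

end

lemma onLine_lineDir_sub {p s : ℤ × ℤ} (h : s ≠ p) : OnLine s (lineDir p (s - p)) := by
  rw [onLine_lineDir_iff (sub_ne_zero.2 h), mul_comm]

lemma lineDir_sub_eq {p s : ℤ × ℤ} {l : ℝ × ℝ} (h : s ≠ p) (hp : OnLine p l) (hs : OnLine s l) :
    lineDir p (s - p) = l :=
  line_unique h (onLine_lineDir_sub h) (onLine_lineDir p _) hs hp

lemma cross_eq_of_dot {v x y : ℤ × ℤ} (hv : v ≠ 0) (hx : dot v x = 0) (hy : dot v y = 0) :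
    x.1 * y.2 = x.2 * y.1 := by
  simp only [dot] at hx hy
  have e1 : v.1 * (x.1 * y.2 - x.2 * y.1) = 0 := by linear_combination y.2 * hx - x.2 * hy
  have e2 : v.2 * (x.1 * y.2 - x.2 * y.1) = 0 := by linear_combination x.1 * hy - y.1 * hx
  by_contra h
  have h' := sub_ne_zero.2 h
  exact hv (Prod.ext ((mul_eq_zero.1 e1).resolve_right h') ((mul_eq_zero.1 e2).resolve_right h'))

open Classical in
/-- Counting rectangles with one side in `A × B` along poor lines. -/
lemma card_rectClass_eq_le (A B : Finset (ℤ × ℤ)) (α β W i : ℕ) (hA : #A ≤ α ^ 2)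
    (hB : #B ≤ β ^ 2) (hα : 1 ≤ α) (hαβ : α ≤ β) (hW : 1 ≤ W)
    (U : ℤ × ℤ → Prop)
    (hcap : ∀ p ∈ A, ∀ v, v ≠ 0 → #{q ∈ B | U (q - p) ∧ dot v (q - p) = 0} ≤ 2 ^ i)
    (T : Finset ((ℤ × ℤ) × (ℤ × ℤ))) (hT : T ⊆ A ×ˢ B) (hne : ∀ e ∈ T, e.2 - e.1 ≠ 0)
    (hTU : ∀ e ∈ T, U (e.2 - e.1))
    (hpoor : ∀ e ∈ T, num A (lineDir e.1 (perp (e.2 - e.1))) < 2 * α)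
    (hpoor' : ∀ e ∈ T, num B (lineDir e.1 (e.2 - e.1)) < 2 * β)
    (hlon : ∀ e ∈ T, cnt A e.1 (lineDir e.1 (perp (e.2 - e.1))) ≠ 0) :
    (#{z ∈ T ×ˢ T | rectClass z.1 = rectClass z.2} : ℝ) ≤
      8 * 10 ^ 7 * (i + 1) * (α * β ^ 3 / W + W * α ^ 4) := by
  set n : (ℤ × ℤ) × (ℤ × ℤ) → ℕ := fun e => cnt A e.1 (lineDir e.1 (perp (e.2 - e.1))) with hn
  set al : (ℤ × ℤ) × (ℤ × ℤ) → ℕ := fun e =>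
    #{q ∈ B | (q ≠ e.1 ∧ OnLine q (lineDir e.1 (e.2 - e.1))) ∧ U (q - e.1)} with hal
  have hTA : ∀ e ∈ T, e.1 ∈ A := fun e he => (mem_product.1 (hT he)).1
  have hTB : ∀ e ∈ T, e.2 ∈ B := fun e he => (mem_product.1 (hT he)).2
  have hne' : ∀ e ∈ T, e.2 ≠ e.1 := fun e he => sub_ne_zero.1 (hne e he)
  have h1 : #{z ∈ T ×ˢ T | rectClass z.1 = rectClass z.2} ≤ ∑ e ∈ T, 2 * n e := by
    rw [card_filter, sum_product]
    refine sum_le_sum fun e he => ?_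
    rw [← card_filter]
    calc #{e' ∈ T | rectClass e = rectClass e'}
        ≤ #(insert e.1 {s ∈ A | s ≠ e.1 ∧ OnLine s (lineDir e.1 (perp (e.2 - e.1)))}) := by
          refine card_le_card_of_injOn Prod.fst ?_ ?_
          · intro e' he'
            obtain ⟨k1, k2⟩ := mem_filter.1 he'
            rw [rectClass_eq_iff] at k2
            by_cases h : e'.1 = e.1
            · exact mem_insert.2 (Or.inl h)
            · exact mem_insert_of_mem
                (mem_filter.2 ⟨hTA _ k1, h, (onLine_perp_iff (hne e he)).2 k2.2⟩)
          · intro e' he' e'' he'' h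
            have k2 := (rectClass_eq_iff.1 (mem_filter.1 he').2).1
            have k3 := (rectClass_eq_iff.1 (mem_filter.1 he'').2).1
            have k4 := k2.symm.trans k3
            rw [h] at k4
            exact Prod.ext h (by simpa using k4)
      _ ≤ n e + 1 := by
          refine (card_insert_le _ _).trans ?_
          simp only [hn, cnt]
          exact le_rfl
      _ ≤ 2 * n e := by have := hlon e he; simp only [hn]; omega
  have hX := sum_min_cnt_le A B α β i hA hB hα hαβ
  have hY := sum_min_cnt_le A A α α i hA hA hα le_rfl
  set X := ∑ p ∈ A, ∑ q ∈ B with q ≠ p ∧ num B (lineDir p (q - p)) < 2 * β,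
    min (cnt B p (lineDir p (q - p))) (2 ^ i)
  set Y := ∑ p ∈ A, ∑ q ∈ A with q ≠ p ∧ num A (lineDir p (q - p)) < 2 * α,
    min (cnt A p (lineDir p (q - p))) (2 ^ i)
  have c1 : W * ∑ e ∈ T with W * n e ≤ al e, n e ≤ X := by
    rw [mul_sum]
    calc _ ≤ ∑ e ∈ T with W * n e ≤ al e, min (cnt B e.1 (lineDir e.1 (e.2 - e.1))) (2 ^ i) := by
          refine sum_le_sum fun e he => ?_
          obtain ⟨k1, k2⟩ := mem_filter.1 he
          refine k2.trans (le_min ?_ ?_)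
          · rw [cnt]
            refine card_le_card fun q hq => ?_
            obtain ⟨k3, k4⟩ := mem_filter.1 hq
            exact mem_filter.2 ⟨k3, k4.1⟩
          · refine le_trans (card_le_card fun q hq => ?_)
              (hcap e.1 (hTA e k1) _ (perp_ne_zero (hne e k1)))
            obtain ⟨k3, k4⟩ := mem_filter.1 hq
            exact mem_filter.2 ⟨k3, k4.2, (onLine_lineDir_iff_dot (hne e k1)).1 k4.1.2⟩
      _ ≤ X := by
          simp only [X, sum_filter]
          rw [← sum_product' A B (fun p q => if q ≠ p ∧ num B (lineDir p (q - p)) < 2 * β then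
            min (cnt B p (lineDir p (q - p))) (2 ^ i) else 0), ← sum_filter, ← sum_filter]
          refine sum_le_sum_of_subset fun e he => ?_
          have k1 := (mem_filter.1 he).1
          exact mem_filter.2 ⟨hT k1, hne' e k1, hpoor' e k1⟩
  have c2 : ∑ e ∈ T with ¬ W * n e ≤ al e, n e ≤ W * Y := by
    set T2 := {e ∈ T | ¬ W * n e ≤ al e} with hT2
    have hT2T : ∀ e ∈ T2, e ∈ T := fun e he => (mem_filter.1 he).1
    have e1 : ∑ e ∈ T2, n e = ∑ x ∈ A ×ˢ A,
        #{e ∈ T2 | e.1 = x.1 ∧ x.2 ≠ x.1 ∧ OnLine x.2 (lineDir e.1 (perp (e.2 - e.1)))} := by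
      simp only [hn, cnt, card_filter]
      rw [sum_comm, sum_product_right]
      refine sum_congr rfl fun s _ => ?_
      rw [sum_comm]
      refine sum_congr rfl fun e he => ?_
      rw [sum_eq_single e.1]
      · simp
      · intro p _ hp; rw [if_neg]; exact fun h => hp h.1.symm
      · intro h; exact absurd (hTA e (hT2T e he)) h
    rw [e1]
    simp only [Y, sum_filter]
    rw [← sum_product' A A (fun p q => if q ≠ p ∧ num A (lineDir p (q - p)) < 2 * α then
            min (cnt A p (lineDir p (q - p))) (2 ^ i) else 0), mul_sum]
    refine sum_le_sum ?_
    rintro ⟨p, s⟩ hps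
    obtain ⟨hp, hs⟩ := mem_product.1 hps
    simp only at hp hs ⊢
    set V := {e ∈ T2 | e.1 = p ∧ s ≠ p ∧ OnLine s (lineDir e.1 (perp (e.2 - e.1)))} with hV
    rcases V.eq_empty_or_nonempty with h0 | ⟨e0, he0⟩
    · rw [h0, card_empty]; exact Nat.zero_le _
    · obtain ⟨k1, k2, k3, k4⟩ := mem_filter.1 he0
      have line : ∀ e ∈ V, lineDir p (s - p) = lineDir e.1 (perp (e.2 - e.1)) := by
        intro e he
        obtain ⟨j1, j2, j3, j4⟩ := mem_filter.1 he
        exact lineDir_sub_eq j3 (by rw [← j2]; exact onLine_lineDir _ _) j4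
      have dots : ∀ e ∈ V, dot (s - p) (e.2 - p) = 0 := by
        intro e he
        obtain ⟨j1, j2, j3, j4⟩ := mem_filter.1 he
        rw [onLine_perp_iff (hne e (hT2T e j1)), dot_comm, j2] at j4
        exact j4
      have inj : Set.InjOn Prod.snd (V : Set ((ℤ × ℤ) × (ℤ × ℤ))) := by
        intro e he e' he' h
        have j := (mem_filter.1 he).2.1
        have j' := (mem_filter.1 he').2.1
        exact Prod.ext (j.trans j'.symm) h
      have hpoor0 : num A (lineDir p (s - p)) < 2 * α := by
        rw [line e0 he0]; exact hpoor e0 (hT2T e0 k1)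
      rw [if_pos ⟨k3, hpoor0⟩]
      have b1 : #V ≤ 2 ^ i := by
        refine le_trans (card_le_card_of_injOn Prod.snd ?_ inj)
          (hcap p hp (s - p) (sub_ne_zero.2 k3))
        intro e he
        obtain ⟨j1, j2, j3, j4⟩ := mem_filter.1 he
        refine mem_filter.2 ⟨hTB e (hT2T e j1), ?_, dots e he⟩
        rw [← j2]; exact hTU e (hT2T e j1)
      have b2 : #V ≤ W * cnt A p (lineDir p (s - p)) := by
        have : al e0 < W * n e0 := not_le.1 (mem_filter.1 k1).2
        have h5 : n e0 = cnt A p (lineDir p (s - p)) := by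
          simp only [hn]; rw [line e0 he0, k2]
        rw [← h5]
        refine le_trans (card_le_card_of_injOn Prod.snd ?_ inj) this.le
        intro e he
        obtain ⟨j1, j2, j3, j4⟩ := mem_filter.1 he
        have hu0 := hne e0 (hT2T e0 k1)
        refine mem_filter.2 ⟨hTB e (hT2T e j1), ⟨?_, ?_⟩, ?_⟩
        · rw [k2, ← j2]; exact hne' e (hT2T e j1)
        · rw [onLine_lineDir_iff hu0]
          have d1 := dots e he
          have d0 := dots e0 he0
          rw [k2]
          exact cross_eq_of_dot (sub_ne_zero.2 k3) d1 d0
        · rw [k2, ← j2]; exact hTU e (hT2T e j1)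
      rcases le_total (cnt A p (lineDir p (s - p))) (2 ^ i) with h6 | h6
      · rw [min_eq_left h6]; exact b2
      · rw [min_eq_right h6]; exact b1.trans (Nat.le_mul_of_pos_left _ hW)
  have hsum := sum_filter_add_sum_filter_not T (fun e => W * n e ≤ al e) n
  have hWr : (0 : ℝ) < W := by exact_mod_cast hW
  have r1 : ((∑ e ∈ T with W * n e ≤ al e, n e : ℕ) : ℝ) ≤
      4 * 10 ^ 7 * (i + 1) * (α * β ^ 3) / W := by
    rw [le_div_iff₀ hWr, mul_comm]
    exact le_trans (by exact_mod_cast c1) hX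
  have r2 : ((∑ e ∈ T with ¬ W * n e ≤ al e, n e : ℕ) : ℝ) ≤
      W * (4 * 10 ^ 7 * (i + 1) * (α * α ^ 3)) := by
    refine le_trans (by exact_mod_cast c2) (?_ : ((W * Y : ℕ) : ℝ) ≤ _)
    rw [Nat.cast_mul]
    gcongr
  rw [← mul_sum, ← hsum] at h1
  have h1' : (#{z ∈ T ×ˢ T | rectClass z.1 = rectClass z.2} : ℝ) ≤
      2 * ((∑ e ∈ T with W * n e ≤ al e, n e : ℕ) + (∑ e ∈ T with ¬ W * n e ≤ al e, n e : ℕ)) := by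
    exact_mod_cast h1
  calc _ ≤ 2 * (4 * 10 ^ 7 * (i + 1) * (α * β ^ 3) / W +
        W * (4 * 10 ^ 7 * (i + 1) * (α * α ^ 3)) : ℝ) := by linarith
    _ = _ := by ring

section

variable (S : Finset (ℤ × ℤ)) (lev : ℤ × ℤ → ℕ) (lam : ℕ → ℝ) (m : ℕ)

/-- The line `d` of `e` at `e.1` carries many points of the level of `e.1`. -/
def Rich (d : ℤ × ℤ → ℤ × ℤ → ℝ × ℝ) (e : (ℤ × ℤ) × (ℤ × ℤ)) : Prop :=
  2 * 16 ^ lev e.1 ≤ num (levelSet S lev (lev e.1)) (d e.1 (e.2 - e.1))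

/-- Neither of the lines of `e` at `e.1` is rich, and the perpendicular is not lonely. -/
def GoodAt (e : (ℤ × ℤ) × (ℤ × ℤ)) : Prop :=
  ¬ Rich S lev (fun p u => lineDir p (perp u)) e ∧ ¬ Rich S lev lineDir e ∧ ¬ Lonely S lev e

lemma rectClass_swap_iff {e e' : (ℤ × ℤ) × (ℤ × ℤ)} :
    rectClass e.swap = rectClass e'.swap ↔ rectClass e = rectClass e' := by
  obtain ⟨⟨a, b⟩, ⟨c, d⟩⟩ := e
  obtain ⟨⟨a', b'⟩, ⟨c', d'⟩⟩ := e'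
  simp only [rectClass_eq_iff, dot, Prod.fst_swap, Prod.snd_swap, Prod.mk_sub_mk, Prod.mk.injEq]
  constructor
  · rintro ⟨⟨h1, h2⟩, h3⟩
    have k1 : a' = c' + a - c := by linarith
    have k2 : b' = d' + b - d := by linarith
    subst k1 k2
    exact ⟨⟨by ring, by ring⟩, by linear_combination -h3⟩
  · rintro ⟨⟨h1, h2⟩, h3⟩
    have k1 : c' = a' + c - a := by linarith
    have k2 : d' = b' + d - b := by linarith
    subst k1 k2
    exact ⟨⟨by ring, by ring⟩, by linear_combination -h3⟩

lemma energy_swap (f : ℤ × ℤ → ℝ) (T : Finset ((ℤ × ℤ) × (ℤ × ℤ))) :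
    energy rectClass (edgeWt f) (T.map (Equiv.prodComm _ _).toEmbedding) =
      energy rectClass (edgeWt f) T := by
  refine energy_map _ _ _ _ _ _ (fun e _ => ?_) fun e _ e' _ => ?_
  · simp [edgeWt, mul_comm]
  · exact rectClass_swap_iff

lemma energy_one (T : Finset ((ℤ × ℤ) × (ℤ × ℤ))) :
    energy rectClass (edgeWt 1) T = #{z ∈ T ×ˢ T | rectClass z.1 = rectClass z.2} := by
  rw [energy, ← sum_product', card_filter]
  push_cast
  exact sum_congr rfl fun z _ => by simp [edgeWt]

open Classical in
lemma energy_one_le_of_le (hcard : ∀ j, #(levelSet S lev j) ≤ 256 ^ j)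
    (T : Finset ((ℤ × ℤ) × (ℤ × ℤ))) (hT : T ⊆ S ×ˢ S) (hne : ∀ e ∈ T, e.2 - e.1 ≠ 0)
    (U : ℤ × ℤ → Prop) (hTU : ∀ e ∈ T, U (e.2 - e.1)) (i : ℕ)
    (hcap : ∀ p ∈ S, ∀ v, v ≠ 0 → #{q ∈ S | U (q - p) ∧ dot v (q - p) = 0} ≤ 2 ^ i)
    (hgood : ∀ e ∈ T, GoodAt S lev e) (hgood' : ∀ e ∈ T, GoodAt S lev e.swap) {a b : ℕ}
    (hab : a ≤ b) (hta : ∀ e ∈ T, lev e.1 = a ∧ lev e.2 = b) :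
    energy rectClass (edgeWt 1) T * 4 ^ Nat.dist a b ≤
      16 * 10 ^ 7 * (i + 1) * (256 ^ a * 256 ^ b) := by
  obtain ⟨k, rfl⟩ := Nat.exists_eq_add_of_le hab
  have hc : ∀ j, #(levelSet S lev j) ≤ (16 ^ j) ^ 2 := fun j => by
    rw [← pow_mul, mul_comm, pow_mul]; exact hcard j
  have hTS : ∀ e ∈ T, e.1 ∈ S ∧ e.2 ∈ S := fun e he => mem_product.1 (hT he)
  have key := card_rectClass_eq_le (levelSet S lev a) (levelSet S lev (a + k)) (16 ^ a)
    (16 ^ (a + k)) (64 ^ k) i (hc _) (hc _) (Nat.one_le_pow _ _ (by norm_num))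
    (Nat.pow_le_pow_right (by norm_num) hab) (Nat.one_le_pow _ _ (by norm_num)) U
    (fun p hp v hv => le_trans (card_le_card (filter_subset_filter _ (filter_subset _ _)))
      (hcap p (mem_filter.1 hp).1 v hv)) T
    (fun e he => mem_product.2 ⟨mem_filter.2 ⟨(hTS e he).1, (hta e he).1⟩,
      mem_filter.2 ⟨(hTS e he).2, (hta e he).2⟩⟩) hne hTU
    (fun e he => ?_) (fun e he => ?_) (fun e he => ?_)
  · rw [energy_one]
    have hd : Nat.dist a (a + k) = k := by simp [Nat.dist]
    rw [hd]
    push_cast at key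
    calc _ ≤ (8 * 10 ^ 7 * (i + 1) *
          (16 ^ a * (16 ^ (a + k)) ^ 3 / 64 ^ k + 64 ^ k * (16 ^ a) ^ 4)) *
          (4 : ℝ) ^ k := by gcongr
      _ = _ := by
        have e1 : (16 : ℝ) ^ k = 4 ^ k * 4 ^ k := by rw [← mul_pow]; norm_num
        have e2 : (64 : ℝ) ^ k = 4 ^ k * 4 ^ k * 4 ^ k := by rw [← mul_pow, ← mul_pow]; norm_num
        have e3 : (256 : ℝ) ^ k = 4 ^ k * 4 ^ k * 4 ^ k * 4 ^ k := by
          rw [← mul_pow, ← mul_pow, ← mul_pow]; norm_num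
        have e4 : (256 : ℝ) ^ a = 16 ^ a * 16 ^ a := by rw [← mul_pow]; norm_num
        rw [pow_add, pow_add, e1, e2, e3, e4]
        field_simp
        ring
  · have := (hgood e he).1
    rw [Rich, (hta e he).1] at this
    exact not_le.1 this
  · have := (hgood' e he).2.1
    simp only [Rich, Prod.fst_swap, Prod.snd_swap, (hta e he).2] at this
    have hne' : e.2 ≠ e.1 := sub_ne_zero.1 (hne e he)
    rw [lineDir_sub_eq hne' (l := lineDir e.2 (e.1 - e.2)) (onLine_lineDir_sub hne'.symm)
      (onLine_lineDir _ _)]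
    exact not_le.1 this
  · have := (hgood e he).2.2
    rwa [Lonely, (hta e he).1] at this

open Classical in
lemma energy_one_le (hcard : ∀ j, #(levelSet S lev j) ≤ 256 ^ j)
    (T : Finset ((ℤ × ℤ) × (ℤ × ℤ))) (hT : T ⊆ S ×ˢ S) (hne : ∀ e ∈ T, e.2 - e.1 ≠ 0)
    (U : ℤ × ℤ → Prop) (hU : ∀ w, U w → U (-w)) (hTU : ∀ e ∈ T, U (e.2 - e.1)) (i : ℕ)
    (hcap : ∀ p ∈ S, ∀ v, v ≠ 0 → #{q ∈ S | U (q - p) ∧ dot v (q - p) = 0} ≤ 2 ^ i)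
    (hgood : ∀ e ∈ T, GoodAt S lev e) (hgood' : ∀ e ∈ T, GoodAt S lev e.swap) {a b : ℕ}
    (hta : ∀ e ∈ T, lev e.1 = a ∧ lev e.2 = b) :
    energy rectClass (edgeWt 1) T * 4 ^ Nat.dist a b ≤
      16 * 10 ^ 7 * (i + 1) * (256 ^ a * 256 ^ b) := by
  rcases le_total a b with hab | hab
  · exact energy_one_le_of_le S lev hcard T hT hne U hTU i hcap hgood hgood' hab hta
  · rw [← energy_swap, Nat.dist_comm, mul_comm (256 ^ a)]
    have hm : ∀ e ∈ T.map (Equiv.prodComm (ℤ × ℤ) (ℤ × ℤ)).toEmbedding, e.swap ∈ T := by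
      intro e he
      obtain ⟨e', h1, rfl⟩ := mem_map.1 he
      simpa using h1
    refine energy_one_le_of_le S lev hcard _ ?_ ?_ U ?_ i hcap ?_ ?_ hab ?_
    · intro e he
      have := mem_product.1 (hT (hm e he))
      exact mem_product.2 ⟨this.2, this.1⟩
    · intro e he h
      refine hne _ (hm e he) ?_
      rw [Prod.snd_swap, Prod.fst_swap, ← neg_sub, h, neg_zero]
    · intro e he
      have := hU _ (hTU _ (hm e he))
      rwa [neg_sub] at this
    · intro e he
      exact hgood' _ (hm e he)
    · intro e he
      exact hgood _ (hm e he)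
    · intro e he
      exact (hta _ (hm e he)).symm

open Classical in
lemma energy_good_le (hlam : ∀ j, 0 ≤ lam j) (hm : ∀ p ∈ S, lev p < m)
    (hcard : ∀ j, #(levelSet S lev j) ≤ 256 ^ j)
    (T : Finset ((ℤ × ℤ) × (ℤ × ℤ))) (hT : T ⊆ S ×ˢ S) (hne : ∀ e ∈ T, e.2 - e.1 ≠ 0)
    (U : ℤ × ℤ → Prop) (hU : ∀ w, U w → U (-w)) (hTU : ∀ e ∈ T, U (e.2 - e.1)) (i : ℕ)
    (hcap : ∀ p ∈ S, ∀ v, v ≠ 0 → #{q ∈ S | U (q - p) ∧ dot v (q - p) = 0} ≤ 2 ^ i)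
    (hgood : ∀ e ∈ T, GoodAt S lev e) (hgood' : ∀ e ∈ T, GoodAt S lev e.swap) :
    energy rectClass (edgeWt (levelWt lev lam)) T ≤
      256 * 10 ^ 7 * (i + 1) * (∑ j ∈ range m, lam j ^ 2) ^ 2 := by
  have hTS : ∀ e ∈ T, e.1 ∈ S ∧ e.2 ∈ S := fun e he => mem_product.1 (hT he)
  set C : ℝ := 16 * 10 ^ 7 * (i + 1) with hC
  have hC0 : 0 ≤ C := by positivity
  have type_le : ∀ a b : ℕ, √(energy rectClass (edgeWt (levelWt lev lam))
      {e ∈ T | (lev e.1, lev e.2) = (a, b)}) ≤ √C * (lam a * lam b * (1 / 2) ^ Nat.dist a b) := by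
    intro a b
    set T' := {e ∈ T | (lev e.1, lev e.2) = (a, b)} with hT'
    have hs : ∀ e ∈ T', e ∈ T ∧ lev e.1 = a ∧ lev e.2 = b := fun e he => by
      simpa [hT'] using he
    have h1 := energy_one_le S lev hcard T' (fun e he => hT (hs e he).1)
      (fun e he => hne e (hs e he).1) U hU (fun e he => hTU e (hs e he).1) i hcap
      (fun e he => hgood e (hs e he).1) (fun e he => hgood' e (hs e he).1) (fun e he => (hs e he).2)
    have h2 : energy rectClass (edgeWt (levelWt lev lam)) T' =
        (lam a * lam b) ^ 2 / (256 ^ a * 256 ^ b) * energy rectClass (edgeWt 1) T' := by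
      rw [energy, energy, mul_sum]
      refine sum_congr rfl fun e he => ?_
      rw [mul_sum]
      refine sum_congr rfl fun e' he' => ?_
      have e4 : ∀ n, (256 : ℝ) ^ n = 16 ^ n * 16 ^ n := fun n => by rw [← mul_pow]; norm_num
      obtain ⟨-, h3, h4⟩ := hs e he
      obtain ⟨-, h3', h4'⟩ := hs e' he'
      split_ifs
      · simp only [edgeWt, levelWt, h3, h4, h3', h4', e4, Pi.one_apply]
        field_simp
      · simp
    have hx : 0 ≤ lam a * lam b * (1 / 2) ^ Nat.dist a b :=
      mul_nonneg (mul_nonneg (hlam _) (hlam _)) (by positivity)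
    rw [← Real.sqrt_sq hx, ← Real.sqrt_mul hC0]
    refine Real.sqrt_le_sqrt ?_
    rw [h2, div_mul_eq_mul_div, div_le_iff₀ (by positivity)]
    have h5 : energy rectClass (edgeWt 1) T' ≤ C * (256 ^ a * 256 ^ b) / 4 ^ Nat.dist a b := by
      rw [le_div_iff₀ (by positivity)]; exact h1
    calc _ ≤ (lam a * lam b) ^ 2 * (C * (256 ^ a * 256 ^ b) / 4 ^ Nat.dist a b) := by gcongr
      _ = _ := by
        have e5 : (4 : ℝ) ^ Nat.dist a b = 2 ^ Nat.dist a b * 2 ^ Nat.dist a b := by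
          rw [← mul_pow]; norm_num
        rw [e5, one_div, inv_pow]
        field_simp
  calc _ ≤ _ := energy_le_sq_sum_sqrt rectClass (edgeWt (levelWt lev lam)) T
        (fun e => (lev e.1, lev e.2)) (range m ×ˢ range m) fun e he =>
          mem_product.2 ⟨mem_range.2 (hm _ (hTS e he).1), mem_range.2 (hm _ (hTS e he).2)⟩
    _ ≤ (∑ x ∈ range m ×ˢ range m,
          √C * (lam x.1 * lam x.2 * (1 / 2) ^ Nat.dist x.1 x.2)) ^ 2 := by
        gcongr with x hx
        exact type_le x.1 x.2
    _ ≤ (√C * (4 * ∑ j ∈ range m, lam j ^ 2)) ^ 2 := by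
        rw [← mul_sum]
        refine pow_le_pow_left₀ ?_ ?_ 2
        · refine mul_nonneg (Real.sqrt_nonneg _) (sum_nonneg fun x _ => ?_)
          exact mul_nonneg (mul_nonneg (hlam _) (hlam _)) (by positivity)
        · refine mul_le_mul_of_nonneg_left ?_ (Real.sqrt_nonneg _)
          rw [sum_product]
          exact sum_two_pow_dist_le lam m
    _ = _ := by rw [mul_pow, Real.sq_sqrt hC0, hC]; ring

end

section

variable (S : Finset (ℤ × ℤ)) (lev : ℤ × ℤ → ℕ) (lam : ℕ → ℝ) (m : ℕ)

lemma lineDir_perp_cross {p u u' : ℤ × ℤ} (hu : u ≠ 0) (hu' : u' ≠ 0)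
    (h : lineDir p (perp u) = lineDir p (perp u')) : u.1 * u'.2 = u.2 * u'.1 := by
  have := cross_eq_of_lineDir_eq (perp_ne_zero hu) (perp_ne_zero hu') h
  simp only [perp] at this
  linarith

open Classical in
/-- Reduction of the energy to the good and lonely parts. -/
lemma energy_le_of_lonely_le (hlam : ∀ j, 0 ≤ lam j) (hm : ∀ p ∈ S, lev p < m)
    (hcard : ∀ j, #(levelSet S lev j) ≤ 256 ^ j)
    (U : ℤ × ℤ → Prop) (hU : ∀ w, U w → U (-w)) (i : ℕ)
    (hcap : ∀ p ∈ S, ∀ v, v ≠ 0 → #{q ∈ S | U (q - p) ∧ dot v (q - p) = 0} ≤ 2 ^ i) (L : ℝ)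
    (hL : ∀ T ⊆ S ×ˢ S, (∀ e ∈ T, e.2 - e.1 ≠ 0) → (∀ e ∈ T, U (e.2 - e.1)) →
      (∀ e ∈ T, Lonely S lev e) → energy rectClass (edgeWt (levelWt lev lam)) T ≤ L)
    (T : Finset ((ℤ × ℤ) × (ℤ × ℤ))) (hT : T ⊆ S ×ˢ S) (hne : ∀ e ∈ T, e.2 - e.1 ≠ 0)
    (hTU : ∀ e ∈ T, U (e.2 - e.1)) :
    energy rectClass (edgeWt (levelWt lev lam)) T ≤
      72 * L + (108 + 16384 * 10 ^ 7 * (i + 1)) * (∑ j ∈ range m, lam j ^ 2) ^ 2 := by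
  set E := energy rectClass (edgeWt (levelWt lev lam)) with hE
  set Lam := ∑ j ∈ range m, lam j ^ 2
  set Q : Finset ((ℤ × ℤ) × (ℤ × ℤ)) → Prop := fun T =>
    T ⊆ S ×ˢ S ∧ (∀ e ∈ T, e.2 - e.1 ≠ 0) ∧ (∀ e ∈ T, U (e.2 - e.1)) with hQ
  have Qf : ∀ T (P : (ℤ × ℤ) × (ℤ × ℤ) → Prop), Q T → Q {e ∈ T | P e} := fun T P h =>
    ⟨(filter_subset _ _).trans h.1, fun e he => h.2.1 e (mem_filter.1 he).1,
      fun e he => h.2.2 e (mem_filter.1 he).1⟩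
  have Qs : ∀ T, Q T → Q (T.map (Equiv.prodComm (ℤ × ℤ) (ℤ × ℤ)).toEmbedding) := by
    intro T h
    have hm : ∀ e ∈ T.map (Equiv.prodComm (ℤ × ℤ) (ℤ × ℤ)).toEmbedding, e.swap ∈ T := by
      intro e he
      obtain ⟨e', h1, rfl⟩ := mem_map.1 he
      simpa using h1
    refine ⟨fun e he => ?_, fun e he h0 => ?_, fun e he => ?_⟩
    · have := mem_product.1 (h.1 (hm e he))
      exact mem_product.2 ⟨this.2, this.1⟩
    · refine h.2.1 _ (hm e he) ?_
      rw [Prod.snd_swap, Prod.fst_swap, ← neg_sub, h0, neg_zero]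
    · have := hU _ (h.2.2 _ (hm e he))
      rwa [neg_sub] at this
  -- a bound for edges with property `P` gives one for edges whose swap has it
  have swap : ∀ (P : (ℤ × ℤ) × (ℤ × ℤ) → Prop) (X : ℝ),
      (∀ T, Q T → (∀ e ∈ T, P e) → E T ≤ X) → ∀ T, Q T → (∀ e ∈ T, P e.swap) → E T ≤ X := by
    intro P X h T hT hP
    rw [hE, ← energy_swap]
    refine h _ (Qs T hT) fun e he => ?_
    obtain ⟨e', h1, rfl⟩ := mem_map.1 he
    exact hP e' h1
  have step : ∀ (P : (ℤ × ℤ) × (ℤ × ℤ) → Prop) (X : ℝ),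
      (∀ T, Q T → (∀ e ∈ T, P e) → E T ≤ X) →
      ∀ T, Q T → ∃ T' ⊆ T, Q T' ∧ (∀ e ∈ T', ¬ P e) ∧ E T ≤ 2 * X + 2 * E T' := by
    intro P X h T hT
    refine ⟨{e ∈ T | ¬ P e}, filter_subset _ _, ?_, fun e he => (mem_filter.1 he).2, ?_⟩
    · convert Qf T (fun e => ¬ P e) hT
    · have h1 := energy_le_filter rectClass (edgeWt (levelWt lev lam)) T P
      have h2 := h _ (Qf T P hT) fun e he => (mem_filter.1 he).2
      linarith
  have b1 : ∀ T, Q T → (∀ e ∈ T, Rich S lev (fun p u => lineDir p (perp u)) e) →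
      E T ≤ 2 * Lam ^ 2 :=
    fun T h hr => energy_rich_le S lev lam m hm hcard T h.1 h.2.1 _
      (fun p u => onLine_lineDir p _) (fun p u u' => lineDir_perp_cross) hr
  have b2 : ∀ T, Q T → (∀ e ∈ T, Rich S lev lineDir e) → E T ≤ 2 * Lam ^ 2 :=
    fun T h hr => energy_rich_le S lev lam m hm hcard T h.1 h.2.1 _
      onLine_lineDir (fun p u u' => cross_eq_of_lineDir_eq) hr
  have b3 : ∀ T, Q T → (∀ e ∈ T, Lonely S lev e) → E T ≤ L :=
    fun T h hr => hL T h.1 h.2.1 h.2.2 hr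
  have q0 : Q T := ⟨hT, hne, hTU⟩
  obtain ⟨T1, t1, q1, n1, s1⟩ := step _ _ b1 _ q0
  obtain ⟨T2, t2, q2, n2, s2⟩ := step _ _ b2 _ q1
  obtain ⟨T3, t3, q3, n3, s3⟩ := step _ _ b3 _ q2
  obtain ⟨T4, t4, q4, n4, s4⟩ := step _ _ (swap _ _ b1) _ q3
  obtain ⟨T5, t5, q5, n5, s5⟩ := step _ _ (swap _ _ b2) _ q4
  obtain ⟨T6, t6, q6, n6, s6⟩ := step _ _ (swap _ _ b3) _ q5
  have good : E _ ≤ 256 * 10 ^ 7 * (i + 1) * Lam ^ 2 :=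
    energy_good_le S lev lam m hlam hm hcard T6 q6.1 q6.2.1 U hU q6.2.2 i hcap
      (fun e he => ⟨n1 e (t2 (t3 (t4 (t5 (t6 he))))), n2 e (t3 (t4 (t5 (t6 he)))),
        n3 e (t4 (t5 (t6 he)))⟩)
      (fun e he => ⟨n4 e (t5 (t6 he)), n5 e (t6 he), n6 e he⟩)
  linarith

lemma energy_le_log (hlam : ∀ j, 0 ≤ lam j) (hm : ∀ p ∈ S, lev p < m)
    (hcard : ∀ j, #(levelSet S lev j) ≤ 256 ^ j) (i : ℕ) (hS : #S ≤ 2 ^ i)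
    (T : Finset ((ℤ × ℤ) × (ℤ × ℤ))) (hT : T ⊆ S ×ˢ S) (hne : ∀ e ∈ T, e.2 - e.1 ≠ 0) :
    energy rectClass (edgeWt (levelWt lev lam)) T ≤
      2 * 10 ^ 11 * (i + 1 + m) * (∑ j ∈ range m, lam j ^ 2) ^ 2 := by
  classical
  obtain ⟨U, hU⟩ : ∃ U : ℤ × ℤ → Prop, ∀ w, U w := ⟨fun _ => True, fun _ => trivial⟩
  have h := energy_le_of_lonely_le S lev lam m hlam hm hcard U (fun _ _ => hU _) i
    (fun p _ v _ => (card_le_card (filter_subset _ _)).trans hS) _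
    (fun T hT hne _ hlon => energy_lonely_le S lev lam m hm hcard T hT hne hlon) T hT hne
    (fun _ _ => hU _)
  have h2 : 0 ≤ (∑ j ∈ range m, lam j ^ 2) ^ 2 := by positivity
  refine h.trans ?_
  rw [← mul_assoc, ← add_mul]
  refine mul_le_mul_of_nonneg_right ?_ h2
  have : (0 : ℝ) ≤ i := by positivity
  have : (0 : ℝ) ≤ m := by positivity
  linarith

lemma card_gcd_le (p v : ℤ × ℤ) (hv : v ≠ 0) (G : ℕ) (hG : 1 ≤ G) :
    #{q ∈ S | Int.gcd (q - p).1 (q - p).2 ≤ G ∧ dot v (q - p) = 0} ≤ 4 * G := by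
  obtain ⟨v1, v2⟩ := v
  have hg : 0 < Int.gcd v1 v2 := by
    rw [Int.gcd_pos_iff]
    by_contra! h
    exact hv (Prod.ext h.1 h.2)
  obtain ⟨x, y, hxy, h1, h2⟩ := Int.exists_gcd_one hg
  obtain ⟨a, b, hab⟩ := Int.isCoprime_iff_gcd_eq_one.2 hxy
  have hk : ∀ q ∈ ({q ∈ S | Int.gcd (q - p).1 (q - p).2 ≤ G ∧ dot (v1, v2) (q - p) = 0} : Finset _),
      x * (a * (q - p).2 - b * (q - p).1) = (q - p).2 ∧
      -y * (a * (q - p).2 - b * (q - p).1) = (q - p).1 := by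
    intro q hq
    obtain ⟨-, -, h⟩ := mem_filter.1 hq
    simp only [dot] at h
    have h3 : x * (q - p).1 + y * (q - p).2 = 0 := by
      have hg' : (Int.gcd v1 v2 : ℤ) ≠ 0 := by exact_mod_cast hg.ne'
      refine (mul_eq_zero.1 (?_ : (Int.gcd v1 v2 : ℤ) * _ = 0)).resolve_left hg'
      linear_combination h - (q - p).1 * h1 - (q - p).2 * h2
    exact ⟨by linear_combination (q - p).2 * hab - b * h3,
      by linear_combination (q - p).1 * hab - a * h3⟩
  have hc : #(Finset.Icc (-(G : ℤ)) G) ≤ 4 * G := by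
    rw [Int.card_Icc]; omega
  refine le_trans (card_le_card_of_injOn (fun q => a * (q - p).2 - b * (q - p).1) ?_ ?_) hc
  · intro q hq
    obtain ⟨k1, k2⟩ := hk q hq
    obtain ⟨-, k3, -⟩ := mem_filter.1 hq
    rw [mem_coe, Finset.mem_Icc, ← abs_le]
    by_cases h0 : Int.gcd (q - p).1 (q - p).2 = 0
    · rw [Int.gcd_eq_zero_iff] at h0
      beta_reduce
      rw [h0.1, h0.2]; simp
    · have := Int.dvd_coe_gcd (Dvd.intro_left _ k2) (Dvd.intro_left _ k1)
      have h5 := Int.le_of_dvd (by positivity) ((abs_dvd _ _).2 this)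
      exact h5.trans (by exact_mod_cast k3)
  · intro q hq q' hq' h
    obtain ⟨k1, k2⟩ := hk q hq
    obtain ⟨k1', k2'⟩ := hk q' hq'
    simp only at h
    rw [h] at k1 k2
    have e1 := k1.symm.trans k1'
    have e2 := k2.symm.trans k2'
    simp only [Prod.fst_sub, Prod.snd_sub] at e1 e2
    exact Prod.ext (by linarith) (by linarith)

lemma energy_le_gcd (hlam : ∀ j, 0 ≤ lam j) (hm : ∀ p ∈ S, lev p < m)
    (hcard : ∀ j, #(levelSet S lev j) ≤ 256 ^ j) (i : ℕ)
    (T : Finset ((ℤ × ℤ) × (ℤ × ℤ))) (hT : T ⊆ S ×ˢ S) (hne : ∀ e ∈ T, e.2 - e.1 ≠ 0)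
    (hgcd : ∀ e ∈ T, Int.gcd (e.2 - e.1).1 (e.2 - e.1).2 ≤ 4 ^ i) :
    energy rectClass (edgeWt (levelWt lev lam)) T ≤
      10 ^ 12 * 2 ^ i * (∑ j ∈ range m, lam j ^ 2) ^ 2 := by
  classical
  set U : ℤ × ℤ → Prop := fun w => Int.gcd w.1 w.2 ≤ 4 ^ i with hUdef
  have hU : ∀ w, U w → U (-w) := fun w h => by simpa [hUdef] using h
  have hcap : ∀ p ∈ S, ∀ v, v ≠ 0 → #{q ∈ S | U (q - p) ∧ dot v (q - p) = 0} ≤ 4 * 4 ^ i :=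
    fun p _ v hv => by
      convert card_gcd_le S p v hv (4 ^ i) (Nat.one_le_pow _ _ (by norm_num))
  have e1 : 4 * 4 ^ i = 2 ^ (2 * i + 2) := by rw [pow_add, pow_mul]; norm_num [mul_comm]
  have e2 : 4 * 4 ^ i = (2 * 2 ^ i) ^ 2 := by
    rw [mul_pow, ← pow_mul, mul_comm i, pow_mul]; norm_num
  have h := energy_le_of_lonely_le S lev lam m hlam hm hcard U hU (2 * i + 2)
    (fun p hp v hv => by rw [← e1]; convert hcap p hp v hv) _
    (fun T hT hne hTU hlon => energy_lonely_cap_le S lev lam m hlam hm hcard T hT hne hlon U hU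
      hTU (2 * 2 ^ i) (Nat.succ_le_of_lt (by positivity))
      fun p hp v hv => by rw [← e2]; convert hcap p hp v hv) T hT hne hgcd
  have h2 : 0 ≤ (∑ j ∈ range m, lam j ^ 2) ^ 2 := by positivity
  refine h.trans ?_
  rw [← mul_assoc, ← add_mul]
  refine mul_le_mul_of_nonneg_right ?_ h2
  have h3 : (i : ℝ) + 1 ≤ 2 ^ i := by exact_mod_cast Nat.lt_two_pow_self
  push_cast
  have : (0 : ℝ) ≤ i := by positivity
  linarith

end

section

variable (S : Finset (ℤ × ℤ))

/-- The number of points of `S` on which `f` is at least as large as at `p`. -/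
noncomputable def rank (f : ℤ × ℤ → ℝ) (p : ℤ × ℤ) : ℕ := #{q ∈ S | f p ≤ f q}

lemma card_rank_le (f : ℤ × ℤ → ℝ) (M : ℕ) : #{p ∈ S | rank S f p ≤ M} ≤ M := by
  rcases ({p ∈ S | rank S f p ≤ M} : Finset _).eq_empty_or_nonempty with h | h
  · rw [h]; simp
  · obtain ⟨p, hp, hmin⟩ := exists_min_image _ f h
    refine le_trans (card_le_card fun q hq => ?_) (mem_filter.1 hp).2
    exact mem_filter.2 ⟨(mem_filter.1 hq).1, hmin q hq⟩

lemma exists_levels (f : ℤ × ℤ → ℝ) (hf : ∀ p, 0 ≤ f p) (i : ℕ) (hS : #S ≤ 2 ^ i) :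
    ∃ (lev : ℤ × ℤ → ℕ) (lam : ℕ → ℝ), (∀ j, 0 ≤ lam j) ∧ (∀ p ∈ S, lev p < i + 1) ∧
      (∀ j, #(levelSet S lev j) ≤ 256 ^ j) ∧ (∀ p ∈ S, f p ≤ levelWt lev lam p) ∧
      ∑ j ∈ range (i + 1), lam j ^ 2 ≤ 1024 * ∑ p ∈ S, f p ^ 2 := by
  set lev : ℤ × ℤ → ℕ := fun p => Nat.clog 256 (rank S f p) with hlev
  have lev_le : ∀ p j, lev p ≤ j ↔ rank S f p ≤ 256 ^ j := fun p j =>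
    Nat.clog_le_iff_le_pow (by norm_num)
  have hm : ∀ p ∈ S, lev p < i + 1 := fun p _ => by
    rw [Nat.lt_succ_iff, lev_le]
    exact (card_le_card (filter_subset _ _)).trans
      (hS.trans (Nat.pow_le_pow_left (by norm_num) _))
  have hcard' : ∀ j, #{p ∈ S | lev p ≤ j} ≤ 256 ^ j := fun j => by
    simp only [lev_le]; exact card_rank_le S f _
  have hcard : ∀ j, #(levelSet S lev j) ≤ 256 ^ j := fun j =>
    (card_le_card (monotone_filter_right _ fun p _ h => le_of_eq h)).trans (hcard' j)
  have hex : ∀ j, ∃ l : ℝ, 0 ≤ l ∧ (∀ p ∈ S, lev p = j → f p ≤ l / 16 ^ j) ∧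
      l ^ 2 ≤ 512 * (∑ q ∈ S with lev q = j, f q ^ 2 + ∑ q ∈ S with lev q + 1 = j, f q ^ 2) := by
    intro j
    rcases (levelSet S lev j).eq_empty_or_nonempty with h | h
    · refine ⟨0, le_rfl, fun p hp hj => ?_, by rw [zero_pow two_ne_zero]; positivity⟩
      have : p ∈ levelSet S lev j := mem_filter.2 ⟨hp, hj⟩
      rw [h] at this
      simp at this
    · obtain ⟨p, hp, hmax⟩ := exists_max_image _ f h
      obtain ⟨hpS, hpj⟩ := mem_filter.1 hp
      refine ⟨16 ^ j * f p, mul_nonneg (by positivity) (hf p), fun q hq hj => ?_, ?_⟩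
      · rw [mul_div_cancel_left₀ _ (by positivity)]
        exact hmax q (mem_filter.2 ⟨hq, hj⟩)
      · set V := {q ∈ S | f p ≤ f q ∧ j ≤ lev q + 1} with hV
        have hVlev : ∀ q ∈ V, lev q = j ∨ lev q + 1 = j := by
          intro q hq
          obtain ⟨h1, h2, h3⟩ := mem_filter.1 hq
          have : lev q ≤ lev p := Nat.clog_mono_right _ (card_le_card fun x hx => by
            obtain ⟨h4, h5⟩ := mem_filter.1 hx
            exact mem_filter.2 ⟨h4, h2.trans h5⟩)
          omega
        have hVcard : 256 ^ j ≤ 512 * #V := by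
          rcases j with _ | j
          · have : 0 < #V := card_pos.2 ⟨p, mem_filter.2 ⟨hpS, le_rfl, by omega⟩⟩
            omega
          · have h1 : 256 ^ j < rank S f p := by
              rw [← not_le, ← lev_le]; omega
            have h2 : rank S f p ≤ #V + #{q ∈ S | lev q + 1 ≤ j} := by
              refine le_trans (card_le_card fun q hq => ?_) (card_union_le _ _)
              obtain ⟨h3, h4⟩ := mem_filter.1 hq
              by_cases h5 : j + 1 ≤ lev q + 1
              · exact mem_union_left _ (mem_filter.2 ⟨h3, h4, h5⟩)
              · exact mem_union_right _ (mem_filter.2 ⟨h3, by omega⟩)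
            have h3 : 2 * #{q ∈ S | lev q + 1 ≤ j} ≤ 256 ^ j := by
              rcases j with _ | j
              · simp
              · have : #{q ∈ S | lev q + 1 ≤ j + 1} ≤ 256 ^ j := by
                  simpa using hcard' j
                rw [pow_succ]; omega
            rw [pow_succ]; omega
        have hVr : (256 : ℝ) ^ j ≤ 512 * #V := by exact_mod_cast hVcard
        have e1 : (256 : ℝ) ^ j = (16 ^ j) ^ 2 := by rw [← pow_mul, mul_comm, pow_mul]; norm_num
        calc (16 ^ j * f p) ^ 2 = 256 ^ j * f p ^ 2 := by rw [mul_pow, e1]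
          _ ≤ 512 * #V * f p ^ 2 := by gcongr
          _ = 512 * ∑ q ∈ V, f p ^ 2 := by rw [sum_const, nsmul_eq_mul, mul_assoc]
          _ ≤ 512 * ∑ q ∈ V, f q ^ 2 := by
              gcongr with q hq
              · exact hf p
              · exact (mem_filter.1 hq).2.1
          _ ≤ _ := by
              gcongr
              rw [← sum_union]
              · refine sum_le_sum_of_subset_of_nonneg (fun q hq => ?_) (by intros; positivity)
                have hqS := (mem_filter.1 hq).1
                rcases hVlev q hq with h1 | h1
                · exact mem_union_left _ (mem_filter.2 ⟨hqS, h1⟩)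
                · exact mem_union_right _ (mem_filter.2 ⟨hqS, h1⟩)
              · rw [disjoint_left]
                intro q h1 h2
                have := (mem_filter.1 h1).2
                have := (mem_filter.1 h2).2
                omega
  choose lam h0 h1 h2 using hex
  refine ⟨lev, lam, h0, hm, hcard, fun p hp => h1 _ p hp rfl, ?_⟩
  have s1 : ∑ j ∈ range (i + 1), ∑ q ∈ S with lev q = j, f q ^ 2 = ∑ p ∈ S, f p ^ 2 :=
    sum_fiberwise_of_maps_to (fun p hp => mem_range.2 (hm p hp)) _
  have s2 : ∑ j ∈ range (i + 1), ∑ q ∈ S with lev q + 1 = j, f q ^ 2 ≤ ∑ p ∈ S, f p ^ 2 := by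
    refine sum_fiberwise_le_sum_of_sum_fiber_nonneg fun j _ => ?_
    positivity
  calc _ ≤ ∑ j ∈ range (i + 1), 512 * (∑ q ∈ S with lev q = j, f q ^ 2 +
        ∑ q ∈ S with lev q + 1 = j, f q ^ 2) := sum_le_sum fun j _ => h2 j
    _ = 512 * (∑ j ∈ range (i + 1), ∑ q ∈ S with lev q = j, f q ^ 2 +
        ∑ j ∈ range (i + 1), ∑ q ∈ S with lev q + 1 = j, f q ^ 2) := by
        rw [← mul_sum, sum_add_distrib]
    _ ≤ _ := by linarith

lemma energy_mono {ι κ : Type*} [DecidableEq κ] (cl : ι → κ) {F F' : ι → ℝ} (T : Finset ι)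
    (h0 : ∀ e ∈ T, 0 ≤ F e) (h : ∀ e ∈ T, F e ≤ F' e) : energy cl F T ≤ energy cl F' T := by
  refine sum_le_sum fun e he => sum_le_sum fun e' he' => ?_
  split_ifs
  · exact mul_le_mul (h e he) (h e' he') (h0 e' he') ((h0 e he).trans (h e he))
  · exact le_rfl

lemma energy_le_log_sum_sq (f : ℤ × ℤ → ℝ) (hf : ∀ p, 0 ≤ f p) (i : ℕ) (hS : #S ≤ 2 ^ i)
    (T : Finset ((ℤ × ℤ) × (ℤ × ℤ))) (hT : T ⊆ S ×ˢ S) (hne : ∀ e ∈ T, e.2 - e.1 ≠ 0) :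
    energy rectClass (edgeWt f) T ≤ 10 ^ 18 * (i + 1) * (∑ p ∈ S, f p ^ 2) ^ 2 := by
  obtain ⟨lev, lam, h0, hm, hcard, hle, hsum⟩ := exists_levels S f hf i hS
  have hTS : ∀ e ∈ T, e.1 ∈ S ∧ e.2 ∈ S := fun e he => mem_product.1 (hT he)
  calc _ ≤ energy rectClass (edgeWt (levelWt lev lam)) T :=
        energy_mono _ _ (fun e _ => mul_nonneg (hf _) (hf _)) fun e he =>
          mul_le_mul (hle _ (hTS e he).1) (hle _ (hTS e he).2) (hf _) (levelWt_nonneg _ h0 _)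
    _ ≤ 2 * 10 ^ 11 * (i + 1 + (i + 1 : ℕ)) * (∑ j ∈ range (i + 1), lam j ^ 2) ^ 2 :=
        energy_le_log S lev lam (i + 1) h0 hm hcard i hS T hT hne
    _ ≤ 2 * 10 ^ 11 * (i + 1 + (i + 1 : ℕ)) * (1024 * ∑ p ∈ S, f p ^ 2) ^ 2 := by gcongr
    _ = 4 * 10 ^ 11 * 1024 ^ 2 * (i + 1) * (∑ p ∈ S, f p ^ 2) ^ 2 := by push_cast; ring
    _ ≤ _ := by gcongr; norm_num

lemma energy_le_gcd_sum_sq (f : ℤ × ℤ → ℝ) (hf : ∀ p, 0 ≤ f p) (i : ℕ)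
    (T : Finset ((ℤ × ℤ) × (ℤ × ℤ))) (hT : T ⊆ S ×ˢ S) (hne : ∀ e ∈ T, e.2 - e.1 ≠ 0)
    (hgcd : ∀ e ∈ T, Int.gcd (e.2 - e.1).1 (e.2 - e.1).2 ≤ 4 ^ i) :
    energy rectClass (edgeWt f) T ≤ 2 * 10 ^ 18 * 2 ^ i * (∑ p ∈ S, f p ^ 2) ^ 2 := by
  obtain ⟨lev, lam, h0, hm, hcard, hle, hsum⟩ := exists_levels S f hf #S Nat.lt_two_pow_self.le
  have hTS : ∀ e ∈ T, e.1 ∈ S ∧ e.2 ∈ S := fun e he => mem_product.1 (hT he)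
  calc _ ≤ energy rectClass (edgeWt (levelWt lev lam)) T :=
        energy_mono _ _ (fun e _ => mul_nonneg (hf _) (hf _)) fun e he =>
          mul_le_mul (hle _ (hTS e he).1) (hle _ (hTS e he).2) (hf _) (levelWt_nonneg _ h0 _)
    _ ≤ 10 ^ 12 * 2 ^ i * (∑ j ∈ range (#S + 1), lam j ^ 2) ^ 2 :=
        energy_le_gcd S lev lam _ h0 hm hcard i T hT hne hgcd
    _ ≤ 10 ^ 12 * 2 ^ i * (1024 * ∑ p ∈ S, f p ^ 2) ^ 2 := by gcongr
    _ = 10 ^ 12 * 1024 ^ 2 * 2 ^ i * (∑ p ∈ S, f p ^ 2) ^ 2 := by ring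
    _ ≤ _ := by
        refine mul_le_mul_of_nonneg_right (mul_le_mul_of_nonneg_right ?_ ?_) ?_
        · norm_num
        · positivity
        · positivity

end

/-- Two rectangle classes with the same direction, with offsets at distance less than `K / 2`. -/
def Near (K : ℕ) (k k' : (ℤ × ℤ) × ℤ) : Prop := k.1 = k'.1 ∧ |2 * (k.2 - k'.2)| < K

instance (K : ℕ) (k k' : (ℤ × ℤ) × ℤ) : Decidable (Near K k k') :=
  inferInstanceAs (Decidable (_ ∧ _))

lemma Near.symm {K : ℕ} {k k' : (ℤ × ℤ) × ℤ} (h : Near K k k') : Near K k' k :=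
  ⟨h.1.symm, by have := h.2; rwa [abs_mul, abs_sub_comm, ← abs_mul] at this⟩

lemma sum_class_mul {ι κ : Type*} [DecidableEq κ] (cl : ι → κ) (F : ι → ℝ) (h : κ → ℝ)
    (T : Finset ι) (Ks : Finset κ) (hK : ∀ e ∈ T, cl e ∈ Ks) :
    ∑ e ∈ T, h (cl e) * F e = ∑ k ∈ Ks, h k * ∑ e ∈ T with cl e = k, F e := by
  rw [← sum_fiberwise_of_maps_to hK]
  refine sum_congr rfl fun k _ => ?_
  rw [mul_sum]
  exact sum_congr rfl fun e he => by rw [(mem_filter.1 he).2]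

/-- The gcd of the coordinates of the direction of a class. -/
def classGcd (k : (ℤ × ℤ) × ℤ) : ℕ := Int.gcd k.1.1 k.1.2

lemma classGcd_dvd (e : (ℤ × ℤ) × (ℤ × ℤ)) : (classGcd (rectClass e) : ℤ) ∣ (rectClass e).2 :=
  dvd_add (Dvd.dvd.mul_right (Int.gcd_dvd_left _ _) _) (Dvd.dvd.mul_right (Int.gcd_dvd_right _ _) _)

lemma classGcd_pos {e : (ℤ × ℤ) × (ℤ × ℤ)} (he : e.2 - e.1 ≠ 0) : 0 < classGcd (rectClass e) := by
  rw [classGcd, Int.gcd_pos_iff]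
  by_contra! h
  exact he (Prod.ext h.1 h.2)

lemma card_near_le (T : Finset ((ℤ × ℤ) × (ℤ × ℤ))) (hne : ∀ e ∈ T, e.2 - e.1 ≠ 0) (K : ℕ)
    (k : (ℤ × ℤ) × ℤ) (hk : k ∈ T.image rectClass) :
    (#{k' ∈ T.image rectClass | Near K k k'} : ℝ) ≤ 1 + K * (1 / classGcd k) := by
  obtain ⟨e, he, rfl⟩ := mem_image.1 hk
  have hg := classGcd_pos (hne e he)
  have hdvd := classGcd_dvd e
  set k := rectClass e
  set g := classGcd k with hgdef
  set M := K / (2 * g) with hM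
  have h1 : #{k' ∈ T.image rectClass | Near K k k'} ≤ #(Finset.Icc (-(M : ℤ)) M) := by
    refine card_le_card_of_injOn (fun k' => (k'.2 - k.2) / g) ?_ ?_
    · intro k' hk'
      obtain ⟨h2, h3⟩ := mem_filter.1 hk'
      obtain ⟨e', he', rfl⟩ := mem_image.1 h2
      have hd : (g : ℤ) ∣ (rectClass e').2 := by
        have := classGcd_dvd e'
        rwa [classGcd, ← h3.1] at this
      obtain ⟨x, hx⟩ := dvd_sub hd hdvd
      have hg0 : (g : ℤ) ≠ 0 := by exact_mod_cast hg.ne'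
      rw [mem_coe, Finset.mem_Icc, ← abs_le]
      beta_reduce
      rw [hx, Int.mul_ediv_cancel_left _ hg0]
      have h4 := h3.symm.2
      rw [hx] at h4
      have h5 : (2 * g : ℤ) * |x| < K := by
        rw [abs_mul, abs_mul, abs_two, Nat.abs_cast] at h4
        linarith
      have h6 : x.natAbs ≤ M := by
        rw [hM, Nat.le_div_iff_mul_le (by omega)]
        rw [Int.abs_eq_natAbs] at h5
        have : 2 * g * x.natAbs < K := by exact_mod_cast h5
        linarith
      rw [Int.abs_eq_natAbs]
      exact_mod_cast h6
    · intro k' hk' k'' hk'' h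
      obtain ⟨h2, h3⟩ := mem_filter.1 hk'
      obtain ⟨e', he', rfl⟩ := mem_image.1 h2
      obtain ⟨h2', h3'⟩ := mem_filter.1 hk''
      obtain ⟨e'', he'', rfl⟩ := mem_image.1 h2'
      have hd : (g : ℤ) ∣ (rectClass e').2 := by
        have := classGcd_dvd e'
        rwa [classGcd, ← h3.1] at this
      have hd' : (g : ℤ) ∣ (rectClass e'').2 := by
        have := classGcd_dvd e''
        rwa [classGcd, ← h3'.1] at this
      refine Prod.ext (h3.1.symm.trans h3'.1) ?_
      have h7 := (Int.ediv_left_inj (dvd_sub hd hdvd) (dvd_sub hd' hdvd)).1 h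
      linarith
  rw [Int.card_Icc] at h1
  have h2 : #{k' ∈ T.image rectClass | Near K k k'} ≤ 2 * M + 1 := by omega
  have h3 : (M : ℝ) ≤ K / (2 * g : ℕ) := Nat.cast_div_le
  have hg' : (0 : ℝ) < g := by exact_mod_cast hg
  calc (#{k' ∈ T.image rectClass | Near K k k'} : ℝ) ≤ 2 * M + 1 := by exact_mod_cast h2
    _ ≤ 2 * (K / (2 * g : ℕ)) + 1 := by gcongr
    _ = _ := by push_cast; field_simp; ring

lemma inv_le_sum_dyadic (g M : ℕ) (hg : 0 < g) (hM : g < M) :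
    (1 / g : ℝ) ≤ ∑ i ∈ range M, if g ≤ 4 ^ i then 4 * (1 / 4 : ℝ) ^ i else 0 := by
  set i := Nat.clog 4 g with hi
  have h1 : g ≤ 4 ^ i := Nat.le_pow_clog (by norm_num) _
  have h2 : i < M := by
    refine lt_of_le_of_lt ?_ hM
    rw [hi, Nat.clog_le_iff_le_pow (by norm_num)]
    exact (Nat.lt_pow_self (by norm_num)).le
  have h3 : 4 ^ i ≤ 4 * g := by
    rcases h : i with _ | j
    · omega
    · have : ¬ g ≤ 4 ^ j := by
        rw [← Nat.clog_le_iff_le_pow (by norm_num)]; omega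
      rw [pow_succ]; omega
  have hg' : (0 : ℝ) < g := by exact_mod_cast hg
  calc (1 / g : ℝ) ≤ 4 * (1 / 4 : ℝ) ^ i := by
        rw [div_le_iff₀ hg', one_div, inv_pow]
        have : (4 : ℝ) ^ i ≤ 4 * g := by exact_mod_cast h3
        calc (1 : ℝ) ≤ (4 * g) / 4 ^ i := by rwa [le_div_iff₀ (by positivity), one_mul]
          _ = _ := by ring
    _ = if g ≤ 4 ^ i then 4 * (1 / 4 : ℝ) ^ i else 0 := (if_pos h1).symm
    _ ≤ _ := single_le_sum (f := fun i => if g ≤ 4 ^ i then 4 * (1 / 4 : ℝ) ^ i else 0)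
        (fun j _ => by positivity) (mem_range.2 h2)

section

variable (S : Finset (ℤ × ℤ))

lemma sum_near_of_ne_le (f : ℤ × ℤ → ℝ) (hf : ∀ p, 0 ≤ f p) (i K : ℕ) (hS : #S ≤ 2 ^ i)
    (T : Finset ((ℤ × ℤ) × (ℤ × ℤ))) (hT : T ⊆ S ×ˢ S) (hne : ∀ e ∈ T, e.2 - e.1 ≠ 0) :
    ∑ e ∈ T, ∑ e' ∈ T, (if Near K (rectClass e) (rectClass e') then edgeWt f e * edgeWt f e' else 0)
      ≤ (10 ^ 18 * (i + 1) + 16 * 10 ^ 18 * K) * (∑ p ∈ S, f p ^ 2) ^ 2 := by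
  set Ks := T.image rectClass with hKs
  set F := edgeWt f
  set Lam := ∑ p ∈ S, f p ^ 2
  have hK : ∀ e ∈ T, rectClass e ∈ Ks := fun e he => mem_image_of_mem _ he
  set a : (ℤ × ℤ) × ℤ → ℝ := fun k => ∑ e ∈ T with rectClass e = k, F e with ha
  have e1 : ∑ e ∈ T, ∑ e' ∈ T, (if Near K (rectClass e) (rectClass e') then F e * F e' else 0) =
      ∑ k ∈ Ks, ∑ k' ∈ Ks, if Near K k k' then a k * a k' else 0 := by
    have i1 : ∀ e, ∑ e' ∈ T, (if Near K (rectClass e) (rectClass e') then F e * F e' else 0) =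
        (∑ k' ∈ Ks, (if Near K (rectClass e) k' then 1 else 0) * a k') * F e := by
      intro e
      rw [← sum_class_mul rectClass F (fun k' => if Near K (rectClass e) k' then 1 else 0) T Ks hK,
        sum_mul]
      refine sum_congr rfl fun e' _ => ?_
      split_ifs <;> ring
    simp only [i1]
    rw [sum_class_mul rectClass F
      (fun k => ∑ k' ∈ Ks, (if Near K k k' then 1 else 0) * a k') T Ks hK]
    refine sum_congr rfl fun k _ => ?_
    rw [sum_mul]
    refine sum_congr rfl fun k' _ => ?_
    split_ifs <;> simp [ha, mul_comm]
  have e2 : ∑ k ∈ Ks, ∑ k' ∈ Ks, (if Near K k k' then a k * a k' else 0) ≤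
      ∑ k ∈ Ks, a k ^ 2 * (1 + K * (1 / classGcd k)) := by
    have h1 : ∑ k ∈ Ks, ∑ k' ∈ Ks, (if Near K k k' then a k * a k' else 0) ≤
        ∑ k ∈ Ks, ∑ k' ∈ Ks, ((if Near K k k' then a k ^ 2 / 2 else 0) +
          if Near K k' k then a k' ^ 2 / 2 else 0) := by
      refine sum_le_sum fun k _ => sum_le_sum fun k' _ => ?_
      by_cases h : Near K k k'
      · rw [if_pos h, if_pos h, if_pos h.symm]
        nlinarith [sq_nonneg (a k - a k')]
      · rw [if_neg h, if_neg h, if_neg fun h' => h h'.symm, add_zero]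
    simp only [sum_add_distrib] at h1
    rw [sum_comm (f := fun k k' => if Near K k' k then a k' ^ 2 / 2 else 0)] at h1
    refine h1.trans ?_
    rw [← sum_add_distrib]
    refine sum_le_sum fun k hk => ?_
    rw [← sum_filter, sum_const, nsmul_eq_mul]
    have h2 := mul_le_mul_of_nonneg_left (card_near_le T hne K k hk) (sq_nonneg (a k))
    linarith
  have e3 : ∑ k ∈ Ks, a k ^ 2 ≤ 10 ^ 18 * (i + 1) * Lam ^ 2 := by
    rw [ha, ← energy_eq_sum_sq rectClass F T Ks hK]
    exact energy_le_log_sum_sq S f hf i hS T hT hne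
  have e4 : ∑ k ∈ Ks, a k ^ 2 * (1 / classGcd k) ≤ 16 * 10 ^ 18 * Lam ^ 2 := by
    set M := Ks.sup classGcd + 1
    have layer : ∀ j : ℕ, ∑ k ∈ Ks with classGcd k ≤ 4 ^ j, a k ^ 2 ≤
        2 * 10 ^ 18 * 2 ^ j * Lam ^ 2 := by
      intro j
      have hsub : ∀ e ∈ {e ∈ T | classGcd (rectClass e) ≤ 4 ^ j},
          rectClass e ∈ {k ∈ Ks | classGcd k ≤ 4 ^ j} := fun e he =>
        mem_filter.2 ⟨hK e (mem_filter.1 he).1, (mem_filter.1 he).2⟩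
      have h1 := energy_le_gcd_sum_sq S f hf j {e ∈ T | classGcd (rectClass e) ≤ 4 ^ j}
        ((filter_subset _ _).trans hT) (fun e he => hne e (mem_filter.1 he).1)
        (fun e he => (mem_filter.1 he).2)
      rw [energy_eq_sum_sq _ _ _ _ hsub] at h1
      refine le_trans (le_of_eq ?_) h1
      refine sum_congr rfl fun k hk => ?_
      have hfe : ({e ∈ T | rectClass e = k} : Finset _) =
          {e ∈ T | classGcd (rectClass e) ≤ 4 ^ j ∧ rectClass e = k} := by
        refine filter_congr fun e _ => ⟨?_, fun h => h.2⟩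
        rintro rfl
        exact ⟨(mem_filter.1 hk).2, rfl⟩
      simp only [ha]
      rw [filter_filter, hfe]
    calc ∑ k ∈ Ks, a k ^ 2 * (1 / classGcd k)
        ≤ ∑ k ∈ Ks, a k ^ 2 *
            ∑ j ∈ range M, if classGcd k ≤ 4 ^ j then 4 * (1 / 4 : ℝ) ^ j else 0 := by
          refine sum_le_sum fun k hk => ?_
          gcongr
          obtain ⟨e, he, rfl⟩ := mem_image.1 hk
          exact inv_le_sum_dyadic _ _ (classGcd_pos (hne e he))
            (Nat.lt_succ_of_le (le_sup (f := classGcd) hk))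
      _ = ∑ j ∈ range M, 4 * (1 / 4 : ℝ) ^ j * ∑ k ∈ Ks with classGcd k ≤ 4 ^ j, a k ^ 2 := by
          simp only [mul_sum, sum_filter]
          rw [sum_comm]
          refine sum_congr rfl fun j _ => sum_congr rfl fun k _ => ?_
          split_ifs <;> ring
      _ ≤ ∑ j ∈ range M, 4 * (1 / 4 : ℝ) ^ j * (2 * 10 ^ 18 * 2 ^ j * Lam ^ 2) := by
          gcongr with j _
          exact layer j
      _ = 8 * 10 ^ 18 * Lam ^ 2 * ∑ j ∈ range M, (1 / 2 : ℝ) ^ j := by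
          rw [mul_sum]
          refine sum_congr rfl fun j _ => ?_
          have : (1 / 4 : ℝ) ^ j * 2 ^ j = (1 / 2) ^ j := by rw [← mul_pow]; norm_num
          rw [← this]; ring
      _ ≤ 8 * 10 ^ 18 * Lam ^ 2 * 2 := by
          gcongr
          exact sum_geometric_two_le M
      _ = _ := by ring
  rw [e1]
  refine e2.trans ?_
  calc ∑ k ∈ Ks, a k ^ 2 * (1 + K * (1 / classGcd k))
      = ∑ k ∈ Ks, a k ^ 2 + K * ∑ k ∈ Ks, a k ^ 2 * (1 / classGcd k) := by
        rw [mul_sum, ← sum_add_distrib]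
        exact sum_congr rfl fun k _ => by ring
    _ ≤ 10 ^ 18 * (i + 1) * Lam ^ 2 + K * (16 * 10 ^ 18 * Lam ^ 2) := by gcongr
    _ = _ := by ring

lemma sum_near_le (f : ℤ × ℤ → ℝ) (hf : ∀ p, 0 ≤ f p) (i K : ℕ) (hS : #S ≤ 2 ^ i) :
    ∑ e ∈ S ×ˢ S, ∑ e' ∈ S ×ˢ S,
        (if Near K (rectClass e) (rectClass e') then edgeWt f e * edgeWt f e' else 0)
      ≤ (1 + 10 ^ 18 * (i + 1) + 16 * 10 ^ 18 * K) * (∑ p ∈ S, f p ^ 2) ^ 2 := by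
  set T := S ×ˢ S with hT
  have hF : ∀ e, 0 ≤ edgeWt f e := fun e => mul_nonneg (hf _) (hf _)
  have split : ∀ e ∈ T, ∑ e' ∈ T,
      (if Near K (rectClass e) (rectClass e') then edgeWt f e * edgeWt f e' else 0) =
      (if e.2 = e.1 then ∑ e' ∈ T with e'.2 = e'.1,
        (if Near K (rectClass e) (rectClass e') then edgeWt f e * edgeWt f e' else 0) else 0) +
      (if ¬ e.2 = e.1 then ∑ e' ∈ T with ¬ e'.2 = e'.1,
        (if Near K (rectClass e) (rectClass e') then edgeWt f e * edgeWt f e' else 0) else 0) := by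
    intro e _
    have hd : ∀ e', Near K (rectClass e) (rectClass e') → (e.2 = e.1 ↔ e'.2 = e'.1) := by
      intro e' h
      have : e.2 - e.1 = e'.2 - e'.1 := h.1
      rw [← sub_eq_zero, this, sub_eq_zero]
    by_cases h : e.2 = e.1
    · rw [if_pos h, if_neg (not_not.2 h), add_zero, sum_filter]
      refine sum_congr rfl fun e' _ => ?_
      by_cases hn : Near K (rectClass e) (rectClass e')
      · rw [if_pos ((hd e' hn).1 h)]
      · simp [hn]
    · rw [if_neg h, if_pos h, zero_add, sum_filter]
      refine sum_congr rfl fun e' _ => ?_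
      by_cases hn : Near K (rectClass e) (rectClass e')
      · rw [if_pos fun h' => h ((hd e' hn).2 h')]
      · simp [hn]
  rw [sum_congr rfl split, sum_add_distrib, ← sum_filter, ← sum_filter]
  have diag : ∑ e ∈ T with e.2 = e.1, edgeWt f e = ∑ p ∈ S, f p ^ 2 := by
    rw [sum_filter, hT, sum_product]
    refine sum_congr rfl fun p hp => ?_
    rw [sum_eq_single p]
    · simp [edgeWt, sq]
    · intro q _ hq; exact if_neg hq
    · intro h; exact absurd hp h
  have h1 : ∑ e ∈ T with e.2 = e.1, ∑ e' ∈ T with e'.2 = e'.1,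
      (if Near K (rectClass e) (rectClass e') then edgeWt f e * edgeWt f e' else 0) ≤
      (∑ p ∈ S, f p ^ 2) ^ 2 := by
    rw [sq, ← diag, sum_mul_sum]
    refine sum_le_sum fun e _ => sum_le_sum fun e' _ => ?_
    split_ifs
    · exact le_rfl
    · exact mul_nonneg (hF _) (hF _)
  have h2 := sum_near_of_ne_le S f hf i K hS {e ∈ T | ¬ e.2 = e.1} (filter_subset _ _)
    fun e he => sub_ne_zero.2 (mem_filter.1 he).2
  linarith

end

/-- The character of frequency `(w₁, w₂, m)` on the space-time torus. -/
noncomputable def torusChar (φ : ℤ × ℤ × ℤ) (t : ℝ) (x : ℝ × ℝ) : ℂ :=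
  Complex.exp (Complex.I * (φ.1 * x.1 + φ.2.1 * x.2 + φ.2.2 * t))

lemma integral_exp_int_mul (n : ℤ) :
    ∫ θ in (0 : ℝ)..2 * π, Complex.exp (Complex.I * (n * (θ : ℂ))) =
      if n = 0 then (2 * π : ℂ) else 0 := by
  split_ifs with h
  · subst h; simp
  · have hn : Complex.I * (n : ℂ) ≠ 0 :=
      mul_ne_zero Complex.I_ne_zero (Int.cast_ne_zero.2 h)
    simp_rw [← mul_assoc]
    rw [integral_exp_mul_complex hn]
    have : Complex.I * n * ((2 * π : ℝ) : ℂ) = n * (2 * π * Complex.I) := by push_cast; ring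
    rw [this, Complex.exp_int_mul_two_pi_mul_I]
    simp

lemma torusChar_eq_mul (φ : ℤ × ℤ × ℤ) (t : ℝ) (x : ℝ × ℝ) :
    torusChar φ t x = Complex.exp (Complex.I * (φ.2.2 * t)) *
      (Complex.exp (Complex.I * (φ.1 * x.1)) * Complex.exp (Complex.I * (φ.2.1 * x.2))) := by
  rw [torusChar, ← Complex.exp_add, ← Complex.exp_add]
  congr 1; ring

lemma torusChar_mul_conj (φ ψ : ℤ × ℤ × ℤ) (t : ℝ) (x : ℝ × ℝ) :
    torusChar φ t x * (starRingEnd ℂ) (torusChar ψ t x) = torusChar (φ - ψ) t x := by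
  simp only [torusChar, ← Complex.exp_conj, ← Complex.exp_add]
  congr 1
  simp
  ring

lemma continuous_torusChar (φ : ℤ × ℤ × ℤ) :
    Continuous fun p : ℝ × (ℝ × ℝ) => torusChar φ p.1 p.2 := by
  unfold torusChar; fun_prop

lemma setIntegral_torusChar (φ : ℤ × ℤ × ℤ) (t : ℝ) :
    ∫ x in Set.Icc ((0 : ℝ), (0 : ℝ)) (2 * π, 2 * π), torusChar φ t x =
      Complex.exp (Complex.I * (φ.2.2 * t)) *
        ((if φ.1 = 0 then (2 * π : ℂ) else 0) * if φ.2.1 = 0 then (2 * π : ℂ) else 0) := by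
  simp only [torusChar_eq_mul]
  have h : ∀ n : ℤ, ∫ θ in Set.Icc (0 : ℝ) (2 * π), Complex.exp (Complex.I * (n * (θ : ℂ))) =
      if n = 0 then (2 * π : ℂ) else 0 := fun n => by
    rw [integral_Icc_eq_integral_Ioc, ← intervalIntegral.integral_of_le Real.two_pi_pos.le,
      integral_exp_int_mul]
  rw [integral_const_mul, ← Set.Icc_prod_Icc, Measure.volume_eq_prod,
    setIntegral_prod_mul (fun θ : ℝ => Complex.exp (Complex.I * (φ.1 * θ)))
      (fun θ : ℝ => Complex.exp (Complex.I * (φ.2.1 * θ))), h, h]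

lemma integral_torusChar (φ : ℤ × ℤ × ℤ) :
    ∫ t in (0 : ℝ)..2 * π, ∫ x in Set.Icc ((0 : ℝ), (0 : ℝ)) (2 * π, 2 * π), torusChar φ t x =
      if φ = 0 then (2 * π : ℂ) ^ 3 else 0 := by
  simp only [setIntegral_torusChar]
  rw [intervalIntegral.integral_mul_const, integral_exp_int_mul]
  simp only [Prod.ext_iff, Prod.fst_zero, Prod.snd_zero]
  split_ifs <;> first | (exfalso; tauto) | ring

lemma integral_norm_sum_torusChar_sq {ι : Type*} (I : Finset ι) (c : ι → ℂ) (φ : ι → ℤ × ℤ × ℤ) :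
    ((∫ t in (0 : ℝ)..2 * π, ∫ x in Set.Icc ((0 : ℝ), (0 : ℝ)) (2 * π, 2 * π),
        ‖∑ i ∈ I, c i * torusChar (φ i) t x‖ ^ 2 : ℝ) : ℂ) =
      ∑ i ∈ I, ∑ j ∈ I, if φ i = φ j then c i * (starRingEnd ℂ) (c j) * (2 * π : ℂ) ^ 3 else 0 := by
  have hsq : ∀ t x, ((‖∑ i ∈ I, c i * torusChar (φ i) t x‖ ^ 2 : ℝ) : ℂ) =
      ∑ i ∈ I, ∑ j ∈ I, c i * (starRingEnd ℂ) (c j) * torusChar (φ i - φ j) t x := by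
    intro t x
    push_cast
    rw [← Complex.mul_conj', map_sum, sum_mul_sum]
    refine sum_congr rfl fun i _ => sum_congr rfl fun j _ => ?_
    rw [← torusChar_mul_conj, map_mul]; ring
  have hint : ∀ (d : ℂ) (ψ : ℤ × ℤ × ℤ) (t : ℝ), IntegrableOn (fun x => d * torusChar ψ t x)
      (Set.Icc ((0 : ℝ), (0 : ℝ)) (2 * π, 2 * π)) := fun d ψ t =>
    (continuous_const.mul
      ((continuous_torusChar ψ).comp (Continuous.prodMk_right t))).integrableOn_Icc
  have hint2 : ∀ (d : ℂ) (ψ : ℤ × ℤ × ℤ), IntervalIntegrable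
      (fun t => ∫ x in Set.Icc ((0 : ℝ), (0 : ℝ)) (2 * π, 2 * π), d * torusChar ψ t x)
      volume 0 (2 * π) := fun d ψ => by
    simp only [integral_const_mul, setIntegral_torusChar]
    exact Continuous.intervalIntegrable (by fun_prop) _ _
  rw [← intervalIntegral.integral_ofReal]
  simp only [← integral_complex_ofReal, hsq]
  have inner : ∀ t : ℝ, ∫ x in Set.Icc ((0 : ℝ), (0 : ℝ)) (2 * π, 2 * π),
      ∑ i ∈ I, ∑ j ∈ I, c i * (starRingEnd ℂ) (c j) * torusChar (φ i - φ j) t x =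
      ∑ i ∈ I, ∑ j ∈ I, ∫ x in Set.Icc ((0 : ℝ), (0 : ℝ)) (2 * π, 2 * π),
        c i * (starRingEnd ℂ) (c j) * torusChar (φ i - φ j) t x := fun t => by
    rw [integral_finsetSum _ fun i _ => integrable_finsetSum _ fun j _ => hint _ _ t]
    exact sum_congr rfl fun i _ => integral_finsetSum _ fun j _ => hint _ _ t
  simp only [inner]
  rw [intervalIntegral.integral_finsetSum fun i _ => ?_]
  · refine sum_congr rfl fun i _ => ?_
    rw [intervalIntegral.integral_finsetSum fun j _ => hint2 _ _]
    refine sum_congr rfl fun j _ => ?_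
    simp only [integral_const_mul, intervalIntegral.integral_const_mul, integral_torusChar,
      sub_eq_zero, mul_ite, mul_zero]
  · have := IntervalIntegrable.sum (μ := volume) (a := 0) (b := 2 * π) I
      (f := fun j t => ∫ x in Set.Icc ((0 : ℝ), (0 : ℝ)) (2 * π, 2 * π),
        c i * (starRingEnd ℂ) (c j) * torusChar (φ i - φ j) t x) fun j _ => hint2 _ _
    simpa [Finset.sum_fn] using this

lemma integral_norm_sum_torusChar_sq_le {ι : Type*} (I : Finset ι) (c : ι → ℂ)
    (φ : ι → ℤ × ℤ × ℤ) :
    ∫ t in (0 : ℝ)..2 * π, ∫ x in Set.Icc ((0 : ℝ), (0 : ℝ)) (2 * π, 2 * π),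
        ‖∑ i ∈ I, c i * torusChar (φ i) t x‖ ^ 2 ≤
      (2 * π) ^ 3 * ∑ i ∈ I, ∑ j ∈ I, if φ i = φ j then ‖c i‖ * ‖c j‖ else 0 := by
  refine (le_abs_self _).trans ?_
  rw [← Real.norm_eq_abs, ← Complex.norm_real, integral_norm_sum_torusChar_sq, mul_sum]
  refine (norm_sum_le _ _).trans (sum_le_sum fun i _ => ?_)
  rw [mul_sum]
  refine (norm_sum_le _ _).trans (sum_le_sum fun j _ => ?_)
  split_ifs
  · simp [abs_of_pos Real.pi_pos]; linarith
  · simp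

/-- The frequency of `|u|²` carried by an edge, shifted by `k` in time. -/
def edgeFreq (i : ((ℤ × ℤ) × (ℤ × ℤ)) × ℕ) : ℤ × ℤ × ℤ :=
  ((i.1.2 - i.1.1).1, (i.1.2 - i.1.1).2, i.2 - (dot i.1.2 i.1.2 - dot i.1.1 i.1.1))

lemma edgeFreq_eq_iff (e e' : (ℤ × ℤ) × (ℤ × ℤ)) (k k' : ℕ) :
    edgeFreq (e, k) = edgeFreq (e', k') ↔ (rectClass e).1 = (rectClass e').1 ∧
      2 * ((rectClass e).2 - (rectClass e').2) = (k : ℤ) - k' := by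
  obtain ⟨⟨a, b⟩, c, d⟩ := e
  obtain ⟨⟨a', b'⟩, c', d'⟩ := e'
  simp only [edgeFreq, rectClass, dot, Prod.mk.injEq, Prod.mk_sub_mk]
  constructor
  · rintro ⟨h1, h2, h3⟩
    obtain rfl : c = c' - a' + a := by linarith
    obtain rfl : d = d' - b' + b := by linarith
    exact ⟨⟨h1, h2⟩, by linarith⟩
  · rintro ⟨⟨h1, h2⟩, h3⟩
    obtain rfl : c = c' - a' + a := by linarith
    obtain rfl : d = d' - b' + b := by linarith
    exact ⟨h1, h2, by linarith⟩

lemma card_edgeFreq_eq_le (K : ℕ) (e e' : (ℤ × ℤ) × (ℤ × ℤ)) (w : ℝ) (hw : 0 ≤ w) :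
    ∑ k ∈ range K, ∑ k' ∈ range K, (if edgeFreq (e, k) = edgeFreq (e', k') then w else 0) ≤
      K * if Near K (rectClass e) (rectClass e') then w else 0 := by
  have h : ∀ k ∈ range K,
      ∑ k' ∈ range K, (if edgeFreq (e, k) = edgeFreq (e', k') then w else 0) ≤
        if Near K (rectClass e) (rectClass e') then w else 0 := by
    intro k hk
    rw [mem_range] at hk
    by_cases hex : ∃ k' ∈ range K, edgeFreq (e, k) = edgeFreq (e', k')
    · obtain ⟨l, hl, hkl⟩ := hex
      rw [mem_range] at hl
      have h1 := (edgeFreq_eq_iff e e' k l).1 hkl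
      rw [if_pos ⟨h1.1, by rw [h1.2, abs_lt]; omega⟩]
      rw [sum_eq_single l (fun k' _ hne => if_neg fun h2 => hne ?_)
        fun h2 => absurd (mem_range.2 hl) h2]
      · rw [if_pos hkl]
      · have := (edgeFreq_eq_iff e e' k k').1 h2
        omega
    · push Not at hex
      rw [sum_eq_zero fun k' hk' => if_neg (hex k' hk')]
      split_ifs
      exacts [hw, le_rfl]
  refine (sum_le_sum h).trans ?_
  rw [sum_const, card_range, nsmul_eq_mul]

lemma half_le_norm_sum_exp (K : ℕ) (t : ℝ) (ht : 0 ≤ t) (hKt : K * t ≤ 1) :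
    (K : ℝ) / 2 ≤ ‖∑ k ∈ range K, Complex.exp (Complex.I * (k * t))‖ := by
  refine le_trans ?_ (Complex.re_le_norm _)
  rw [Complex.re_sum]
  have : ∀ k ∈ range K, (1 / 2 : ℝ) ≤ (Complex.exp (Complex.I * (k * t))).re := by
    intro k hk
    have hk' : (k : ℝ) ≤ K := by exact_mod_cast (mem_range.1 hk).le
    have h0 : 0 ≤ k * t := by positivity
    have h1 : k * t ≤ 1 := le_trans (by gcongr) hKt
    have h2 : Complex.I * (k * t) = ((k * t : ℝ) : ℂ) * Complex.I := by push_cast; ring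
    rw [h2, Complex.exp_ofReal_mul_I_re]
    have := Real.one_sub_sq_div_two_le_cos (x := k * t)
    nlinarith
  calc (K : ℝ) / 2 = ∑ _k ∈ range K, (1 / 2 : ℝ) := by
        rw [sum_const, card_range, nsmul_eq_mul]; ring
    _ ≤ _ := sum_le_sum this

/-- The free Schrödinger evolution of a trigonometric polynomial. -/
noncomputable def freeEvolution (S : Finset (ℤ × ℤ)) (a : ℤ × ℤ → ℂ) (t : ℝ) (x : ℝ × ℝ) : ℂ :=
  ∑ ξ ∈ S, a ξ * Complex.exp (Complex.I * ((ξ.1 : ℂ) * (x.1 : ℂ) + (ξ.2 : ℂ) * (x.2 : ℂ)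
    - (t : ℂ) * ((ξ.1 : ℂ) ^ 2 + (ξ.2 : ℂ) ^ 2)))

lemma continuous_freeEvolution (S : Finset (ℤ × ℤ)) (a : ℤ × ℤ → ℂ) :
    Continuous fun p : ℝ × (ℝ × ℝ) => freeEvolution S a p.1 p.2 := by
  unfold freeEvolution; fun_prop

lemma sum_exp_mul_freeEvolution (S : Finset (ℤ × ℤ)) (a : ℤ × ℤ → ℂ) (K : ℕ) (t : ℝ)
    (x : ℝ × ℝ) :
    (∑ k ∈ range K, Complex.exp (Complex.I * (k * t))) *
        ((starRingEnd ℂ) (freeEvolution S a t x) * freeEvolution S a t x) =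
      ∑ i ∈ (S ×ˢ S) ×ˢ range K,
        (starRingEnd ℂ) (a i.1.1) * a i.1.2 * torusChar (edgeFreq i) t x := by
  rw [sum_product, sum_product]
  simp only [freeEvolution, map_sum]
  rw [mul_comm, sum_mul_sum, sum_mul]
  refine sum_congr rfl fun η _ => ?_
  rw [sum_mul]
  refine sum_congr rfl fun ξ _ => ?_
  rw [mul_sum]
  refine sum_congr rfl fun k _ => ?_
  rw [map_mul, ← Complex.exp_conj, torusChar]
  have : ∀ p q r s w : ℂ, p * Complex.exp q * (r * Complex.exp s) * Complex.exp w =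
      p * r * Complex.exp (q + s + w) := fun p q r s w => by
    rw [Complex.exp_add, Complex.exp_add]; ring
  rw [this]
  congr 2
  simp [edgeFreq, dot]
  ring

lemma integral_norm_sum_exp_mul_freeEvolution_le (S : Finset (ℤ × ℤ)) (a : ℤ × ℤ → ℂ) (i K : ℕ)
    (hS : #S ≤ 2 ^ i) :
    ∫ t in (0 : ℝ)..2 * π, ∫ x in Set.Icc ((0 : ℝ), (0 : ℝ)) (2 * π, 2 * π),
        ‖∑ k ∈ range K, Complex.exp (Complex.I * (k * t))‖ ^ 2 * ‖freeEvolution S a t x‖ ^ 4 ≤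
      (2 * π) ^ 3 * (K * ((1 + 10 ^ 18 * (i + 1) + 16 * 10 ^ 18 * K) *
        (∑ ξ ∈ S, ‖a ξ‖ ^ 2) ^ 2)) := by
  have h1 := integral_norm_sum_torusChar_sq_le ((S ×ˢ S) ×ˢ range K)
    (fun i => (starRingEnd ℂ) (a i.1.1) * a i.1.2) edgeFreq
  simp only [← sum_exp_mul_freeEvolution, norm_mul, RCLike.norm_conj, mul_pow] at h1
  have h2 : ∀ z : ℂ, ‖z‖ ^ 2 * ‖z‖ ^ 2 = ‖z‖ ^ 4 := fun z => by ring
  simp only [h2] at h1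
  rw [← mul_pow 2 π 3] at h1
  refine h1.trans (mul_le_mul_of_nonneg_left ?_ (pow_nonneg Real.two_pi_pos.le 3))
  refine le_trans ?_ (mul_le_mul_of_nonneg_left
    (sum_near_le S (fun ξ => ‖a ξ‖) (fun _ => norm_nonneg _) i K hS) (Nat.cast_nonneg K))
  rw [sum_product, mul_sum]
  refine sum_le_sum fun e _ => ?_
  simp only [sum_product (s := S ×ˢ S) (t := range K)]
  rw [sum_comm, mul_sum]
  refine sum_le_sum fun e' _ => ?_
  exact card_edgeFreq_eq_le K e e' _ (by positivity)

lemma setIntegral_freeEvolution_pow_continuous (S : Finset (ℤ × ℤ)) (a : ℤ × ℤ → ℂ) :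
    Continuous fun t => ∫ x in Set.Icc ((0 : ℝ), (0 : ℝ)) (2 * π, 2 * π),
      ‖freeEvolution S a t x‖ ^ 4 :=
  continuous_parametric_integral_of_continuous
    ((continuous_freeEvolution S a).norm.pow 4) isCompact_Icc

lemma integral_freeEvolution_pow_le (S : Finset (ℤ × ℤ)) (a : ℤ × ℤ → ℂ) (i K : ℕ)
    (hS : #S ≤ 2 ^ i) (hK : 0 < K) (T : ℝ) (hT : 0 ≤ T) (hKT : K * T ≤ 1) :
    ∫ t in (0 : ℝ)..T, ∫ x in Set.Icc ((0 : ℝ), (0 : ℝ)) (2 * π, 2 * π),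
        ‖freeEvolution S a t x‖ ^ 4 ≤
      4 / K ^ 2 * ((2 * π) ^ 3 * (K * ((1 + 10 ^ 18 * (i + 1) + 16 * 10 ^ 18 * K) *
        (∑ ξ ∈ S, ‖a ξ‖ ^ 2) ^ 2))) := by
  have hK' : (1 : ℝ) ≤ K := by exact_mod_cast hK
  set G : ℝ → ℝ := fun t => ∫ x in Set.Icc ((0 : ℝ), (0 : ℝ)) (2 * π, 2 * π),
    ‖freeEvolution S a t x‖ ^ 4
  have hG : Continuous G := setIntegral_freeEvolution_pow_continuous S a
  have hG0 : ∀ t, 0 ≤ G t := fun t => integral_nonneg fun x => by positivity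
  set D : ℝ → ℝ := fun t => ‖∑ k ∈ range K, Complex.exp (Complex.I * (k * t))‖ ^ 2
  have hD : Continuous D := by fun_prop
  have h1 := integral_norm_sum_exp_mul_freeEvolution_le S a i K hS
  simp only [integral_const_mul] at h1
  change ∫ t in (0 : ℝ)..2 * π, D t * G t ≤ _ at h1
  calc ∫ t in (0 : ℝ)..T, G t
      ≤ ∫ t in (0 : ℝ)..T, 4 / (K : ℝ) ^ 2 * (D t * G t) := by
        refine intervalIntegral.integral_mono_on hT (hG.intervalIntegrable _ _)
          ((continuous_const.mul (hD.mul hG)).intervalIntegrable _ _) fun t ht => ?_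
        have h2 := half_le_norm_sum_exp K t ht.1
          ((mul_le_mul_of_nonneg_left ht.2 (by positivity)).trans hKT)
        have h3 : ((K : ℝ) / 2) ^ 2 ≤ D t := pow_le_pow_left₀ (by positivity) h2 2
        have h4 : 1 ≤ 4 / (K : ℝ) ^ 2 * D t := by
          calc (1 : ℝ) = 4 / (K : ℝ) ^ 2 * (K / 2) ^ 2 := by field_simp; norm_num
            _ ≤ _ := by gcongr
        calc G t = 1 * G t := (one_mul _).symm
          _ ≤ 4 / (K : ℝ) ^ 2 * D t * G t := mul_le_mul_of_nonneg_right h4 (hG0 t)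
          _ = _ := by ring
    _ = 4 / (K : ℝ) ^ 2 * ∫ t in (0 : ℝ)..T, D t * G t := intervalIntegral.integral_const_mul _ _
    _ ≤ 4 / (K : ℝ) ^ 2 * ∫ t in (0 : ℝ)..2 * π, D t * G t := by
        gcongr
        refine intervalIntegral.integral_mono_interval le_rfl hT ?_ ?_
          ((hD.mul hG).intervalIntegrable _ _)
        · nlinarith [Real.pi_gt_three]
        · exact Filter.Eventually.of_forall fun t => mul_nonneg (sq_nonneg _) (hG0 t)
    _ ≤ _ := by gcongr

lemma exists_log_parameters (N : ℕ) (hN : 0 < N) :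
    ∃ i K : ℕ, N ≤ 2 ^ i ∧ 0 < K ∧ (K : ℝ) ≤ max 1 (Real.log N) ∧ (i : ℝ) + 1 ≤ 6 * K := by
  refine ⟨Nat.log 2 N + 1, ⌊max 1 (Real.log N)⌋₊, (Nat.lt_pow_succ_log_self one_lt_two N).le,
    Nat.floor_pos.2 (le_max_left _ _), Nat.floor_le (by positivity), ?_⟩
  set K := ⌊max 1 (Real.log N)⌋₊
  have hK : (1 : ℝ) ≤ K := by exact_mod_cast Nat.floor_pos.2 (le_max_left _ _)
  have h1 : Real.log N < K + 1 := (le_max_right _ _).trans_lt (Nat.lt_floor_add_one _)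
  have h2 : ((2 : ℝ) ^ Nat.log 2 N) ≤ N := by exact_mod_cast Nat.pow_log_le_self 2 hN.ne'
  have h3 := Real.log_le_log (by positivity) h2
  rw [Real.log_pow] at h3
  have h4 := Real.log_two_gt_d9
  have h5 : (0 : ℝ) ≤ Nat.log 2 N := Nat.cast_nonneg _
  push_cast
  nlinarith

end LocalStrichartz

/-- **L⁴ Strichartz estimate on the logarithmic time scale (Theorem 1.2).**
There exists `c > 0` such that for every finite nonempty set `S ⊂ ℤ²` and every
`a : ℤ² → ℂ` supported on `S`, the free Schrödinger evolution
`u(t,x) = ∑_{ξ ∈ S} a ξ · exp(i(ξ·x − t|ξ|²))` satisfies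
`‖u‖_{L⁴([0,1/Log #S]×𝕋²)} ≤ c ‖a‖_{ℓ²}`, where `Log x = max 1 (ln x)`. -/
theorem local_L4_strichartz_T2 :
    ∃ c : ℝ, 0 < c ∧
      ∀ (S : Finset (ℤ × ℤ)) (a : ℤ × ℤ → ℂ), S.Nonempty → (∀ ξ ∉ S, a ξ = 0) →
        (∫ t in (0:ℝ)..(1 / max 1 (Real.log (S.card : ℝ))),
            ∫ x in Set.Icc ((0:ℝ), (0:ℝ)) ((2 * π), (2 * π)),
              ‖∑ ξ ∈ S, a ξ * Complex.exp (Complex.I *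
                  ((ξ.1 : ℂ) * (x.1 : ℂ) + (ξ.2 : ℂ) * (x.2 : ℂ)
                    - (t : ℂ) * ((ξ.1 : ℂ) ^ 2 + (ξ.2 : ℂ) ^ 2)))‖ ^ 4) ^ ((1:ℝ)/4)
          ≤ c * (∑ ξ ∈ S, ‖a ξ‖ ^ 2) ^ ((1:ℝ)/2) := by
  refine ⟨(4 * (2 * π) ^ 3 * (23 * 10 ^ 18)) ^ ((1 : ℝ) / 4), by positivity, ?_⟩
  intro S a hS _
  obtain ⟨i, K, hi, hK, hKl, hiK⟩ := LocalStrichartz.exists_log_parameters S.card hS.card_pos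
  have hK' : (1 : ℝ) ≤ K := by exact_mod_cast hK
  have hm : 0 < max 1 (Real.log (S.card : ℝ)) := by positivity
  have h1 := LocalStrichartz.integral_freeEvolution_pow_le S a i K hi hK
    (1 / max 1 (Real.log (S.card : ℝ)))
    (by positivity) (by rw [mul_one_div]; exact (div_le_one hm).2 hKl)
  set Lam := ∑ ξ ∈ S, ‖a ξ‖ ^ 2
  have hL : 0 ≤ Lam := Finset.sum_nonneg fun _ _ => by positivity
  have h2 : 4 / (K : ℝ) ^ 2 * ((2 * π) ^ 3 * (K * ((1 + 10 ^ 18 * (i + 1) + 16 * 10 ^ 18 * K) *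
      Lam ^ 2))) ≤ 4 * (2 * π) ^ 3 * (23 * 10 ^ 18) * Lam ^ 2 := by
    calc _ ≤ 4 / (K : ℝ) ^ 2 * ((2 * π) ^ 3 * (K * ((23 * 10 ^ 18 * K) * Lam ^ 2))) := by
          gcongr
          linarith
      _ = _ := by field_simp
  have h3 : (Lam ^ 2) ^ ((1 : ℝ) / 4) = Lam ^ ((1 : ℝ) / 2) := by
    rw [← Real.rpow_natCast, ← Real.rpow_mul hL]; norm_num
  rw [← h3, ← Real.mul_rpow (by positivity) (by positivity)]
  refine Real.rpow_le_rpow ?_ (h1.trans h2) (by norm_num)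
  exact intervalIntegral.integral_nonneg (by positivity) fun t _ =>
    integral_nonneg fun x => by positivity
end

section
/- There exists a constant c > 0 such that for every integer N ≥ 2, the function u(t,x) = Σ_{ξ∈[-N,N]²∩ℤ²} e^{i(ξ·x − t|ξ|²)} satisfies (∫_0^{2π} ∫_{𝕋²} |u(t,x)|⁴ dx dt)^{1/4} ≥ c (ln N)^{1/4} · (2N+1), i.e. the L⁴([0,2π]×𝕋²) norm of the free evolution of the data with Fourier coefficients χ_{[-N,N]²∩ℤ²} is at least c (ln N)^{1/4} times the ℓ² norm of the coefficients. -/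
open MeasureTheory
open scoped BigOperators Real

theorem sum_Icc_inv_sq_le_two (M : ℕ) : ∑ m ∈ Finset.Icc 1 M, ((m : ℝ) ^ 2)⁻¹ ≤ 2 := by
  rcases Nat.eq_zero_or_pos M with rfl | hM
  · simp
  · have h := sum_Ioc_inv_sq_le_sub (α := ℝ) one_ne_zero hM
    have hpos : (0 : ℝ) ≤ (M : ℝ)⁻¹ := by positivity
    rw [← Finset.add_sum_Ioc_eq_sum_Icc hM]
    push_cast at h ⊢
    linarith

/-- Elementary form of the average order of `φ`, from `∑_{d ∣ n} φ(d) = n`. -/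
theorem log_le_two_mul_sum_totient_div_sq (M : ℕ) :
    Real.log (M + 1) ≤ 2 * ∑ d ∈ Finset.Icc 1 M, (d.totient : ℝ) / (d : ℝ) ^ 2 := by
  have hinner : ∀ d ∈ Finset.Icc 1 M,
      ∑ n ∈ (Finset.Icc 1 M).filter (d ∣ ·), ((n : ℝ) ^ 2)⁻¹ ≤ 2 * ((d : ℝ) ^ 2)⁻¹ := by
    intro d hd
    have hd1 : 1 ≤ d := (Finset.mem_Icc.1 hd).1
    calc ∑ n ∈ (Finset.Icc 1 M).filter (d ∣ ·), ((n : ℝ) ^ 2)⁻¹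
        ≤ ∑ n ∈ (Finset.Icc 1 M).image (d * ·), ((n : ℝ) ^ 2)⁻¹ := by
          refine Finset.sum_le_sum_of_subset_of_nonneg ?_ fun _ _ _ => by positivity
          intro n hn
          obtain ⟨hn, m, rfl⟩ := Finset.mem_filter.1 hn
          rw [Finset.mem_Icc] at hn
          refine Finset.mem_image.2 ⟨m, Finset.mem_Icc.2 ⟨?_, ?_⟩, rfl⟩
          · exact Nat.pos_of_ne_zero fun hm => by simp [hm] at hn
          · exact (Nat.le_mul_of_pos_left m hd1).trans hn.2
      _ = (∑ m ∈ Finset.Icc 1 M, ((m : ℝ) ^ 2)⁻¹) * ((d : ℝ) ^ 2)⁻¹ := by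
          rw [Finset.sum_image fun a _ b _ h => Nat.eq_of_mul_eq_mul_left hd1 h, Finset.sum_mul]
          refine Finset.sum_congr rfl fun m _ => ?_
          push_cast
          rw [mul_pow, mul_inv, mul_comm]
      _ ≤ 2 * ((d : ℝ) ^ 2)⁻¹ := by
          gcongr
          exact sum_Icc_inv_sq_le_two M
  calc Real.log (M + 1) ≤ ((harmonic M : ℚ) : ℝ) := by
        exact_mod_cast log_add_one_le_harmonic M
    _ = ∑ n ∈ Finset.Icc 1 M, ∑ d ∈ n.divisors, (d.totient : ℝ) * ((n : ℝ) ^ 2)⁻¹ := by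
        rw [harmonic_eq_sum_Icc]
        push_cast
        refine Finset.sum_congr rfl fun n hn => ?_
        have hn0 : (n : ℝ) ≠ 0 := by
          have := (Finset.mem_Icc.1 hn).1
          positivity
        rw [← Finset.sum_mul, ← Nat.cast_sum, Nat.sum_totient]
        field_simp
    _ = ∑ d ∈ Finset.Icc 1 M, ∑ n ∈ (Finset.Icc 1 M).filter (d ∣ ·),
          (d.totient : ℝ) * ((n : ℝ) ^ 2)⁻¹ := by
        refine Finset.sum_comm' fun n d => ?_
        simp only [Finset.mem_Icc, Nat.mem_divisors, Finset.mem_filter]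
        constructor
        · rintro ⟨⟨h1, h2⟩, h3, -⟩
          exact ⟨⟨⟨h1, h2⟩, h3⟩, Nat.pos_of_dvd_of_pos h3 h1, (Nat.le_of_dvd h1 h3).trans h2⟩
        · rintro ⟨⟨⟨h1, h2⟩, h3⟩, -⟩
          exact ⟨⟨h1, h2⟩, h3, by omega⟩
    _ ≤ ∑ d ∈ Finset.Icc 1 M, (d.totient : ℝ) * (2 * ((d : ℝ) ^ 2)⁻¹) := by
        refine Finset.sum_le_sum fun d hd => ?_
        rw [← Finset.mul_sum]
        gcongr
        exact hinner d hd
    _ = 2 * ∑ d ∈ Finset.Icc 1 M, (d.totient : ℝ) / (d : ℝ) ^ 2 := by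
        rw [Finset.mul_sum]
        exact Finset.sum_congr rfl fun d _ => by ring

theorem sq_mul_log_le_sum_totient_mul_div_sq (M : ℕ) :
    (M : ℝ) ^ 2 * Real.log (M + 1) ≤
      8 * ((∑ q ∈ Finset.Icc 1 M, q.totient * (M / q) ^ 2 : ℕ) : ℝ) := by
  have hterm : ∀ q ∈ Finset.Icc 1 M,
      (M : ℝ) ^ 2 * ((q.totient : ℝ) / (q : ℝ) ^ 2) ≤ 4 * ((q.totient * (M / q) ^ 2 : ℕ) : ℝ) := by
    intro q hq
    obtain ⟨hq1, hqM⟩ := Finset.mem_Icc.1 hq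
    have hq0 : (0 : ℝ) < q := by exact_mod_cast hq1
    have hM : M ≤ 2 * (q * (M / q)) := by
      have h1 := Nat.div_add_mod M q
      have h2 := Nat.mod_lt M hq1
      have h3 := Nat.le_mul_of_pos_right q (Nat.div_pos hqM hq1)
      omega
    have hM' : (M : ℝ) / q ≤ 2 * ((M / q : ℕ) : ℝ) := by
      rw [div_le_iff₀ hq0]
      have : (M : ℝ) ≤ 2 * (q * ((M / q : ℕ) : ℝ)) := by exact_mod_cast hM
      linarith
    calc (M : ℝ) ^ 2 * ((q.totient : ℝ) / (q : ℝ) ^ 2)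
        = (q.totient : ℝ) * ((M : ℝ) / q) ^ 2 := by ring
      _ ≤ (q.totient : ℝ) * (2 * ((M / q : ℕ) : ℝ)) ^ 2 := by gcongr
      _ = 4 * ((q.totient * (M / q) ^ 2 : ℕ) : ℝ) := by push_cast; ring
  have h := Finset.sum_le_sum hterm
  rw [← Finset.mul_sum, ← Finset.mul_sum, ← Nat.cast_sum] at h
  have := mul_le_mul_of_nonneg_left (log_le_two_mul_sum_totient_div_sq M) (sq_nonneg (M : ℝ))
  linarith

/-- The quadruples `((ξ₁, ξ₂), (ξ₃, ξ₄))` in `[-N, N]²` with `ξ₁ + ξ₂ = ξ₃ + ξ₄` and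
`|ξ₁|² + |ξ₂|² = |ξ₃|² + |ξ₄|²`, that is, the rectangles with vertices in the box. -/
noncomputable def resonantQuadruples (N : ℕ) : Finset (((ℤ × ℤ) × (ℤ × ℤ)) × ((ℤ × ℤ) × (ℤ × ℤ))) :=
  let F := Finset.Icc (-(N : ℤ)) N ×ˢ Finset.Icc (-(N : ℤ)) N
  ((F ×ˢ F) ×ˢ (F ×ˢ F)).filter fun q =>
    q.1.1.1 + q.1.2.1 - q.2.1.1 - q.2.2.1 = 0 ∧
    q.1.1.2 + q.1.2.2 - q.2.1.2 - q.2.2.2 = 0 ∧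
    q.1.1.1 ^ 2 + q.1.1.2 ^ 2 + (q.1.2.1 ^ 2 + q.1.2.2 ^ 2)
      - (q.2.1.1 ^ 2 + q.2.1.2 ^ 2) - (q.2.2.1 ^ 2 + q.2.2.2 ^ 2) = 0

theorem eq_of_mul_eq_mul_of_coprime {p q k p' q' k' : ℕ} (h : q.Coprime p) (h' : q'.Coprime p')
    (hk : 0 < k) (hp : p * k = p' * k') (hq : q * k = q' * k') : p = p' ∧ q = q' ∧ k = k' := by
  have hkk : k = k' := by
    have h1 := Nat.gcd_mul_right q k p
    have h2 := Nat.gcd_mul_right q' k' p'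
    rw [hp, hq, h2, h.gcd_eq_one, h'.gcd_eq_one] at h1
    omega
  subst hkk
  exact ⟨Nat.eq_of_mul_eq_mul_right hk hp, Nat.eq_of_mul_eq_mul_right hk hq, rfl⟩

/-- The rectangle with corner `a` and sides `k (p, q)` and `l (-q, p)`. -/
theorem le_card_resonantQuadruples (N : ℕ) :
    (N + 1) ^ 2 * ∑ q ∈ Finset.Icc 1 (N / 2), q.totient * (N / 2 / q) ^ 2 ≤
      (resonantQuadruples N).card := by
  set M := N / 2 with hM
  have hMN : 2 * M ≤ N := Nat.mul_div_le N 2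
  let A : Finset ((ℕ × ℕ) × (Σ _ : ℕ, ℕ × (ℕ × ℕ))) :=
    (Finset.range (N + 1) ×ˢ Finset.range (N + 1)) ×ˢ
      (Finset.Icc 1 M).sigma fun q =>
        (Finset.range q).filter q.Coprime ×ˢ (Finset.Icc 1 (M / q) ×ˢ Finset.Icc 1 (M / q))
  have hA : A.card = (N + 1) ^ 2 * ∑ q ∈ Finset.Icc 1 M, q.totient * (M / q) ^ 2 := by
    simp [A, Finset.card_sigma, Nat.totient, sq]
  rw [← hA]
  let f : (ℕ × ℕ) × (Σ _ : ℕ, ℕ × (ℕ × ℕ)) → ((ℤ × ℤ) × (ℤ × ℤ)) × ((ℤ × ℤ) × (ℤ × ℤ)) :=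
    fun z =>
      let a : ℤ := M - N + z.1.1
      let b : ℤ := -N + z.1.2
      let v₁ : ℤ := (z.2.2.1 * z.2.2.2.1 : ℕ)
      let v₂ : ℤ := (z.2.1 * z.2.2.2.1 : ℕ)
      let w₁ : ℤ := (z.2.1 * z.2.2.2.2 : ℕ)
      let w₂ : ℤ := (z.2.2.1 * z.2.2.2.2 : ℕ)
      (((a, b), (a + v₁ - w₁, b + v₂ + w₂)), ((a + v₁, b + v₂), (a - w₁, b + w₂)))
  refine Finset.card_le_card_of_injOn f ?_ ?_
  · rintro ⟨⟨i, j⟩, ⟨q, p, k, l⟩⟩ hz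
    simp only [A, Finset.mem_coe, Finset.mem_product, Finset.mem_range,
      Finset.mem_sigma, Finset.mem_Icc, Finset.mem_filter] at hz
    obtain ⟨⟨hi, hj⟩, ⟨hq1, hqM⟩, ⟨hpq, -⟩, ⟨hk1, hk⟩, ⟨hl1, hl⟩⟩ := hz
    have hqk : q * k ≤ M := (Nat.mul_le_mul_left q hk).trans (Nat.mul_div_le M q)
    have hql : q * l ≤ M := (Nat.mul_le_mul_left q hl).trans (Nat.mul_div_le M q)
    have hpk : p * k ≤ M := (Nat.mul_le_mul_right k hpq.le).trans hqk
    have hpl : p * l ≤ M := (Nat.mul_le_mul_right l hpq.le).trans hql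
    simp only [f, resonantQuadruples, Finset.coe_filter, Finset.mem_product, Finset.mem_Icc,
      Set.mem_ofPred_eq]
    refine ⟨⟨⟨⟨⟨?_, ?_⟩, ?_, ?_⟩, ⟨?_, ?_⟩, ?_, ?_⟩, ⟨⟨?_, ?_⟩, ?_, ?_⟩, ⟨?_, ?_⟩, ?_, ?_⟩,
      by ring, by ring, by push_cast; ring⟩ <;> omega
  · rintro ⟨⟨i, j⟩, ⟨q, p, k, l⟩⟩ hz ⟨⟨i', j'⟩, ⟨q', p', k', l'⟩⟩ hz' hff
    simp only [A, Finset.mem_coe, Finset.mem_product, Finset.mem_range,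
      Finset.mem_sigma, Finset.mem_Icc, Finset.mem_filter] at hz hz'
    obtain ⟨⟨hi, hj⟩, ⟨hq1, hqM⟩, ⟨hpq, hc⟩, ⟨hk1, hk⟩, ⟨hl1, hl⟩⟩ := hz
    obtain ⟨⟨hi', hj'⟩, ⟨hq1', hqM'⟩, ⟨hpq', hc'⟩, ⟨hk1', hk'⟩, ⟨hl1', hl'⟩⟩ := hz'
    simp only [f, Prod.mk.injEq] at hff
    obtain ⟨⟨⟨h1, h2⟩, -⟩, ⟨h3, h4⟩, h5, h6⟩ := hff
    obtain ⟨rfl, rfl, rfl⟩ := eq_of_mul_eq_mul_of_coprime hc hc' hk1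
      (show p * k = p' * k' by omega) (show q * k = q' * k' by omega)
    have hl : l = l' := Nat.eq_of_mul_eq_mul_left hq1 (show q * l = q * l' by omega)
    obtain rfl : i = i' := by omega
    obtain rfl : j = j' := by omega
    subst hl
    rfl

theorem integral_exp_int_mul (n : ℤ) :
    ∫ x in (0 : ℝ)..(2 * π), Complex.exp (Complex.I * (n * x)) =
      if n = 0 then (2 * π : ℂ) else 0 := by
  split_ifs with h
  · simp [h]
  · have hc : Complex.I * n ≠ 0 := by simp [h]
    simp_rw [← mul_assoc]
    rw [integral_exp_mul_complex hc]
    have : Complex.exp (Complex.I * n * ((2 * π : ℝ) : ℂ)) = 1 := by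
      rw [Complex.exp_eq_one_iff]
      exact ⟨n, by push_cast; ring⟩
    simp [-Complex.ofReal_mul, this]

theorem setIntegral_Icc_exp (n m : ℤ) (z : ℂ) :
    ∫ x in Set.Icc ((0 : ℝ), (0 : ℝ)) (2 * π, 2 * π),
        Complex.exp (Complex.I * (n * x.1 + m * x.2 - z)) =
      Complex.exp (-(Complex.I * z)) * if n = 0 ∧ m = 0 then (2 * π : ℂ) ^ 2 else 0 := by
  have hint (n : ℤ) : ∫ x in Set.Icc (0 : ℝ) (2 * π), Complex.exp (Complex.I * (n * x)) =
      if n = 0 then (2 * π : ℂ) else 0 := by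
    rw [integral_Icc_eq_integral_Ioc, ← intervalIntegral.integral_of_le (by positivity),
      integral_exp_int_mul]
  have hexp (x : ℝ × ℝ) : Complex.exp (Complex.I * (n * x.1 + m * x.2 - z)) =
      Complex.exp (-(Complex.I * z)) *
        (Complex.exp (Complex.I * (n * x.1)) * Complex.exp (Complex.I * (m * x.2))) := by
    simp only [← Complex.exp_add]
    ring_nf
  simp_rw [hexp]
  rw [integral_const_mul, Set.Icc_prod_eq, Measure.volume_eq_prod,
    setIntegral_prod_mul (fun x : ℝ => Complex.exp (Complex.I * (n * x)))
      (fun x : ℝ => Complex.exp (Complex.I * (m * x))), hint, hint]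
  congr 1
  split_ifs <;> simp_all [sq]

theorem integral_sum_exp {ι : Type*} (s : Finset ι) (a b c : ι → ℤ) :
    ∫ t in (0 : ℝ)..(2 * π), ∫ x in Set.Icc ((0 : ℝ), (0 : ℝ)) (2 * π, 2 * π),
        ∑ i ∈ s, Complex.exp (Complex.I * (a i * x.1 + b i * x.2 - t * c i)) =
      (2 * π : ℂ) ^ 3 * (s.filter fun i => a i = 0 ∧ b i = 0 ∧ c i = 0).card := by
  have hx (t : ℝ) : ∫ x in Set.Icc ((0 : ℝ), (0 : ℝ)) (2 * π, 2 * π),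
        ∑ i ∈ s, Complex.exp (Complex.I * (a i * x.1 + b i * x.2 - t * c i)) =
      ∑ i ∈ s, Complex.exp (Complex.I * ((-c i : ℤ) * t)) *
        if a i = 0 ∧ b i = 0 then (2 * π : ℂ) ^ 2 else 0 := by
    rw [integral_finsetSum]
    · refine Finset.sum_congr rfl fun i _ => ?_
      rw [setIntegral_Icc_exp]
      push_cast
      ring_nf
    · intro i _
      exact (Continuous.continuousOn (by fun_prop)).integrableOn_compact isCompact_Icc
  simp_rw [hx]
  rw [intervalIntegral.integral_finsetSum]
  · rw [Finset.card_filter, Nat.cast_sum, Finset.mul_sum]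
    refine Finset.sum_congr rfl fun i _ => ?_
    rw [intervalIntegral.integral_mul_const, integral_exp_int_mul]
    by_cases ha : a i = 0 <;> by_cases hb : b i = 0 <;> by_cases hc : c i = 0 <;>
      simp [ha, hb, hc]
    ring
  · intro i _
    exact (Continuous.intervalIntegrable (by fun_prop) _ _)

theorem ofReal_norm_sum_pow_four {ι : Type*} (s : Finset ι) (f : ι → ℂ) :
    ((‖∑ i ∈ s, f i‖ ^ 4 : ℝ) : ℂ) = ∑ q ∈ (s ×ˢ s) ×ˢ (s ×ˢ s),
      f q.1.1 * f q.1.2 * (starRingEnd ℂ (f q.2.1) * starRingEnd ℂ (f q.2.2)) := by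
  have h : ((‖∑ i ∈ s, f i‖ ^ 4 : ℝ) : ℂ) =
      ((∑ i ∈ s, f i) * ∑ i ∈ s, f i) *
        ((∑ i ∈ s, starRingEnd ℂ (f i)) * ∑ i ∈ s, starRingEnd ℂ (f i)) := by
    rw [← map_sum, mul_mul_mul_comm, Complex.mul_conj']
    push_cast
    ring
  rw [h, Finset.sum_mul_sum, Finset.sum_mul_sum, ← Finset.sum_product', ← Finset.sum_product',
    Finset.sum_mul_sum, ← Finset.sum_product']

theorem integral_norm_pow_four_eq_card (N : ℕ) :
    ∫ t in (0:ℝ)..(2 * π),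
        ∫ x in Set.Icc ((0:ℝ), (0:ℝ)) ((2 * π), (2 * π)),
          ‖∑ ξ ∈ (Finset.Icc (-(N:ℤ)) (N:ℤ)) ×ˢ (Finset.Icc (-(N:ℤ)) (N:ℤ)),
              Complex.exp (Complex.I *
                ((ξ.1 : ℂ) * (x.1 : ℂ) + (ξ.2 : ℂ) * (x.2 : ℂ)
                  - (t : ℂ) * ((ξ.1 : ℂ) ^ 2 + (ξ.2 : ℂ) ^ 2)))‖ ^ 4 =
      (2 * π) ^ 3 * (resonantQuadruples N).card := by
  apply Complex.ofReal_injective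
  rw [← intervalIntegral.integral_ofReal]
  simp_rw [← integral_complex_ofReal, ofReal_norm_sum_pow_four]
  push_cast
  rw [resonantQuadruples, ← integral_sum_exp]
  congr! 5 with t x q
  simp only [← Complex.exp_conj, ← Complex.exp_add, map_mul, map_sub, map_add, map_pow,
    Complex.conj_I, Complex.conj_ofReal, map_intCast]
  push_cast
  ring_nf

theorem four_pow_log_le_card (N : ℕ) (hN : 2 ≤ N) :
    (2 * (N : ℝ) + 1) ^ 4 * Real.log N ≤ 10000 * (resonantQuadruples N).card := by
  have hN' : (2 : ℝ) ≤ N := by exact_mod_cast hN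
  set M := N / 2 with hM
  have hM3 : (N : ℝ) ≤ 3 * M := by
    have : N ≤ 3 * M := by omega
    exact_mod_cast this
  have hM2 : (N : ℝ) + 1 ≤ 2 * (M + 1) := by
    have : N + 1 ≤ 2 * (M + 1) := by omega
    exact_mod_cast this
  have hlog : Real.log N ≤ 2 * Real.log (M + 1) := by
    have : Real.log N ≤ Real.log (((M : ℝ) + 1) ^ 2) :=
      Real.log_le_log (by linarith) (by nlinarith [sq_nonneg ((N : ℝ) - 1)])
    simpa [Real.log_pow] using this
  have hlog0 : 0 ≤ Real.log N := Real.log_nonneg (by linarith)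
  have hcard : ((N : ℝ) + 1) ^ 2 * ((∑ q ∈ Finset.Icc 1 M, q.totient * (M / q) ^ 2 : ℕ) : ℝ) ≤
      (resonantQuadruples N).card := by exact_mod_cast le_card_resonantQuadruples N
  have hsum := sq_mul_log_le_sum_totient_mul_div_sq M
  calc (2 * (N : ℝ) + 1) ^ 4 * Real.log N
      = ((2 * (N : ℝ) + 1) ^ 2 * (2 * (N : ℝ) + 1) ^ 2) * Real.log N := by ring
    _ ≤ ((2 * ((N : ℝ) + 1)) ^ 2 * (12 * M) ^ 2) * (2 * Real.log (M + 1)) := by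
        gcongr <;> linarith
    _ = 1152 * (((N : ℝ) + 1) ^ 2 * ((M : ℝ) ^ 2 * Real.log (M + 1))) := by ring
    _ ≤ 1152 * (((N : ℝ) + 1) ^ 2 *
          (8 * ((∑ q ∈ Finset.Icc 1 M, q.totient * (M / q) ^ 2 : ℕ) : ℝ))) := by gcongr
    _ ≤ 10000 * (resonantQuadruples N).card := by
        have : (0 : ℝ) ≤ (resonantQuadruples N).card := Nat.cast_nonneg _
        linarith

/-- **Sharpness of the logarithmic loss (estimate (1.1)).**
There exists `c > 0` such that for every integer `N ≥ 2`, the free Schrödinger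
evolution `u(t,x) = ∑_{ξ ∈ [-N,N]²∩ℤ²} exp(i(ξ·x − t|ξ|²))` of the data with
Fourier coefficients `χ_{[-N,N]²∩ℤ²}` satisfies
`‖u‖_{L⁴([0,2π]×𝕋²)} ≥ c (ln N)^{1/4} (2N+1)`, where `2N+1` is the ℓ² norm of
the coefficients. -/
theorem sharp_L4_strichartz_lower_bound :
    ∃ c : ℝ, 0 < c ∧
      ∀ N : ℕ, 2 ≤ N →
        c * (Real.log (N : ℝ)) ^ ((1:ℝ)/4) * (2 * (N : ℝ) + 1) ≤
          (∫ t in (0:ℝ)..(2 * π),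
              ∫ x in Set.Icc ((0:ℝ), (0:ℝ)) ((2 * π), (2 * π)),
                ‖∑ ξ ∈ (Finset.Icc (-(N:ℤ)) (N:ℤ)) ×ˢ (Finset.Icc (-(N:ℤ)) (N:ℤ)),
                    Complex.exp (Complex.I *
                      ((ξ.1 : ℂ) * (x.1 : ℂ) + (ξ.2 : ℂ) * (x.2 : ℂ)
                        - (t : ℂ) * ((ξ.1 : ℂ) ^ 2 + (ξ.2 : ℂ) ^ 2)))‖ ^ 4) ^ ((1:ℝ)/4) := by
  refine ⟨1 / 10, by norm_num, fun N hN => ?_⟩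
  rw [integral_norm_pow_four_eq_card]
  have hlog : 0 ≤ Real.log N := Real.log_natCast_nonneg N
  have hfourth : (1 / 10 * Real.log N ^ ((1 : ℝ) / 4) * (2 * (N : ℝ) + 1)) =
      (((2 * (N : ℝ) + 1) ^ 4 * Real.log N) / 10000) ^ ((1 : ℝ) / 4) := by
    have hbase : ((2 * (N : ℝ) + 1) ^ 4 * Real.log N) / 10000 =
        ((2 * (N : ℝ) + 1) / 10) ^ 4 * Real.log N := by ring
    have hroot : (((2 * (N : ℝ) + 1) / 10) ^ 4) ^ ((1 : ℝ) / 4) = (2 * (N : ℝ) + 1) / 10 := by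
      rw [one_div]
      exact_mod_cast Real.pow_rpow_inv_natCast (by positivity) four_ne_zero
    rw [hbase, Real.mul_rpow (by positivity) hlog, hroot]
    ring
  rw [hfourth]
  refine Real.rpow_le_rpow (by positivity) ?_ (by norm_num)
  have hπ : (1 : ℝ) ≤ (2 * π) ^ 3 := one_le_pow₀ (by linarith [Real.pi_gt_three])
  have hcard := le_mul_of_one_le_left (Nat.cast_nonneg (resonantQuadruples N).card) hπ
  linarith [four_pow_log_le_card N hN]
end
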